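/- Let Λ be a cyclic, non-selfinjective Nakayama algebra of infinite global dimension. Then there exists d ≥ 0 such that the d-th syzygy filtered algebra ε^d(Λ) is a cyclic Nakayama algebra with 1 ≤ findim ε^d(Λ) ≤ 2, and findim Λ = 2d + findim ε^d(Λ). -/

import Mathlib

open Function DirectSum
open scoped Classical

noncomputable section

section Preamble

variable (A : Type) [Ring A]

/-- A submodule is small (superfluous) if it has no proper supplement. -/
def IsSmallSubmodule {M : Type} [AddCommGroup M] [Module A M] (N : Submodule A M) : Prop :=
  ∀ K : Submodule A M, N ⊔ K = ⊤ → K = ⊤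

/-- `P` is a projective cover of `M`: `P` is projective, finitely generated, and there is a
surjection `P → M` with small (superfluous) kernel. -/
def IsProjCoverOf (P M : ModuleCat.{0} A) : Prop :=
  Module.Projective A ↥P ∧ Module.Finite A ↥P ∧
    ∃ f : ↥P →ₗ[A] ↥M, Function.Surjective f ∧ IsSmallSubmodule A (LinearMap.ker f)

/-- `N` is (isomorphic to) the syzygy `Ω(M)`, i.e. the kernel of a projective cover of `M`. -/
def IsSyzygyOf (N M : ModuleCat.{0} A) : Prop :=
  ∃ (P : ModuleCat.{0} A) (f : ↥P →ₗ[A] ↥M),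
    Module.Projective A ↥P ∧ Module.Finite A ↥P ∧ Function.Surjective f ∧
      IsSmallSubmodule A (LinearMap.ker f) ∧ Nonempty (↥N ≃ₗ[A] ↥(LinearMap.ker f))

/-- `N` is (isomorphic to) the `n`-th syzygy `Ω^n(M)`. -/
def IsNthSyzygyOf : ℕ → ModuleCat.{0} A → ModuleCat.{0} A → Prop
  | 0 => fun N M => Nonempty (↥N ≃ₗ[A] ↥M)
  | n + 1 => fun N M => ∃ K : ModuleCat.{0} A, IsNthSyzygyOf n K M ∧ IsSyzygyOf A N K

/-- An indecomposable module: nontrivial, with no nontrivial direct sum decomposition. -/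
def IndecomposableModule (M : ModuleCat.{0} A) : Prop :=
  Nontrivial ↥M ∧ ∀ N N' : Submodule A ↥M, IsCompl N N' → N = ⊥ ∨ N = ⊤

/-- A uniserial module: the submodules form a chain. -/
def IsUniserialModule (M : ModuleCat.{0} A) : Prop :=
  ∀ N N' : Submodule A ↥M, N ≤ N' ∨ N' ≤ N

/-- A (one-sided) Nakayama condition: an Artinian ring all of whose finitely generated
indecomposable modules are uniserial. -/
def IsNakayamaRing : Prop :=
  IsArtinianRing A ∧
    ∀ M : ModuleCat.{0} A, Module.Finite A ↥M → IndecomposableModule A M → IsUniserialModule A M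

/-- A Nakayama algebra: all indecomposable finitely generated (left and right) modules
are uniserial. -/
def IsNakayamaAlgebra : Prop := IsNakayamaRing A ∧ IsNakayamaRing Aᵐᵒᵖ

/-- Connectedness: the only central idempotents are `0` and `1`. -/
def IsConnectedRing : Prop :=
  ∀ e : A, IsIdempotentElem e → e ∈ Set.center A → e = 0 ∨ e = 1

/-- A cyclic Nakayama algebra: a connected Nakayama algebra whose quiver is a cyclically
oriented cycle, equivalently with no simple projective module. -/
def IsCyclicNakayama : Prop :=
  IsNakayamaAlgebra A ∧ IsConnectedRing A ∧
    ∀ M : ModuleCat.{0} A, IsSimpleModule A ↥M → ¬ Module.Projective A ↥M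

/-- The projective dimension of a module, computed via minimal projective resolutions:
the least `n` such that `Ω^n(M)` is projective (`⊤ = ∞` if there is none). -/
def projDim (M : ModuleCat.{0} A) : ℕ∞ :=
  sInf ((fun n : ℕ => (n : ℕ∞)) ''
    {n : ℕ | ∃ N : ModuleCat.{0} A, IsNthSyzygyOf A n N M ∧ Module.Projective A ↥N})

/-- The finitistic dimension: the supremum of the (finite) projective dimensions of
finitely generated modules of finite projective dimension. -/
def finDim : ℕ∞ :=
  sSup {d : ℕ∞ | d ≠ ⊤ ∧ ∃ M : ModuleCat.{0} A, Module.Finite A ↥M ∧ projDim A M = d}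

/-- The global dimension: the supremum of the projective dimensions of all finitely
generated modules. -/
def globalDim : ℕ∞ :=
  sSup {d : ℕ∞ | ∃ M : ModuleCat.{0} A, Module.Finite A ↥M ∧ projDim A M = d}

/-- `N` is a direct summand of `M`. -/
def IsDirectSummandOf (N M : ModuleCat.{0} A) : Prop :=
  ∃ C : ModuleCat.{0} A, Nonempty (↥M ≃ₗ[A] (↥N × ↥C))

/-- The delooping level of a module `M`:
`del M = min { d | Ω^d(M) is a direct summand of A ⊕ Ω^{d+1}(M') for some f.g. M' }`. -/
def delMod (M : ModuleCat.{0} A) : ℕ∞ :=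
  sInf ((fun n : ℕ => (n : ℕ∞)) ''
    {d : ℕ | ∃ (M' N N' : ModuleCat.{0} A), Module.Finite A ↥M' ∧
      IsNthSyzygyOf A d N M ∧ IsNthSyzygyOf A (d + 1) N' M' ∧
      IsDirectSummandOf A N (ModuleCat.of A (A × ↥N'))})

/-- The delooping level of the algebra: the supremum over simple modules. -/
def delAlg : ℕ∞ :=
  sSup {d : ℕ∞ | ∃ S : ModuleCat.{0} A, IsSimpleModule A ↥S ∧ delMod A S = d}

/-- A periodic module: `Ω^t(M) ≅ M` for some `t ≥ 1`. -/
def IsPeriodicModule (M : ModuleCat.{0} A) : Prop :=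
  ∃ t : ℕ, 1 ≤ t ∧ IsNthSyzygyOf A t M M

/-- Selfinjectivity: the regular module is injective. -/
def IsSelfinjectiveRing : Prop := Module.Injective A A

/-- The socle of a module: the sum of all simple submodules. -/
def socleOf (M : ModuleCat.{0} A) : Submodule A ↥M :=
  sSup {N : Submodule A ↥M | IsSimpleModule A ↥N}

/-- The radical of a module: `rad M = J(A)·M`. -/
def radOf (M : Type) [AddCommGroup M] [Module A M] : Submodule A M :=
  (Ideal.jacobson (⊥ : Ideal A)) • (⊤ : Submodule A M)

/-- The top of a module: `M / rad M`. -/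
abbrev topOf (M : Type) [AddCommGroup M] [Module A M] :=
  M ⧸ radOf A M

end Preamble

section Phi

variable (A : Type) [Ring A]

/-- Finitely generated indecomposable modules. -/
def FGIndec := {M : ModuleCat.{0} A // Module.Finite A ↥M ∧ IndecomposableModule A M}

/-- Isomorphism as a setoid on finitely generated indecomposable modules. -/
def indecSetoid : Setoid (FGIndec A) where
  r X Y := Nonempty (↥X.1 ≃ₗ[A] ↥Y.1)
  iseqv := ⟨fun _ => ⟨LinearEquiv.refl A _⟩,
            fun h => h.elim fun e => ⟨e.symm⟩,
            fun h h' => h.elim fun e => h'.elim fun e' => ⟨e.trans e'⟩⟩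

/-- Isomorphism classes of finitely generated indecomposable modules. -/
abbrev IndecIso := Quotient (indecSetoid A)

/-- The free abelian group on iso-classes of f.g. indecomposable modules. -/
abbrev K0Group := IndecIso A →₀ ℤ

/-- `f` records a decomposition of `M` as a direct sum of indecomposables with
multiplicities. -/
def IsDecompositionOf (f : IndecIso A →₀ ℕ) (M : ModuleCat.{0} A) : Prop :=
  Nonempty (↥M ≃ₗ[A] DirectSum (Σ x : f.support, Fin (f x.1))
    (fun i => ↥((Quotient.out i.1.1).1)))

/-- The class of `M` in the free abelian group on indecomposables (junk value `0` if no
decomposition exists). -/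
def decompClass (M : ModuleCat.{0} A) : K0Group A :=
  if h : ∃ f : IndecIso A →₀ ℕ, IsDecompositionOf A f M
  then (Classical.choose h).mapRange (fun m : ℕ => (m : ℤ)) (by simp)
  else 0

/-- A choice of syzygy module `Ω(M)` (junk value `0` if no projective cover exists). -/
def syzygyModule (M : ModuleCat.{0} A) : ModuleCat.{0} A :=
  if h : ∃ N : ModuleCat.{0} A, IsSyzygyOf A N M then Classical.choose h
  else ModuleCat.of A PUnit

/-- The Igusa–Todorov endomorphism `L` of the free abelian group on indecomposables,
sending `[M] ↦ [Ω M]`. -/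
def syzygyEnd : AddMonoid.End (K0Group A) :=
  Finsupp.liftAddHom fun x : IndecIso A =>
    (zmultiplesHom (K0Group A)) (decompClass A (syzygyModule A (Quotient.out x).1))

/-- The generators `[X]`, `X` an indecomposable direct summand of `M`, of the subgroup
`⟨add M⟩`. -/
def addGenerators (M : ModuleCat.{0} A) : Set (K0Group A) :=
  {g | ∃ (X : ModuleCat.{0} A) (h : Module.Finite A ↥X ∧ IndecomposableModule A X),
      IsDirectSummandOf A X M ∧ g = Finsupp.single (Quotient.mk (indecSetoid A) ⟨X, h⟩) 1}

/-- The Igusa–Todorov function `φ(M)`: the least `t` at which the rank of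
`L^t⟨add M⟩` stabilizes. -/
def phiMod (M : ModuleCat.{0} A) : ℕ∞ :=
  sInf ((fun n : ℕ => (n : ℕ∞)) ''
    {t : ℕ | ∀ j : ℕ, 1 ≤ j →
      Module.finrank ℤ
        ↥(AddSubgroup.map ((syzygyEnd A) ^ t) (AddSubgroup.closure (addGenerators A M))) =
      Module.finrank ℤ
        ↥(AddSubgroup.map ((syzygyEnd A) ^ (t + j)) (AddSubgroup.closure (addGenerators A M)))})

/-- The `φ`-dimension of the algebra. -/
def phiDim : ℕ∞ :=
  sSup {d : ℕ∞ | ∃ M : ModuleCat.{0} A, Module.Finite A ↥M ∧ phiMod A M = d}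

end Phi

section Epsilon

variable (A : Type) [Ring A]

/-- `T` is (isomorphic to) the socle of some indecomposable projective module. -/
def IsSocleOfIndecProjective (T : ModuleCat.{0} A) : Prop :=
  IsSimpleModule A ↥T ∧ ∃ Q : ModuleCat.{0} A, Module.Projective A ↥Q ∧ Module.Finite A ↥Q ∧
    IndecomposableModule A Q ∧ Nonempty (↥T ≃ₗ[A] ↥(socleOf A Q))

/-- `S` belongs to `S'(Λ)`: `S ≅ S_{i+1}` where `S_i` is a socle of an indecomposable
projective; here `S_{i+1} = top (rad P(S_i))` for the cyclic quiver. -/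
def IsInSPrime (S : ModuleCat.{0} A) : Prop :=
  IsSimpleModule A ↥S ∧ ∃ T P : ModuleCat.{0} A, IsSocleOfIndecProjective A T ∧
    IsProjCoverOf A P T ∧ Nonempty ((topOf A ↥(radOf A ↥P)) ≃ₗ[A] ↥S)

/-- `B` is (isomorphic to) the syzygy filtered algebra
`ε(Λ) = End_Λ(⊕_{S ∈ S'(Λ)} P(S))`. -/
def IsSyzygyFilteredAlgebra (B : Type) [Ring B] : Prop :=
  ∃ (ι : Type) (_ : Fintype ι) (Sf Pf : ι → ModuleCat.{0} A),
    (∀ i, IsInSPrime A (Sf i) ∧ IsProjCoverOf A (Pf i) (Sf i)) ∧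
    (∀ i j, Nonempty (↥(Sf i) ≃ₗ[A] ↥(Sf j)) → i = j) ∧
    (∀ S : ModuleCat.{0} A, IsInSPrime A S → ∃ i, Nonempty (↥S ≃ₗ[A] ↥(Sf i))) ∧
    Nonempty (B ≃+* Module.End A (DirectSum ι fun i => ↥(Pf i)))

/-- `B` is (isomorphic to) the `d`-th iterated syzygy filtered algebra `ε^d(Λ)`,
each intermediate step being a cyclic non-selfinjective Nakayama algebra. -/
def IsIterSyzygyFiltered (d : ℕ) (B : Type) [Ring B] : Prop :=
  ∃ C : ℕ → RingCat.{0},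
    Nonempty (A ≃+* ↥(C 0)) ∧ Nonempty (↥(C d) ≃+* B) ∧
    ∀ i < d, IsCyclicNakayama ↥(C i) ∧ ¬ IsSelfinjectiveRing ↥(C i) ∧
      IsSyzygyFilteredAlgebra ↥(C i) ↥(C (i + 1))

end Epsilon

section Combinatorics

/-- A monotone, strictly inflationary self-map `f` of a locally finite linear order which is
periodic with respect to a shift `σ`. For a cyclic Nakayama ring, the order indexes the
indecomposable projectives along the universal cover of the quiver, and `f i` is the first
index that does not occur in the `i`-th projective. -/
structure PeriodicMap (I : Type) [LinearOrder I] (σ : I ≃o I) (f : I → I) : Prop where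
  lt_shift : ∀ i, i < σ i
  finite_Icc : ∀ a b : I, (Set.Icc a b).Finite
  mono : Monotone f
  comm : ∀ i, f (σ i) = σ (f i)
  lt_map : ∀ i, i < f i

/-- The fibres of `f^m` and of `f^(m+1)` agree. -/
def KernelStable {I : Type} (f : I → I) (m : ℕ) : Prop :=
  ∀ x y, f^[m + 1] x = f^[m + 1] y → f^[m] x = f^[m] y

/-- Pairs `x ≤ f y` identified by `f^(m+1)` are already identified by `f^m`. -/
def ImageKernelStable {I : Type} [LE I] (f : I → I) (m : ℕ) : Prop :=
  ∀ x y, x ≤ f y → f^[m + 1] x = f^[m + 1] (f y) → f^[m] x = f^[m] (f y)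

/-- The sequence `a, b, f a, f b, f² a, …` describing the minimal projective resolution of the
interval module `[a, b)`. -/
def resolutionSeq {I : Type} (f : I → I) : I → I → ℕ → I
  | a, _, 0 => a
  | a, b, n + 1 => resolutionSeq f b (f a) n

/-- Some interval has a resolution sequence without repetitions. -/
def HasInfiniteResolution {I : Type} [LE I] (f : I → I) : Prop :=
  ∃ a b, a ≤ b ∧ b ≤ f a ∧ ∀ k, resolutionSeq f a b k ≠ resolutionSeq f a b (k + 1)

theorem resolutionSeq_even {I : Type} (f : I → I) (a b : I) (m : ℕ) :
    resolutionSeq f a b (2 * m) = f^[m] a := by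
  induction m generalizing a b with
  | zero => rfl
  | succ m ih =>
    change resolutionSeq f (f a) (f b) (2 * m) = _
    rw [ih]; rfl

theorem resolutionSeq_odd {I : Type} (f : I → I) (a b : I) (m : ℕ) :
    resolutionSeq f a b (2 * m + 1) = f^[m] b :=
  resolutionSeq_even f b (f a) m

theorem resolutionSeq_add_two {I : Type} (f : I → I) (a b : I) (k : ℕ) :
    resolutionSeq f a b (k + 2) = f (resolutionSeq f a b k) := by
  induction k generalizing a b with
  | zero => rfl
  | succ k ih => exact ih b (f a)

theorem KernelStable.iterate_eq {I : Type} {f : I → I} {m : ℕ} (h : KernelStable f m) {x y : I}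
    {j : ℕ} (hj : f^[j] x = f^[j] y) : f^[m] x = f^[m] y := by
  rcases le_total j m with hjm | hjm
  · obtain ⟨d, rfl⟩ := Nat.exists_eq_add_of_le' hjm
    rw [iterate_add_apply, iterate_add_apply, hj]
  · obtain ⟨d, rfl⟩ := Nat.exists_eq_add_of_le hjm
    clear hjm
    induction d generalizing x y with
    | zero => exact hj
    | succ d ih =>
      have := ih (x := f x) (y := f y) (by
        rw [← iterate_succ_apply, ← iterate_succ_apply]; exact hj)
      rw [← iterate_succ_apply, ← iterate_succ_apply] at this
      exact h x y this

namespace PeriodicMap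

variable {I : Type} [LinearOrder I] {σ : I ≃o I} {f : I → I}

theorem exists_lt_of_strictMono (h : PeriodicMap I σ f) {y : ℕ → I} (hy : StrictMono y) (b : I) :
    ∃ k, b < y k := by
  by_contra! hc
  refine Set.infinite_range_of_injective hy.injective ((h.finite_Icc (y 0) b).subset ?_)
  rintro _ ⟨k, rfl⟩
  exact ⟨hy.monotone (Nat.zero_le k), hc k⟩

theorem strictMono_shift (h : PeriodicMap I σ f) (a : I) : StrictMono fun k : ℕ => σ^[k] a :=
  strictMono_nat_of_lt_succ fun k => by
    simp only [iterate_succ_apply']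
    exact h.lt_shift _

theorem comm_iterate (h : PeriodicMap I σ f) (m k : ℕ) (x : I) :
    f^[m] (σ^[k] x) = σ^[k] (f^[m] x) :=
  Function.Commute.iterate_iterate (f := f) (g := σ) h.comm m k x

theorem symm_comm (h : PeriodicMap I σ f) (x : I) : f (σ.symm x) = σ.symm (f x) := by
  rw [← σ.injective.eq_iff, ← h.comm]; simp

theorem symm_comm_iterate (h : PeriodicMap I σ f) (m k : ℕ) (x : I) :
    f^[m] (σ.symm^[k] x) = σ.symm^[k] (f^[m] x) :=
  Function.Commute.iterate_iterate (f := f) (g := σ.symm) h.symm_comm m k x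

theorem symm_iterate_lt (_ : PeriodicMap I σ f) {k : ℕ} {a b : I} (hk : a < σ^[k] b) :
    σ.symm^[k] a < b := by
  induction k generalizing b with
  | zero => exact hk
  | succ k ih =>
    rw [iterate_succ_apply] at hk
    rw [iterate_succ_apply', OrderIso.symm_apply_lt]
    exact ih hk

theorem exists_symm_iterate_lt (h : PeriodicMap I σ f) (a b : I) : ∃ k, σ.symm^[k] a < b := by
  obtain ⟨k, hk⟩ := h.exists_lt_of_strictMono (h.strictMono_shift b) a
  exact ⟨k, h.symm_iterate_lt hk⟩

theorem map_lt_map_iterate (h : PeriodicMap I σ f) (m : ℕ) (x : I) : f^[m] x < f^[m] (f x) := by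
  rw [← iterate_succ_apply, iterate_succ_apply']
  exact h.lt_map _

theorem zpow_comm_iterate (h : PeriodicMap I σ f) (m : ℕ) (k : ℤ) (x : I) :
    f^[m] ((σ.toEquiv ^ k : Equiv.Perm I) x) = (σ.toEquiv ^ k : Equiv.Perm I) (f^[m] x) := by
  obtain ⟨k, rfl | rfl⟩ := k.eq_nat_or_neg
  · have e : ∀ z, (σ.toEquiv ^ (k : ℤ) : Equiv.Perm I) z = σ^[k] z := fun z =>
      congrFun (Equiv.Perm.iterate_eq_pow σ.toEquiv k).symm z
    rw [e, e, h.comm_iterate m k x]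
  · have := h.symm_comm_iterate m k x
    have e : ∀ z, (σ.toEquiv ^ (-(k : ℤ)) : Equiv.Perm I) z = σ.symm^[k] z := by
      intro z
      rw [zpow_neg, zpow_natCast, ← inv_pow]
      exact congrFun (Equiv.Perm.iterate_eq_pow (σ.toEquiv⁻¹) k).symm z
    rw [e, e, this]

theorem eq_zero_of_zpow_eq (h : PeriodicMap I σ f) {k : ℤ} {x : I}
    (hk : (σ.toEquiv ^ k : Equiv.Perm I) x = x) : k = 0 := by
  obtain ⟨n, rfl | rfl⟩ := k.eq_nat_or_neg
  · have : σ^[n] x = σ^[0] x := (congrFun (Equiv.Perm.iterate_eq_pow σ.toEquiv n) x).trans hk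
    simpa using (h.strictMono_shift x).injective this
  · have : σ^[n] x = σ^[0] x := by
      rw [zpow_neg, Equiv.Perm.inv_eq_iff_eq] at hk
      exact (congrFun (Equiv.Perm.iterate_eq_pow σ.toEquiv n) x).trans hk.symm
    simpa using (h.strictMono_shift x).injective this

theorem finite_orbits (h : PeriodicMap I σ f) :
    Finite (Quotient (Equiv.Perm.SameCycle.setoid σ.toEquiv)) := by
  rcases isEmpty_or_nonempty I with hI | ⟨⟨a⟩⟩
  · infer_instance
  have := (h.finite_Icc a (σ a)).to_subtype
  refine Finite.of_surjective
    (fun i : Set.Icc a (σ a) => Quotient.mk (Equiv.Perm.SameCycle.setoid σ.toEquiv) i.1) ?_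
  intro q
  induction q using Quotient.inductionOn with | _ i => ?_
  obtain ⟨m, hm⟩ := h.exists_symm_iterate_lt i a
  have hex : ∃ k, a < σ^[k] (σ.symm^[m] i) := h.exists_lt_of_strictMono (h.strictMono_shift _) a
  have hk := Nat.find_spec hex
  have hpos : Nat.find hex ≠ 0 := fun h0 => by
    rw [h0] at hk; exact absurd hm hk.not_gt
  obtain ⟨k, hk'⟩ := Nat.exists_eq_succ_of_ne_zero hpos
  have hlt := Nat.find_min hex (m := k) (by omega)
  rw [hk'] at hk
  refine ⟨⟨_, hk.le, ?_⟩, ?_⟩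
  · rw [iterate_succ_apply']; exact σ.monotone (not_lt.mp hlt)
  · apply Quotient.sound
    change Equiv.Perm.SameCycle σ.toEquiv (σ^[k.succ] (σ.symm^[m] i)) i
    have e1 : σ^[k.succ] (σ.symm^[m] i) = (σ.toEquiv ^ (k.succ : ℤ) : Equiv.Perm I)
        ((σ.toEquiv ^ (-(m : ℤ)) : Equiv.Perm I) i) := by
      rw [zpow_natCast, zpow_neg, zpow_natCast, ← inv_pow]
      rw [← Equiv.Perm.iterate_eq_pow, ← Equiv.Perm.iterate_eq_pow]; rfl
    rw [e1, ← Equiv.Perm.mul_apply, ← zpow_add]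
    exact ⟨-(k.succ + -(m : ℤ)), by
      rw [← Equiv.Perm.mul_apply, ← zpow_add, neg_add_cancel]; rfl⟩

/-- The map induced by `f` on the shift orbits. -/
def orbitMap (h : PeriodicMap I σ f) : Quotient (Equiv.Perm.SameCycle.setoid σ.toEquiv) →
    Quotient (Equiv.Perm.SameCycle.setoid σ.toEquiv) :=
  Quotient.map f fun x y ⟨k, hk⟩ => ⟨k, by rw [← hk]; exact (h.zpow_comm_iterate 1 k x).symm⟩

theorem iterate_eq_of_kernelStable (h : PeriodicMap I σ f) {m : ℕ} (hm : KernelStable f m)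
    (x : I) : ∃ y, f^[m] x = f^[m + 1] y := by
  have := h.finite_orbits
  let mk := Quotient.mk (Equiv.Perm.SameCycle.setoid σ.toEquiv)
  let S := Set.range fun x => mk (f^[m] x)
  have hmaps : Set.MapsTo h.orbitMap S S := by
    rintro _ ⟨x, rfl⟩
    exact ⟨f x, by simp only [← iterate_succ_apply, iterate_succ_apply']; rfl⟩
  have hinj : Set.InjOn h.orbitMap S := by
    rintro _ ⟨x, rfl⟩ _ ⟨y, rfl⟩ hxy
    obtain ⟨k, hk⟩ : Equiv.Perm.SameCycle σ.toEquiv (f (f^[m] x)) (f (f^[m] y)) :=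
      Quotient.exact hxy
    rw [← iterate_succ_apply' f, ← iterate_succ_apply' f, ← h.zpow_comm_iterate] at hk
    exact Quotient.sound ⟨k, by rw [← h.zpow_comm_iterate]; exact hm _ _ hk⟩
  obtain ⟨_, ⟨y, rfl⟩, hy⟩ :=
    (((Set.toFinite S).injOn_iff_bijOn_of_mapsTo hmaps).1 hinj).surjOn ⟨x, rfl⟩
  obtain ⟨k, hk⟩ : Equiv.Perm.SameCycle σ.toEquiv (f (f^[m] y)) (f^[m] x) := Quotient.exact hy
  refine ⟨(σ.toEquiv ^ k : Equiv.Perm I) y, ?_⟩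
  rw [h.zpow_comm_iterate, iterate_succ_apply', hk]

theorem exists_kernelStable (h : PeriodicMap I σ f) : ∃ m, KernelStable f m := by
  have := h.finite_orbits
  let mk := Quotient.mk (Equiv.Perm.SameCycle.setoid σ.toEquiv)
  let S : ℕ → Set _ := fun m => Set.range fun x => mk (f^[m] x)
  have hmaps : ∀ m, h.orbitMap '' S m = S (m + 1) := by
    intro m
    ext q
    constructor
    · rintro ⟨_, ⟨x, rfl⟩, rfl⟩
      exact ⟨x, by simp only [iterate_succ_apply']; rfl⟩
    · rintro ⟨x, rfl⟩
      exact ⟨_, ⟨x, rfl⟩, by simp only [iterate_succ_apply']; rfl⟩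
  have hsub : ∀ m, S (m + 1) ⊆ S m := by
    rintro m _ ⟨x, rfl⟩
    exact ⟨f x, by rfl⟩
  obtain ⟨m, hm⟩ : ∃ m, S (m + 1) = S m := by
    by_contra! hc
    have hlt : StrictAnti fun m => (S m).ncard := strictAnti_nat_of_succ_lt fun m =>
      Set.ncard_lt_ncard ((hsub m).ssubset_of_ne (hc m))
    exact not_strictAnti_of_wellFoundedLT _ hlt
  refine ⟨m, fun x y hxy => ?_⟩
  have hmt : Set.MapsTo h.orbitMap (S m) (S m) := by
    intro q hq
    rw [← hm, ← hmaps]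
    exact ⟨q, hq, rfl⟩
  have hsurj : Set.SurjOn h.orbitMap (S m) (S m) := by
    intro q hq
    rw [hmaps, hm]; exact hq
  have hinj := (((Set.toFinite (S m)).surjOn_iff_bijOn_of_mapsTo hmt).1 hsurj).injOn
  have heq := hinj ⟨x, rfl⟩ ⟨y, rfl⟩ (by
    change mk (f (f^[m] x)) = mk (f (f^[m] y))
    rw [← iterate_succ_apply' f, ← iterate_succ_apply' f, hxy])
  obtain ⟨k, hk⟩ : Equiv.Perm.SameCycle σ.toEquiv (f^[m] x) (f^[m] y) := Quotient.exact heq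
  have : (σ.toEquiv ^ k : Equiv.Perm I) (f^[m + 1] x) = f^[m + 1] x := by
    have h1 := h.zpow_comm_iterate 1 k (f^[m] x)
    simp only [iterate_one] at h1
    rw [iterate_succ_apply', ← h1, hk, ← iterate_succ_apply' f, ← iterate_succ_apply' f, hxy]
  rw [h.eq_zero_of_zpow_eq this] at hk
  simpa using hk

theorem exists_adjoint (h : PeriodicMap I σ f) : ∃ u : I → I, GaloisConnection f u := by
  have key : ∀ j, ∃ t, f t ≤ j ∧ ∀ i, f i ≤ j → i ≤ t := by
    intro j
    obtain ⟨k, hk⟩ := h.exists_symm_iterate_lt (f j) j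
    have hk' := h.symm_comm_iterate 1 k j
    simp only [iterate_one] at hk'
    set a := σ.symm^[k] j
    have hfin : (Set.Icc a j ∩ {i | f i ≤ j}).Finite := (h.finite_Icc a j).inter_of_left _
    have haj : f a ≤ j := by rw [hk']; exact hk.le
    obtain ⟨t, ht, hmax⟩ := hfin.exists_maximalFor id _ ⟨a, ⟨le_rfl, (h.lt_map a).le.trans haj⟩, haj⟩
    refine ⟨t, ht.2, fun i hi => ?_⟩
    rcases le_total i t with hit | hit
    · exact hit
    · exact hmax ⟨⟨ht.1.1.trans hit, (h.lt_map i).le.trans hi⟩, hi⟩ hit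
  choose u hu hu' using key
  exact ⟨u, fun i j => ⟨fun hi => hu' j i hi, fun hi => (h.mono hi).trans (hu j)⟩⟩

theorem dual (h : PeriodicMap I σ f) {u : I → I} (hu : GaloisConnection f u) :
    PeriodicMap Iᵒᵈ σ.symm.dual (OrderDual.toDual ∘ u ∘ OrderDual.ofDual) where
  lt_shift i := by
    change σ.symm (OrderDual.ofDual i) < OrderDual.ofDual i
    rw [OrderIso.symm_apply_lt]; exact h.lt_shift _
  finite_Icc a b := by
    refine (h.finite_Icc (OrderDual.ofDual b) (OrderDual.ofDual a)).subset ?_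
    rintro x ⟨hx, hx'⟩
    exact ⟨hx', hx⟩
  mono := hu.monotone_u.dual
  comm i := by
    change u (σ.symm (OrderDual.ofDual i)) = σ.symm (u (OrderDual.ofDual i))
    refine eq_of_forall_le_iff fun c => ?_
    rw [← hu, OrderIso.le_symm_apply, OrderIso.le_symm_apply, ← hu, h.comm]
  lt_map i := (h.lt_map _).trans_le (hu.l_u_le _)

/-- An automorphism commuting with `f` restricts to the range of `f`. -/
def restrictRange (f : I → I) (τ : I ≃o I) (hτ : ∀ x, f (τ x) = τ (f x)) :
    Set.range f ≃o Set.range f where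
  toFun x := ⟨τ x, by obtain ⟨_, y, rfl⟩ := x; exact ⟨τ y, hτ y⟩⟩
  invFun x := ⟨τ.symm x, by
    obtain ⟨_, y, rfl⟩ := x
    exact ⟨τ.symm y, by rw [← τ.injective.eq_iff, ← hτ]; simp⟩⟩
  left_inv x := by simp
  right_inv x := by simp
  map_rel_iff' := by simp

theorem restrict (h : PeriodicMap I σ f) :
    PeriodicMap (Set.range f) (restrictRange f σ h.comm) (fun x => ⟨f x, x, rfl⟩) where
  lt_shift i := h.lt_shift i.1
  finite_Icc a b := by
    refine Set.Finite.of_finite_image ((h.finite_Icc a.1 b.1).subset ?_)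
      (Subtype.val_injective.injOn)
    rintro _ ⟨x, hx, rfl⟩
    exact hx
  mono _ _ hxy := h.mono hxy
  comm i := Subtype.ext (h.comm i.1)
  lt_map i := h.lt_map i.1

theorem exists_pred (h : PeriodicMap I σ f) (j : I) : ∃ i, i ⋖ j := by
  obtain ⟨k, hk⟩ := h.exists_symm_iterate_lt j j
  have hfin : (Set.Icc (σ.symm^[k] j) j ∩ {i | i < j}).Finite := (h.finite_Icc _ j).inter_of_left _
  obtain ⟨t, ht, hmax⟩ := hfin.exists_maximalFor id _ ⟨_, ⟨le_rfl, hk.le⟩, hk⟩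
  exact ⟨t, ht.2, fun c htc hcj =>
    absurd (hmax ⟨⟨ht.1.1.trans htc.le, hcj.le⟩, hcj⟩ htc.le) (not_le.2 htc)⟩

theorem exists_succ (h : PeriodicMap I σ f) (i : I) : ∃ j, i ⋖ j := by
  have hfin : (Set.Icc i (σ i) ∩ {j | i < j}).Finite := (h.finite_Icc _ _).inter_of_left _
  obtain ⟨t, ht, hmin⟩ := hfin.exists_minimalFor id _
    ⟨_, ⟨(h.lt_shift i).le, le_rfl⟩, h.lt_shift i⟩
  exact ⟨t, ht.2, fun c hic hct =>
    absurd (hmin ⟨⟨hic.le, hct.le.trans ht.1.2⟩, hic⟩ hct.le) (not_le.2 hct)⟩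

theorem resolutionSeq_le_succ (h : PeriodicMap I σ f) {a b : I} (hab : a ≤ b) (hb : b ≤ f a)
    (k : ℕ) : resolutionSeq f a b k ≤ resolutionSeq f a b (k + 1) := by
  induction k generalizing a b with
  | zero => exact hab
  | succ k ih => exact ih hb (h.mono hab)

theorem strictMono_resolutionSeq (h : PeriodicMap I σ f) {a b : I} (hab : a ≤ b) (hb : b ≤ f a)
    (hne : ∀ k, resolutionSeq f a b k ≠ resolutionSeq f a b (k + 1)) :
    StrictMono (resolutionSeq f a b) :=
  strictMono_nat_of_lt_succ fun k => (h.resolutionSeq_le_succ hab hb k).lt_of_ne (hne k)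

/-- A shift of a repetition-free resolution sequence separates adjacent indices from each
other's images. -/
theorem lt_map_of_covBy (h : PeriodicMap I σ f) (hf : HasInfiniteResolution f) {i j : I}
    (hij : i ⋖ j) : j < f i := by
  obtain ⟨a, b, hab, hb, hne⟩ := hf
  have hy := h.strictMono_resolutionSeq hab hb hne
  obtain ⟨k, hk⟩ := h.exists_symm_iterate_lt a i
  let y : ℕ → I := fun t => σ.symm^[k] (resolutionSeq f a b t)
  have hmono : StrictMono (σ.symm^[k]) := σ.symm.strictMono.iterate k
  have hys : StrictMono y := hmono.comp hy
  have hy2 : ∀ t, y (t + 2) = f (y t) := fun t => by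
    simp only [y, resolutionSeq_add_two]
    exact (h.symm_comm_iterate 1 k _).symm
  have hex : ∃ t, i < y t := h.exists_lt_of_strictMono hys i
  have hpos : Nat.find hex ≠ 0 := fun h0 => by
    have := Nat.find_spec hex
    rw [h0] at this
    exact absurd hk this.not_gt
  obtain ⟨t, ht⟩ := Nat.exists_eq_succ_of_ne_zero hpos
  have hle : y t ≤ i := not_lt.1 (Nat.find_min hex (by omega))
  have hlt : i < y (t + 1) := by simpa [ht] using Nat.find_spec hex
  have hj : j ≤ y (t + 1) := not_lt.1 fun hc => hij.2 hlt hc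
  calc j ≤ y (t + 1) := hj
    _ < y (t + 2) := hys (Nat.lt_succ_self _)
    _ = f (y t) := hy2 t
    _ ≤ f i := h.mono hle

theorem ImageKernelStable.kernelStable {f : I → I} (hf : Monotone f) {m : ℕ}
    (h : ImageKernelStable f m) : KernelStable f (m + 1) := by
  intro x y hxy
  rcases le_total x y with hle | hle
  · exact h (f x) y (hf hle) hxy
  · exact (h (f y) x (hf hle) hxy.symm).symm

/-- Finite resolution sequences of intervals terminate after at most `N + 1` steps. -/
def BoundedResolutions {I : Type} [LE I] (f : I → I) (N : ℕ) : Prop :=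
  ∀ a b, a ≤ b → b ≤ f a →
    (∃ k, resolutionSeq f a b k = resolutionSeq f a b (k + 1)) →
    ∃ k ≤ N + 1, resolutionSeq f a b k = resolutionSeq f a b (k + 1)

theorem boundedResolutions_even_iff (h : PeriodicMap I σ f) (m : ℕ) :
    BoundedResolutions f (2 * m) ↔ KernelStable f m := by
  constructor
  · intro hB
    have key : ∀ x y, x ≤ y → f^[m + 1] x = f^[m + 1] y → f^[m] x = f^[m] y := by
      intro x y hxy he
      have hyx : y ≤ f x := by
        by_contra! hc
        have := h.mono.iterate (m + 1) hc.le
        rw [← he] at this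
        exact absurd this (not_le.2 (h.map_lt_map_iterate _ _))
      obtain ⟨k, hk, hk'⟩ := hB x y hxy hyx ⟨2 * (m + 1), by
        rw [resolutionSeq_odd, resolutionSeq_even, he]⟩
      obtain ⟨j, rfl | rfl⟩ := Nat.even_or_odd' k
      · rw [resolutionSeq_odd, resolutionSeq_even] at hk'
        obtain ⟨d, rfl⟩ := Nat.exists_eq_add_of_le' (show j ≤ m by omega)
        rw [iterate_add_apply, iterate_add_apply, hk']
      · rw [resolutionSeq_odd, show 2 * j + 1 + 1 = 2 * (j + 1) by ring, resolutionSeq_even] at hk'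
        obtain ⟨d, hd⟩ := Nat.exists_eq_add_of_le' (show j ≤ m + 1 by omega)
        have h1 := h.map_lt_map_iterate (m + 1) x
        have h2 : f^[m + 1] y = f^[m + 1] (f x) := by
          rw [show m + 1 = d + j by omega, iterate_add_apply, iterate_add_apply, hk']; rfl
        rw [← h2, he] at h1
        exact absurd h1 (lt_irrefl _)
    intro x y hxy
    rcases le_total x y with hle | hle
    · exact key x y hle hxy
    · exact (key y x hle hxy.symm).symm
  · rintro hK a b _ _ ⟨k, hk⟩
    obtain ⟨j, rfl | rfl⟩ := Nat.even_or_odd' k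
    · rw [resolutionSeq_odd, resolutionSeq_even] at hk
      exact ⟨2 * m, by omega, by
        rw [resolutionSeq_odd, resolutionSeq_even]; exact hK.iterate_eq hk⟩
    · rw [resolutionSeq_odd, show 2 * j + 1 + 1 = 2 * (j + 1) by ring, resolutionSeq_even] at hk
      refine ⟨2 * m + 1, by omega, ?_⟩
      rw [resolutionSeq_odd, show 2 * m + 1 + 1 = 2 * (m + 1) by ring, resolutionSeq_even]
      exact hK.iterate_eq (x := b) (y := f a) hk

theorem boundedResolutions_odd_iff (h : PeriodicMap I σ f) (m : ℕ) :
    BoundedResolutions f (2 * m + 1) ↔ ImageKernelStable f m := by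
  constructor
  · intro hB x y hxy he
    have hyx : y ≤ x := by
      by_contra! hc
      have := h.mono.iterate (m + 1) hc.le
      rw [he] at this
      exact absurd this (not_le.2 (h.map_lt_map_iterate _ _))
    obtain ⟨k, hk, hk'⟩ := hB y x hyx hxy ⟨2 * (m + 1) + 1, by
      rw [resolutionSeq_odd, show 2 * (m + 1) + 1 + 1 = 2 * (m + 1 + 1) by ring,
        resolutionSeq_even, he]; rfl⟩
    obtain ⟨j, rfl | rfl⟩ := Nat.even_or_odd' k
    · rw [resolutionSeq_odd, resolutionSeq_even] at hk'
      obtain ⟨d, hd⟩ := Nat.exists_eq_add_of_le' (show j ≤ m + 1 by omega)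
      have h1 := h.map_lt_map_iterate (m + 1) y
      rw [← he, hd, iterate_add_apply, iterate_add_apply, hk'] at h1
      exact absurd h1 (lt_irrefl _)
    · rw [resolutionSeq_odd, show 2 * j + 1 + 1 = 2 * (j + 1) by ring, resolutionSeq_even] at hk'
      obtain ⟨d, rfl⟩ := Nat.exists_eq_add_of_le' (show j ≤ m by omega)
      rw [iterate_add_apply, iterate_add_apply, hk']; rfl
  · rintro hL a b _ hb ⟨k, hk⟩
    have hK := ImageKernelStable.kernelStable h.mono hL
    obtain ⟨j, rfl | rfl⟩ := Nat.even_or_odd' k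
    · rw [resolutionSeq_odd, resolutionSeq_even] at hk
      exact ⟨2 * (m + 1), by omega, by
        rw [resolutionSeq_odd, resolutionSeq_even]; exact hK.iterate_eq hk⟩
    · rw [resolutionSeq_odd, show 2 * j + 1 + 1 = 2 * (j + 1) by ring, resolutionSeq_even] at hk
      refine ⟨2 * m + 1, by omega, ?_⟩
      rw [resolutionSeq_odd, show 2 * m + 1 + 1 = 2 * (m + 1) by ring, resolutionSeq_even]
      exact hL b a hb (hK.iterate_eq (x := b) (y := f a) hk)

theorem exists_boundedResolutions (h : PeriodicMap I σ f) : ∃ N, BoundedResolutions f N := by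
  obtain ⟨m, hm⟩ := h.exists_kernelStable
  exact ⟨2 * m, (h.boundedResolutions_even_iff m).2 hm⟩

theorem iterate_restrict {I : Type} (f : I → I) (m : ℕ) (x : Set.range f) :
    (((fun x : Set.range f => (⟨f x, x, rfl⟩ : Set.range f))^[m] x : Set.range f) : I)
      = f^[m] x := by
  induction m generalizing x with
  | zero => rfl
  | succ m ih => rw [iterate_succ_apply, ih, iterate_succ_apply]

theorem kernelStable_restrict_iff {I : Type} (f : I → I) (m : ℕ) :
    KernelStable (fun x : Set.range f => (⟨f x, x, rfl⟩ : Set.range f)) m ↔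
      KernelStable f (m + 1) := by
  constructor
  · intro h x y hxy
    have := h ⟨f x, x, rfl⟩ ⟨f y, y, rfl⟩ (Subtype.ext (by
      rw [iterate_restrict, iterate_restrict]; exact hxy))
    rwa [Subtype.ext_iff, iterate_restrict, iterate_restrict] at this
  · rintro h ⟨_, x, rfl⟩ ⟨_, y, rfl⟩ hxy
    rw [Subtype.ext_iff, iterate_restrict, iterate_restrict] at *
    exact h x y hxy

theorem imageKernelStable_restrict_iff {f : I → I} (hf : Monotone f) (m : ℕ) :
    ImageKernelStable (fun x : Set.range f => (⟨f x, x, rfl⟩ : Set.range f)) m ↔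
      ImageKernelStable f (m + 1) := by
  constructor
  · intro h x y hle hxy
    have := h ⟨f x, x, rfl⟩ ⟨f y, y, rfl⟩ (hf hle) (Subtype.ext (by
      rw [iterate_restrict, iterate_restrict]; exact hxy))
    rwa [Subtype.ext_iff, iterate_restrict, iterate_restrict] at this
  · rintro h ⟨_, x, rfl⟩ ⟨_, y, rfl⟩ hle hxy
    rw [Subtype.ext_iff, iterate_restrict, iterate_restrict] at *
    rcases le_total x (f y) with hc | hc
    · exact h x y hc hxy
    · have : f x = f (f y) := le_antisymm hle (hf hc)
      change f^[m] (f x) = f^[m] (f (f y))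
      rw [this]

theorem boundedResolutions_restrict_iff (h : PeriodicMap I σ f) (N : ℕ) :
    BoundedResolutions (fun x : Set.range f => (⟨f x, x, rfl⟩ : Set.range f)) N ↔
      BoundedResolutions f (N + 2) := by
  obtain ⟨m, rfl | rfl⟩ := Nat.even_or_odd' N
  · rw [h.restrict.boundedResolutions_even_iff, show 2 * m + 2 = 2 * (m + 1) by ring,
      h.boundedResolutions_even_iff, kernelStable_restrict_iff]
  · rw [h.restrict.boundedResolutions_odd_iff, show 2 * m + 1 + 2 = 2 * (m + 1) + 1 by ring,
      h.boundedResolutions_odd_iff, imageKernelStable_restrict_iff h.mono]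

theorem hasInfiniteResolution_restrict (h : PeriodicMap I σ f) (hf : HasInfiniteResolution f) :
    HasInfiniteResolution (fun x : Set.range f => (⟨f x, x, rfl⟩ : Set.range f)) := by
  obtain ⟨a, b, hab, hb, hne⟩ := hf
  refine ⟨⟨f a, a, rfl⟩, ⟨f b, b, rfl⟩, h.mono hab, h.mono hb, fun k hk => hne (k + 2) ?_⟩
  have key : ∀ (a b : Set.range f) k, ((resolutionSeq
      (fun x : Set.range f => (⟨f x, x, rfl⟩ : Set.range f)) a b k : Set.range f) : I) =
      resolutionSeq f a b k := by
    intro a b k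
    induction k generalizing a b with
    | zero => rfl
    | succ k ih => exact ih _ _
  rw [Subtype.ext_iff, key, key] at hk
  exact hk

theorem _root_.GaloisConnection.iterate {f u : I → I} (hu : GaloisConnection f u) (m : ℕ) :
    GaloisConnection f^[m] u^[m] := by
  induction m with
  | zero => exact GaloisConnection.id
  | succ m ih =>
    intro x y
    rw [iterate_succ_apply, ih, hu, ← iterate_succ_apply' u]

theorem kernelStable_adjoint (h : PeriodicMap I σ f) {u : I → I} (hu : GaloisConnection f u)
    {m : ℕ} (hK : KernelStable f m) : KernelStable u m := by
  have key : ∀ x y, u^[m + 1] x = u^[m + 1] y → u^[m] x ≤ u^[m] y := by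
    intro x y hxy
    rw [← hu.iterate m]
    obtain ⟨w, hw⟩ := h.iterate_eq_of_kernelStable hK (u^[m] x)
    rw [hw, hu.iterate (m + 1), ← hxy, ← hu.iterate (m + 1), ← hw]
    exact (hu.iterate m).l_u_le x
  exact fun x y hxy => le_antisymm (key x y hxy) (key y x hxy.symm)

theorem imageKernelStable_iff (hu' : Monotone f) {u : I → I} (hu : GaloisConnection f u) (m : ℕ) :
    ImageKernelStable f m ↔
      ∀ x, u^[m + 1] (u (f (f^[m] x))) = u^[m + 1] (f^[m] x) := by
  have hx : ∀ x y, y ≤ u^[m + 1] (u (f (f^[m] x))) ↔ f^[m + 1] (f y) ≤ f^[m + 1] x := by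
    intro x y
    rw [← iterate_succ_apply, ← iterate_succ_apply' f, ← hu.iterate, iterate_succ_apply]
  have hx' : ∀ x y, y ≤ u^[m + 1] (f^[m] x) ↔ f^[m] (f y) ≤ f^[m] x := by
    intro x y
    rw [← hu.iterate, iterate_succ_apply]
  constructor
  · intro hL x
    refine eq_of_forall_le_iff fun y => ?_
    rw [hx, hx']
    constructor
    · intro hy
      rcases le_total x (f y) with hc | hc
      · exact (hL x y hc (le_antisymm (hu'.iterate _ hc) hy)).ge
      · exact hu'.iterate _ hc
    · intro hy
      rw [iterate_succ_apply', iterate_succ_apply']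
      exact hu' hy
  · intro hD x y hxy he
    refine le_antisymm (hu'.iterate _ hxy) ?_
    rw [← hx', ← hD, hx]
    exact he.ge

theorem imageKernelStable_dual_iff {u : I → I} (hu : GaloisConnection f u) (m : ℕ) :
    ImageKernelStable (OrderDual.toDual ∘ u ∘ OrderDual.ofDual : Iᵒᵈ → Iᵒᵈ) m ↔
      ∀ x, f^[m + 1] (f (u (u^[m] x))) = f^[m + 1] (u^[m] x) :=
  imageKernelStable_iff (I := Iᵒᵈ) hu.monotone_u.dual hu.dual m

theorem imageKernelStable_adjoint (h : PeriodicMap I σ f) {u : I → I}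
    (hu : GaloisConnection f u) {m : ℕ} (hL : ImageKernelStable f m) :
    ImageKernelStable (OrderDual.toDual ∘ u ∘ OrderDual.ofDual : Iᵒᵈ → Iᵒᵈ) m := by
  rw [imageKernelStable_dual_iff hu]
  intro x
  have hD := (imageKernelStable_iff h.mono hu m).1 hL (u^[m] x)
  have hfix : u^[m] (f^[m] (u^[m] x)) = u^[m] x := (hu.iterate m).u_l_u_eq_u x
  obtain ⟨w, hw⟩ := h.iterate_eq_of_kernelStable
    (ImageKernelStable.kernelStable h.mono hL) (u^[m] x)
  rw [iterate_succ_apply' u, iterate_succ_apply' u, hfix] at hD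
  rw [← iterate_succ_apply, ← hD, ← iterate_succ_apply u, ← iterate_succ_apply' u,
    ← iterate_succ_apply' f m, hw]
  exact (hu.iterate (m + 1 + 1)).l_u_l_eq_l w

theorem kernelStable_dual_iff {I : Type} (u : I → I) (m : ℕ) :
    KernelStable (OrderDual.toDual ∘ u ∘ OrderDual.ofDual : Iᵒᵈ → Iᵒᵈ) m ↔ KernelStable u m :=
  Iff.rfl

theorem boundedResolutions_adjoint (h : PeriodicMap I σ f) {u : I → I}
    (hu : GaloisConnection f u) {N : ℕ} (hN : BoundedResolutions f N) :
    BoundedResolutions (OrderDual.toDual ∘ u ∘ OrderDual.ofDual : Iᵒᵈ → Iᵒᵈ) N := by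
  obtain ⟨m, rfl | rfl⟩ := Nat.even_or_odd' N
  · rw [(h.dual hu).boundedResolutions_even_iff, kernelStable_dual_iff]
    exact h.kernelStable_adjoint hu ((h.boundedResolutions_even_iff m).1 hN)
  · rw [(h.dual hu).boundedResolutions_odd_iff]
    exact h.imageKernelStable_adjoint hu ((h.boundedResolutions_odd_iff m).1 hN)

/-- The length of finite resolutions is invariant under passing to the adjoint map. -/
theorem boundedResolutions_dual_iff (h : PeriodicMap I σ f) {u : I → I}
    (hu : GaloisConnection f u) (N : ℕ) :
    BoundedResolutions (OrderDual.toDual ∘ u ∘ OrderDual.ofDual : Iᵒᵈ → Iᵒᵈ) N ↔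
      BoundedResolutions f N :=
  ⟨fun hN => (h.dual hu).boundedResolutions_adjoint hu.dual hN, h.boundedResolutions_adjoint hu⟩

theorem hasInfiniteResolution_dual (h : PeriodicMap I σ f) {u : I → I}
    (hu : GaloisConnection f u) (hf : HasInfiniteResolution f) :
    HasInfiniteResolution (OrderDual.toDual ∘ u ∘ OrderDual.ofDual : Iᵒᵈ → Iᵒᵈ) := by
  obtain ⟨a, b, hab, hb, hne⟩ := hf
  have hs := h.strictMono_resolutionSeq hab hb hne
  have hlt : ∀ m, f^[m] a < f^[m] b := fun m => by
    have := hs (show 2 * m < 2 * m + 1 by omega)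
    rwa [resolutionSeq_even, resolutionSeq_odd] at this
  have hlt' : ∀ m, f^[m] b < f^[m + 1] a := fun m => by
    have := hs (show 2 * m + 1 < 2 * (m + 1) by omega)
    rwa [resolutionSeq_even, resolutionSeq_odd] at this
  obtain ⟨N, hN⟩ := (h.dual hu).exists_boundedResolutions
  obtain ⟨M, hM⟩ : ∃ M, M = N + 2 := ⟨_, rfl⟩
  have lb : ∀ (c : I) j, j ≤ M → f^[M - j] c ≤ u^[j] (f^[M] c) := by
    intro c j hj
    rw [← hu.iterate, ← iterate_add_apply, Nat.add_sub_cancel' hj]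
  have hA : ∀ j ≤ M, u^[j] (f^[M] a) < u^[j] (f^[M] b) := by
    intro j hj
    refine lt_of_lt_of_le ?_ (lb b j hj)
    rw [← not_le, ← hu.iterate, ← iterate_add_apply, Nat.add_sub_cancel' hj, not_le]
    exact hlt M
  have hC : ∀ j < M, u^[j + 1] (f^[M] b) < u^[j] (f^[M] a) := by
    intro j hj
    refine lt_of_lt_of_le ?_ (lb a j hj.le)
    rw [← not_le, ← hu.iterate, ← iterate_add_apply, show j + 1 + (M - j) = M + 1 by omega, not_le]
    exact hlt' M
  by_contra hc
  unfold HasInfiniteResolution at hc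
  push Not at hc
  have h1 : (OrderDual.toDual (f^[M] b) : Iᵒᵈ) ≤ OrderDual.toDual (f^[M] a) := (hlt M).le
  have h2 : (OrderDual.toDual (f^[M] a) : Iᵒᵈ) ≤
      (OrderDual.toDual ∘ u ∘ OrderDual.ofDual : Iᵒᵈ → Iᵒᵈ) (OrderDual.toDual (f^[M] b)) :=
    (hC 0 (by omega)).le
  obtain ⟨k, hk, hk'⟩ := hN _ _ h1 h2 (hc _ _ h1 h2)
  obtain ⟨j, rfl | rfl⟩ := Nat.even_or_odd' k
  · rw [resolutionSeq_odd, resolutionSeq_even] at hk'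
    exact (hA j (by omega)).ne' hk'
  · rw [resolutionSeq_odd, show 2 * j + 1 + 1 = 2 * (j + 1) by ring, resolutionSeq_even] at hk'
    exact (hC j (by omega)).ne' hk'

end PeriodicMap

end Combinatorics

section SerialSystem

/-- A combinatorial coordinate system for a ring all of whose indecomposable projectives are
uniserial. The idempotents `φ i i` represent the indecomposable projectives, and
`φ i j ∈ φ j j * R * φ i i` generates the submodule of colength `j - i` of the `i`-th projective;
the latter vanishes as soon as `f i ≤ j`. -/
structure SerialSystem (R : Type) [Ring R] (I : Type) [LinearOrder I] (σ : I ≃o I) (f : I → I)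
    (φ : I → I → R) : Prop extends PeriodicMap I σ f where
  mul : ∀ {i j k}, i ≤ j → j ≤ k → φ j k * φ i j = φ i k
  eq_zero : ∀ {i j}, i ≤ j → (φ i j = 0 ↔ f i ≤ j)
  factor : ∀ {i j} {r : R}, φ j j * r = r → r * φ i i = r → r ≠ 0 →
    ∃ j', i ≤ j' ∧ φ j' j' = φ j j ∧ (∃ u, r = u * φ i j') ∧ ∃ v, φ i j' = v * r
  cofactor : ∀ {i j} {r : R}, φ j j * r = r → r * φ i i = r → r ≠ 0 →
    ∃ i', i' ≤ j ∧ φ i' i' = φ i i ∧ (∃ u, r = φ i' j * u) ∧ ∃ v, φ i' j = r * v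
  nilp : ∀ {i j}, i < j → ∀ r, IsNilpotent (r * φ i j)
  full : ∃ (n : ℕ) (k : Fin n → I) (a b : Fin n → R), ∑ t, a t * φ (k t) (k t) * b t = 1
  shift : ∀ i, φ (σ i) (σ i) = φ i i
  conj : ∀ {i j}, φ i i = φ j j → ∃ τ : I ≃o I, τ i = j ∧
    ∀ x, f (τ x) = τ (f x) ∧ φ (τ x) (τ x) = φ x x

theorem isNilpotent_mul_swap {R : Type} [Ring R] {a b : R} (h : IsNilpotent (a * b)) :
    IsNilpotent (b * a) := by
  obtain ⟨n, hn⟩ := h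
  refine ⟨n + 1, ?_⟩
  have key : ∀ m, (b * a) ^ (m + 1) = b * (a * b) ^ m * a := by
    intro m
    induction m with
    | zero => simp
    | succ m ih => rw [pow_succ, ih, pow_succ]; simp only [mul_assoc]
  rw [key, hn]; simp

theorem eq_zero_of_isNilpotent_smul_eq {R M : Type} [Ring R] [AddCommGroup M] [Module R M] {r : R}
    (hr : IsNilpotent r) {x : M} (hx : r • x = x) : x = 0 := by
  obtain ⟨n, hn⟩ := hr
  have : ∀ m : ℕ, r ^ m • x = x := by
    intro m
    induction m with
    | zero => simp
    | succ m ih => rw [pow_succ, mul_smul, hx, ih]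
  rw [← this n, hn, zero_smul]

theorem length_span_lt_of_span_lt {R M : Type} [Ring R] [AddCommGroup M] [Module R M]
    [IsArtinian R M] [IsNoetherian R M] {N N' : Submodule R M} (h : N < N') :
    Module.length R N < Module.length R N' := by
  rw [Module.length_submodule, Module.length_submodule]
  exact Submodule.height_strictMono h

theorem length_span_eq {R M : Type} [Ring R] [AddCommGroup M] [Module R M] (x : M) :
    Module.length R (R ∙ x) = Module.length R (R ⧸ LinearMap.ker (LinearMap.toSpanSingleton R M x)) := by
  rw [← LinearMap.range_toSpanSingleton]
  exact (LinearMap.quotKerEquivRange _).length_eq.symm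

theorem length_span_lt_of_ker_lt {R M N : Type} [Ring R] [IsArtinianRing R] [IsNoetherianRing R]
    [AddCommGroup M] [Module R M] [AddCommGroup N] [Module R N] {x : M} {y : N}
    (h : LinearMap.ker (LinearMap.toSpanSingleton R M x) <
      LinearMap.ker (LinearMap.toSpanSingleton R N y)) :
    Module.length R (R ∙ y) < Module.length R (R ∙ x) := by
  rw [length_span_eq, length_span_eq, Module.length_quotient, Module.length_quotient]
  refine Order.coheight_strictAnti h ?_
  rw [← Module.length_quotient]
  exact (Module.length_ne_top (R := R)).lt_top

namespace SerialSystem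

variable {R : Type} [Ring R] {I : Type} [LinearOrder I] {σ : I ≃o I} {f : I → I}
  {φ : I → I → R}

theorem op (h : SerialSystem R I σ f φ) {u : I → I} (hu : GaloisConnection f u) :
    SerialSystem Rᵐᵒᵖ Iᵒᵈ σ.symm.dual (OrderDual.toDual ∘ u ∘ OrderDual.ofDual)
      (fun i j => MulOpposite.op (φ (OrderDual.ofDual j) (OrderDual.ofDual i))) where
  toPeriodicMap := h.toPeriodicMap.dual hu
  mul hij hjk := by
    rw [← MulOpposite.op_mul]
    exact congrArg _ (h.mul hjk hij)
  eq_zero {i j} hij := by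
    rw [MulOpposite.op_eq_zero_iff]
    exact (h.eq_zero hij).trans (hu _ _)
  factor {i j r} hj hi hr := by
    obtain ⟨i', h1, h2, ⟨u, h3⟩, v, h4⟩ := h.cofactor (i := OrderDual.ofDual j)
      (j := OrderDual.ofDual i) (r := r.unop) (congrArg MulOpposite.unop hi)
      (congrArg MulOpposite.unop hj) (by simpa using hr)
    exact ⟨OrderDual.toDual i', h1, congrArg _ h2, ⟨.op u, MulOpposite.unop_injective h3⟩,
      .op v, congrArg MulOpposite.op h4⟩
  cofactor {i j r} hj hi hr := by
    obtain ⟨i', h1, h2, ⟨u, h3⟩, v, h4⟩ := h.factor (i := OrderDual.ofDual j)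
      (j := OrderDual.ofDual i) (r := r.unop) (congrArg MulOpposite.unop hi)
      (congrArg MulOpposite.unop hj) (by simpa using hr)
    exact ⟨OrderDual.toDual i', h1, congrArg _ h2, ⟨.op u, MulOpposite.unop_injective h3⟩,
      .op v, congrArg MulOpposite.op h4⟩
  nilp {i j} hij r := by
    obtain ⟨n, hn⟩ := isNilpotent_mul_swap
      (h.nilp (i := OrderDual.ofDual j) (j := OrderDual.ofDual i) hij r.unop)
    exact ⟨n, MulOpposite.unop_injective (by simpa using hn)⟩
  full := by
    obtain ⟨n, k, a, b, h1⟩ := h.full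
    refine ⟨n, OrderDual.toDual ∘ k, fun t => .op (b t), fun t => .op (a t),
      MulOpposite.unop_injective ?_⟩
    simpa [mul_assoc] using h1
  shift i := by
    have := h.shift (σ.symm (OrderDual.ofDual i))
    rw [σ.apply_symm_apply] at this
    exact congrArg MulOpposite.op this.symm
  conj {i j} hij := by
    obtain ⟨τ, h1, h2⟩ := h.conj (MulOpposite.op_injective hij)
    refine ⟨τ.dual, h1, fun x => ⟨?_, congrArg _ (h2 _).2⟩⟩
    change u (τ (OrderDual.ofDual x)) = τ (u (OrderDual.ofDual x))
    refine eq_of_forall_le_iff fun c => ?_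
    rw [← hu, ← τ.symm_apply_le, ← τ.symm_apply_le, ← hu]
    have := (h2 (τ.symm c)).1
    rw [τ.apply_symm_apply] at this
    rw [this, τ.symm_apply_apply]

section

variable (h : SerialSystem R I σ f φ)
include h

theorem mul_self (i : I) : φ i i * φ i i = φ i i := h.mul le_rfl le_rfl

theorem left_mul {i j : I} (hij : i ≤ j) : φ j j * φ i j = φ i j := h.mul hij le_rfl

theorem right_mul {i j : I} (hij : i ≤ j) : φ i j * φ i i = φ i j := h.mul le_rfl hij

theorem ne_zero {i j : I} (hij : i ≤ j) (hj : j < f i) : φ i j ≠ 0 := fun h0 =>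
  hj.not_ge ((h.eq_zero hij).1 h0)

theorem self_ne_zero (i : I) : φ i i ≠ 0 := h.ne_zero le_rfl (h.lt_map i)

theorem mem_of_forall {M : Type} [AddCommGroup M] [Module R M] {N : Submodule R M} {x : M}
    (hx : ∀ k b, (φ k k * b) • x ∈ N) : x ∈ N := by
  obtain ⟨n, k, a, b, h1⟩ := h.full
  rw [← one_smul R x, ← h1, Finset.sum_smul]
  refine sum_mem fun t _ => ?_
  rw [mul_assoc, mul_smul]
  exact N.smul_mem _ (hx _ _)

/-- The trace of a left ideal on the `i`-th projective is generated by some `φ i j`. -/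
theorem exists_index (N : Submodule R R) (i : I) : ∃ j, i ≤ j ∧ j ≤ f i ∧ φ i j ∈ N ∧
    (∀ j', i ≤ j' → φ i j' ∈ N → j ≤ j') ∧
    ∀ r, r * φ i i = r → r ∈ N → ∃ a, r = a * φ i j := by
  have hfin : (Set.Icc i (f i) ∩ {j | φ i j ∈ N}).Finite := (h.finite_Icc _ _).inter_of_left _
  obtain ⟨j, ⟨⟨h1, h2⟩, h3⟩, hmin⟩ := hfin.exists_minimalFor id _
    ⟨f i, ⟨(h.lt_map i).le, le_rfl⟩, by
      rw [Set.mem_ofPred_eq, (h.eq_zero (h.lt_map i).le).2 le_rfl]; exact N.zero_mem⟩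
  have hle : ∀ j', i ≤ j' → φ i j' ∈ N → j ≤ j' := by
    intro j' hj' hN
    by_contra! hc
    exact hc.not_ge (hmin ⟨⟨hj', hc.le.trans h2⟩, hN⟩ hc.le)
  refine ⟨j, h1, h2, h3, hle, fun r hr hrN => ?_⟩
  suffices r ∈ R ∙ φ i j by
    obtain ⟨a, ha⟩ := Submodule.mem_span_singleton.1 this
    exact ⟨a, ha.symm⟩
  refine h.mem_of_forall fun k b => ?_
  by_cases h0 : (φ k k * b) • r = 0
  · rw [h0]; exact Submodule.zero_mem _
  obtain ⟨j', hj', -, ⟨u, hu⟩, v, hv⟩ := h.factor (i := i) (j := k) (r := (φ k k * b) • r)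
    (by rw [smul_eq_mul, ← mul_assoc, ← mul_assoc, h.mul_self])
    (by rw [smul_eq_mul, mul_assoc, hr]) h0
  have hj'N : φ i j' ∈ N := by rw [hv]; exact N.smul_mem v (N.smul_mem _ hrN)
  rw [hu, ← h.mul h1 (hle j' hj' hj'N), ← mul_assoc]
  exact Submodule.mem_span_singleton.2 ⟨_, rfl⟩

theorem exists_eq_span {M : Type} [AddCommGroup M] [Module R M] {i : I} {x : M}
    (hx : φ i i • x = x) {N : Submodule R M} (hN : N ≤ R ∙ x) :
    ∃ j, i ≤ j ∧ j ≤ f i ∧ N = R ∙ φ i j • x := by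
  obtain ⟨j, h1, h2, h3, -, h4⟩ := h.exists_index (N.comap (LinearMap.toSpanSingleton R M x)) i
  refine ⟨j, h1, h2, le_antisymm (fun y hy => ?_) ?_⟩
  · obtain ⟨r, rfl⟩ := Submodule.mem_span_singleton.1 (hN hy)
    obtain ⟨a, ha⟩ := h4 (r * φ i i) (by rw [mul_assoc, h.mul_self]) (by
      rwa [Submodule.mem_comap, LinearMap.toSpanSingleton_apply, mul_smul, hx])
    refine Submodule.mem_span_singleton.2 ⟨a, ?_⟩
    rw [← mul_smul, ← ha, mul_smul, hx]
  · rw [Submodule.span_singleton_le_iff_mem]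
    exact h3

theorem span_antitone {M : Type} [AddCommGroup M] [Module R M] {i j k : I} (x : M)
    (hij : i ≤ j) (hjk : j ≤ k) : (R ∙ φ i k • x) ≤ R ∙ φ i j • x := by
  rw [Submodule.span_singleton_le_iff_mem, ← h.mul hij hjk, mul_smul]
  exact Submodule.mem_span_singleton.2 ⟨_, rfl⟩

theorem le_total_of_le_span {M : Type} [AddCommGroup M] [Module R M] {i : I} {x : M}
    (hx : φ i i • x = x) {N N' : Submodule R M} (hN : N ≤ R ∙ x) (hN' : N' ≤ R ∙ x) :
    N ≤ N' ∨ N' ≤ N := by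
  obtain ⟨j, h1, -, rfl⟩ := h.exists_eq_span hx hN
  obtain ⟨j', h1', -, rfl⟩ := h.exists_eq_span hx hN'
  rcases le_total j j' with hj | hj
  · exact .inr (h.span_antitone x h1 hj)
  · exact .inl (h.span_antitone x h1' hj)

theorem finite_Iic_span {M : Type} [AddCommGroup M] [Module R M] {i : I} {x : M}
    (hx : φ i i • x = x) : (Set.Iic (R ∙ x)).Finite := by
  refine ((h.finite_Icc i (f i)).image fun j => R ∙ φ i j • x).subset ?_
  intro N hN
  obtain ⟨j, h1, h2, rfl⟩ := h.exists_eq_span hx hN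
  exact ⟨j, ⟨h1, h2⟩, rfl⟩

theorem finite_submodule_span {M : Type} [AddCommGroup M] [Module R M] {i : I} {x : M}
    (hx : φ i i • x = x) : Finite (Submodule R (R ∙ x)) :=
  have := (h.finite_Iic_span hx).to_subtype
  Finite.of_injective (fun N => (⟨_, (Submodule.map_subtype_le (R ∙ x) N)⟩ : Set.Iic (R ∙ x)))
    fun _ _ hNN' => Submodule.map_injective_of_injective (Submodule.subtype_injective _)
      (congrArg Subtype.val hNN')

theorem exists_surjective : ∃ (n : ℕ) (k : Fin n → I)
    (g : (∀ t, R ∙ φ (k t) (k t)) →ₗ[R] R), Surjective g := by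
  obtain ⟨n, k, a, b, h1⟩ := h.full
  refine ⟨n, k, ∑ t, LinearMap.toSpanSingleton R R (b t) ∘ₗ Submodule.subtype _ ∘ₗ
    LinearMap.proj t, ?_⟩
  rw [← LinearMap.range_eq_top, Ideal.eq_top_iff_one]
  refine ⟨fun t => ⟨a t * φ (k t) (k t), Submodule.mem_span_singleton.2 ⟨a t, rfl⟩⟩, ?_⟩
  simpa using h1

theorem isArtinianRing : IsArtinianRing R := by
  obtain ⟨n, k, g, hg⟩ := h.exists_surjective
  have : ∀ t, IsArtinian R (R ∙ φ (k t) (k t)) := fun t => by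
    have := h.finite_submodule_span (h.mul_self (k t))
    infer_instance
  exact isArtinian_of_surjective _ g hg

theorem isNoetherianRing : IsNoetherianRing R := by
  obtain ⟨n, k, g, hg⟩ := h.exists_surjective
  have : ∀ t, IsNoetherian R (R ∙ φ (k t) (k t)) := fun t => by
    have := h.finite_submodule_span (h.mul_self (k t))
    rw [isNoetherian_iff']
    infer_instance
  exact isNoetherian_of_surjective g (LinearMap.range_eq_top.2 hg)

/-- Elements of `R` with the same target are comparable under right divisibility. -/
theorem right_comparable {i j k : I} {α β : R} (hα : φ k k * α = α) (hα' : α * φ j j = α)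
    (hβ : φ k k * β = β) (hβ' : β * φ i i = β) :
    (∃ δ, β = α * δ) ∨ ∃ δ, α = β * δ := by
  by_cases h0 : α = 0
  · exact .inr ⟨0, by simp [h0]⟩
  by_cases h1 : β = 0
  · exact .inl ⟨0, by simp [h1]⟩
  obtain ⟨a, ha, -, ⟨u, hu⟩, v, hv⟩ := h.cofactor hα hα' h0
  obtain ⟨b, hb, -, ⟨u', hu'⟩, v', hv'⟩ := h.cofactor hβ hβ' h1
  rcases le_total a b with hab | hab
  · refine .inr ⟨v' * φ a b * u, ?_⟩
    rw [← mul_assoc, ← mul_assoc, ← hv', h.mul hab hb, ← hu]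
  · refine .inl ⟨v * φ b a * u', ?_⟩
    rw [← mul_assoc, ← mul_assoc, ← hv, h.mul hab ha, ← hu']

/-- A left invertible corner element is right invertible. -/
theorem exists_right_inv {j : I} {δ v : R} (hδ : φ j j * δ = δ) (hδ' : δ * φ j j = δ)
    (hv : v * δ = φ j j) : ∃ w, δ * w = φ j j := by
  have h0 : δ ≠ 0 := fun h0 => h.self_ne_zero j (by rw [← hv, h0, mul_zero])
  obtain ⟨i', hi', he, ⟨u, hu⟩, w, hw⟩ := h.cofactor hδ hδ' h0
  rcases hi'.lt_or_eq with hlt | rfl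
  · obtain ⟨n, hn⟩ := isNilpotent_mul_swap (h.nilp hlt u)
    rw [← hu] at hn
    have : ∀ m : ℕ, φ j j * v ^ m * δ ^ m = φ j j := by
      intro m
      induction m with
      | zero => simp
      | succ m ih =>
        calc φ j j * v ^ (m + 1) * δ ^ (m + 1) = φ j j * v ^ m * (v * δ) * δ ^ m := by
              rw [pow_succ, pow_succ']; simp only [mul_assoc]
          _ = φ j j * v ^ m * δ ^ m := by
            rw [hv]
            cases m with
            | zero => simp [h.mul_self]
            | succ m => rw [pow_succ' δ, mul_assoc, ← mul_assoc (φ j j) δ, hδ]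
          _ = _ := ih
    exact absurd (by rw [← this n, hn, mul_zero]) (h.self_ne_zero j)
  · exact ⟨w, hw.symm⟩

/-- An essential cyclic submodule of maximal length is everything. -/
theorem span_eq_top_of_essential [IsArtinianRing R] [IsNoetherianRing R]
    {M : Type} [AddCommGroup M] [Module R M] [IsArtinian R M] [IsNoetherian R M]
    {i : I} {x : M} (hx : φ i i • x = x)
    (hess : ∀ N : Submodule R M, N ⊓ (R ∙ x) = ⊥ → N = ⊥)
    (hmax : ∀ (j : I) (y : M), φ j j • y = y →
      Module.length R (R ∙ y) ≤ Module.length R (R ∙ x)) : (R ∙ x) = ⊤ := by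
  have key : ∀ (l : ℕ∞) (j : I) (y : M), φ j j • y = y → Module.length R (R ∙ y) = l →
      y ∈ R ∙ x := by
    intro l
    induction l using WellFoundedLT.induction with | _ l ih => ?_
    intro j y hy hl
    by_cases hy0 : y = 0
    · rw [hy0]; exact Submodule.zero_mem _
    have hne : (R ∙ y) ⊓ (R ∙ x) ≠ ⊥ := fun hb => hy0 (Submodule.span_singleton_eq_bot.1 (hess _ hb))
    obtain ⟨z, ⟨hzy, hzx⟩, hz0⟩ := Submodule.exists_mem_ne_zero_of_ne_bot hne
    obtain ⟨k, b, hkb⟩ : ∃ k b, (φ k k * b) • z ≠ 0 := by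
      by_contra! hc
      exact hz0 (h.mem_of_forall (N := ⊥) hc)
    obtain ⟨α₀, rfl⟩ := Submodule.mem_span_singleton.1 hzy
    obtain ⟨β₀, hβ₀⟩ := Submodule.mem_span_singleton.1 hzx
    obtain ⟨α, hα⟩ : ∃ α, α = φ k k * b * α₀ * φ j j := ⟨_, rfl⟩
    obtain ⟨β, hβ⟩ : ∃ β, β = φ k k * b * β₀ * φ i i := ⟨_, rfl⟩
    have hαy : α • y = (φ k k * b) • α₀ • y := by rw [hα, mul_smul, hy, mul_smul]
    have hβx : β • x = α • y := by rw [hαy, ← hβ₀, hβ, mul_smul, hx, mul_smul]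
    have hαy0 : α • y ≠ 0 := by rwa [hαy]
    have hα1 : φ k k * α = α := by rw [hα]; simp only [← mul_assoc, h.mul_self]
    have hα2 : α * φ j j = α := by rw [hα, mul_assoc, h.mul_self]
    have hβ1 : φ k k * β = β := by rw [hβ]; simp only [← mul_assoc, h.mul_self]
    have hβ2 : β * φ i i = β := by rw [hβ, mul_assoc, h.mul_self]
    have ker_lt : ∀ {p : I} {m m' : M} {γ : R}, φ p p • m = m → φ p p • m' = m' → γ • m ≠ 0 →
        γ • m' = 0 → Module.length R (R ∙ m') < Module.length R (R ∙ m) := by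
      intro p m m' γ hm hm' h1 h2
      obtain ⟨c, hc, -, hc1, -, hc2⟩ :=
        h.exists_index (LinearMap.ker (LinearMap.toSpanSingleton R M m)) p
      obtain ⟨d, hd, -, hd1, -, hd2⟩ :=
        h.exists_index (LinearMap.ker (LinearMap.toSpanSingleton R M m')) p
      simp only [LinearMap.mem_ker, LinearMap.toSpanSingleton_apply] at hc1 hc2 hd1 hd2
      obtain ⟨a, ha⟩ := hd2 (γ * φ p p) (by rw [mul_assoc, h.mul_self])
        (by rw [mul_smul, hm', h2])
      have hdc : d ≤ c := by
        by_contra! hcd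
        apply h1
        rw [← hm, ← mul_smul, ha, ← h.mul hc hcd.le, mul_smul, mul_smul, hc1, smul_zero, smul_zero]
      apply length_span_lt_of_ker_lt
      refine lt_of_le_not_ge (fun r hr => ?_) (fun hle => h1 (hle (x := γ) h2))
      rw [LinearMap.mem_ker, LinearMap.toSpanSingleton_apply] at hr ⊢
      obtain ⟨a', ha'⟩ := hc2 (r * φ p p) (by rw [mul_assoc, h.mul_self]) (by rw [mul_smul, hm, hr])
      rw [← hm', ← mul_smul, ha', ← h.mul hd hdc, mul_smul, mul_smul, hd1, smul_zero, smul_zero]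
    have case_left : (∃ δ, β = α * δ) → y ∈ R ∙ x := by
      rintro ⟨δ, hδ⟩
      have h1 : α • (y - (φ j j * δ) • x) = 0 := by
        rw [smul_sub, ← mul_smul, ← mul_assoc, hα2, ← hδ, hβx, sub_self]
      have h2 : φ j j • (y - (φ j j * δ) • x) = y - (φ j j * δ) • x := by
        rw [smul_sub, hy, ← mul_smul, ← mul_assoc, h.mul_self]
      have h3 := ih _ (hl ▸ ker_lt hy h2 hαy0 h1) j _ h2 rfl
      rw [← sub_add_cancel y ((φ j j * δ) • x)]
      exact Submodule.add_mem _ h3 (Submodule.smul_mem _ _ (Submodule.mem_span_singleton_self x))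
    rcases h.right_comparable hα1 hα2 hβ1 hβ2 with hc | ⟨δ₀, hδ₀⟩
    · exact case_left hc
    obtain ⟨δ, hδdef⟩ : ∃ δ, δ = φ i i * δ₀ * φ j j := ⟨_, rfl⟩
    have hδ1 : φ i i * δ = δ := by rw [hδdef]; simp only [← mul_assoc, h.mul_self]
    have hδ2 : δ * φ j j = δ := by rw [hδdef, mul_assoc, h.mul_self]
    have hδ : α = β * δ := by
      rw [hδdef, ← mul_assoc, ← mul_assoc, hβ2, ← hδ₀, hα2]
    have hδ0 : δ ≠ 0 := fun h0 => hαy0 (by rw [hδ, h0, mul_zero, zero_smul])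
    obtain ⟨j', hj', he, ⟨u, hu⟩, v, hv⟩ := h.factor hδ1 hδ2 hδ0
    rcases hj'.eq_or_lt with rfl | hlt
    · obtain ⟨w, hw⟩ := h.exists_right_inv (j := j) (by rw [he, hδ1]) hδ2 hv.symm
      refine case_left ⟨w, ?_⟩
      rw [hδ, mul_assoc, hw, he, hβ2]
    · exfalso
      have hlt1 : Module.length R (R ∙ δ • y) < Module.length R (R ∙ y) := by
        apply length_span_lt_of_span_lt
        refine lt_of_le_of_ne ((Submodule.span_singleton_le_iff_mem _ _).2
          (Submodule.smul_mem _ _ (Submodule.mem_span_singleton_self y))) fun heq => ?_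
        obtain ⟨a, ha⟩ := Submodule.mem_span_singleton.1
          (heq ▸ Submodule.mem_span_singleton_self y : y ∈ R ∙ δ • y)
        refine hy0 (eq_zero_of_isNilpotent_smul_eq (h.nilp hlt (a * u)) ?_)
        rw [mul_assoc, ← hu, mul_smul, ha]
      have hδy : φ i i • δ • y = δ • y := by rw [← mul_smul, hδ1]
      have h3 := ih _ (hl ▸ hlt1) i _ hδy rfl
      have h4 : x - δ • y ∈ R ∙ x := Submodule.sub_mem _ (Submodule.mem_span_singleton_self x) h3
      have h5 := ker_lt (γ := β) hx (m' := x - δ • y) (by rw [smul_sub, hx, hδy])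
        (by rwa [hβx]) (by rw [smul_sub, ← mul_smul, ← hδ, hβx, sub_self])
      have h6 : x = (x - δ • y) + δ • y := by simp
      rcases h.le_total_of_le_span hx ((Submodule.span_singleton_le_iff_mem _ _).2 h3)
        ((Submodule.span_singleton_le_iff_mem _ _).2 h4) with hle | hle
      · have : x ∈ R ∙ (x - δ • y) := by
          refine (congrArg (· ∈ _) h6).mpr ?_
          exact Submodule.add_mem _ (Submodule.mem_span_singleton_self _)
            (hle (Submodule.mem_span_singleton_self _))
        exact absurd (Module.length_le_of_injective _ (Submodule.inclusion_injective
          ((Submodule.span_singleton_le_iff_mem _ _).2 this))) h5.not_ge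
      · have : x ∈ R ∙ δ • y := by
          refine (congrArg (· ∈ _) h6).mpr ?_
          exact Submodule.add_mem _ (hle (Submodule.mem_span_singleton_self _))
            (Submodule.mem_span_singleton_self _)
        exact absurd (Module.length_le_of_injective _ (Submodule.inclusion_injective
          ((Submodule.span_singleton_le_iff_mem _ _).2 this)))
          (hlt1.trans_le (hmax j y hy)).not_ge
  rw [eq_top_iff]
  rintro y -
  refine h.mem_of_forall fun k b => key _ k _ ?_ rfl
  rw [← mul_smul, ← mul_assoc, h.mul_self]

/-- Every nonzero module of finite length has a cyclic interval summand. -/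
theorem exists_isCompl_span [IsArtinianRing R] [IsNoetherianRing R]
    (M : Type) [AddCommGroup M] [Module R M] [IsArtinian R M] [IsNoetherian R M] [Nontrivial M] :
    ∃ (i : I) (x : M) (K : Submodule R M), φ i i • x = x ∧ x ≠ 0 ∧ IsCompl K (R ∙ x) := by
  obtain ⟨z, hz⟩ := exists_ne (0 : M)
  obtain ⟨k, b, hkb⟩ : ∃ k b, (φ k k * b) • z ≠ 0 := by
    by_contra! hc
    exact hz (h.mem_of_forall (N := ⊥) hc)
  obtain ⟨⟨i, x⟩, ⟨hx, hx0⟩, hmax⟩ : ∃ p : I × M, (φ p.1 p.1 • p.2 = p.2 ∧ p.2 ≠ 0) ∧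
      ∀ q : I × M, φ q.1 q.1 • q.2 = q.2 →
        Module.length R (R ∙ q.2) ≤ Module.length R (R ∙ p.2) := by
    let T : Set ℕ∞ := {l | ∃ p : I × M, (φ p.1 p.1 • p.2 = p.2 ∧ p.2 ≠ 0) ∧
      l = Module.length R (R ∙ p.2)}
    have hT : T.Nonempty := ⟨_, (k, (φ k k * b) • z), ⟨by
      rw [← mul_smul, ← mul_assoc, h.mul_self], hkb⟩, rfl⟩
    have hTf : T.Finite := by
      obtain ⟨n, hn⟩ := ENat.ne_top_iff_exists.1 (Module.length_ne_top (R := R) (M := M))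
      refine ((Set.finite_Iic n).image ((↑) : ℕ → ℕ∞)).subset ?_
      rintro l ⟨p, -, rfl⟩
      have hle := Module.length_le_of_injective _ (Submodule.subtype_injective (R ∙ p.2))
      obtain ⟨m, hm⟩ := ENat.ne_top_iff_exists.1
        (Module.length_ne_top (R := R) (M := (R ∙ p.2 : Submodule R M)))
      refine ⟨m, ?_, hm⟩
      rw [← hm, ← hn] at hle
      exact_mod_cast hle
    obtain ⟨l, hl⟩ := hTf.exists_maximal hT
    obtain ⟨p, hp, rfl⟩ := hl.1
    refine ⟨p, hp, fun q hq => ?_⟩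
    by_cases hq0 : q.2 = 0
    · rw [Submodule.span_singleton_eq_bot.2 hq0]; simp
    · rcases le_total (Module.length R (R ∙ q.2)) (Module.length R (R ∙ p.2)) with hle | hle
      · exact hle
      · exact hl.2 ⟨q, ⟨hq, hq0⟩, rfl⟩ hle
  obtain ⟨K, hK⟩ : ∃ K : Submodule R M, Maximal (fun K => K ⊓ (R ∙ x) = ⊥) K := by
    obtain ⟨K, hK⟩ := set_has_maximal_iff_noetherian.2 ‹IsNoetherian R M›
      {K | K ⊓ (R ∙ x) = ⊥} ⟨⊥, by simp⟩
    exact ⟨K, hK.1, fun L hL hle => by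
      by_contra hc
      exact hK.2 L hL (lt_of_le_not_ge hle hc)⟩
  have hinj : ∀ r : R, r • x ∈ K → r • x = 0 := fun r hr => by
    have : r • x ∈ K ⊓ (R ∙ x) := ⟨hr, Submodule.mem_span_singleton.2 ⟨r, rfl⟩⟩
    rwa [hK.1, Submodule.mem_bot] at this
  have hmap : ∀ y : M, (R ∙ (K.mkQ y)) = (R ∙ y).map K.mkQ := fun y => by
    rw [Submodule.map_span, Set.image_singleton]
  have htop := h.span_eq_top_of_essential (M := M ⧸ K) (i := i) (x := K.mkQ x)
    (by rw [← map_smul, hx]) (fun N hN => ?_) (fun j y hy => ?_)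
  · refine ⟨i, x, K, hx, hx0, disjoint_iff.2 hK.1, codisjoint_iff.2 ?_⟩
    rw [hmap] at htop
    rw [← Submodule.comap_map_mkQ, htop, Submodule.comap_top]
  · have : N.comap K.mkQ ⊓ (R ∙ x) = ⊥ := by
      rw [eq_bot_iff]
      rintro z ⟨hz1, hz2⟩
      obtain ⟨r, rfl⟩ := Submodule.mem_span_singleton.1 hz2
      have : K.mkQ (r • x) ∈ N ⊓ (R ∙ K.mkQ x) := ⟨hz1, Submodule.mem_span_singleton.2 ⟨r, by simp⟩⟩
      rw [hN, Submodule.mem_bot, Submodule.mkQ_apply, Submodule.Quotient.mk_eq_zero] at this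
      exact hinj r this
    have hle : N.comap K.mkQ ≤ K := hK.2 this (by
      intro z hz
      rw [Submodule.mem_comap, Submodule.mkQ_apply, (Submodule.Quotient.mk_eq_zero K).2 hz]
      exact N.zero_mem)
    rw [eq_bot_iff]
    intro z hz
    obtain ⟨z, rfl⟩ := K.mkQ_surjective z
    rw [Submodule.mem_bot, Submodule.mkQ_apply, Submodule.Quotient.mk_eq_zero]
    exact hle hz
  · obtain ⟨y', rfl⟩ := K.mkQ_surjective y
    have hy' : K.mkQ (φ j j • y') = K.mkQ y' := by rw [map_smul, hy]
    rw [← hy']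
    calc Module.length R (R ∙ K.mkQ (φ j j • y')) ≤ Module.length R (R ∙ (φ j j • y')) := by
          rw [hmap, ← LinearMap.range_domRestrict]
          exact Module.length_le_of_surjective _ (LinearMap.surjective_rangeRestrict _)
      _ ≤ Module.length R (R ∙ x) := hmax (j, φ j j • y') (by rw [← mul_smul, h.mul_self])
      _ ≤ Module.length R (R ∙ K.mkQ x) := by
          rw [length_span_eq, length_span_eq]
          refine Module.length_le_of_surjective (Submodule.factor (fun r hr => ?_))
            (Submodule.factor_surjective _)
          rw [LinearMap.mem_ker, LinearMap.toSpanSingleton_apply, ← map_smul, Submodule.mkQ_apply,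
            Submodule.Quotient.mk_eq_zero] at hr
          exact hinj r hr

end

end SerialSystem

end SerialSystem

section ProjectiveDimension

open CategoryTheory

variable (R : Type) [Ring R]

/-- The module `M` has projective dimension at most `n`. -/
abbrev PdLE (n : ℕ) (M : Type) [AddCommGroup M] [Module R M] : Prop :=
  HasProjectiveDimensionLT (ModuleCat.of R M) (n + 1)

variable {R} {M N P : Type} [AddCommGroup M] [Module R M] [AddCommGroup N] [Module R N]
  [AddCommGroup P] [Module R P]

theorem pdLE_zero_iff : PdLE R 0 M ↔ Module.Projective R M := by
  rw [IsProjective.iff_projective, projective_iff_hasProjectiveDimensionLT_one]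

theorem PdLE.mono {m n : ℕ} (h : PdLE R m M) (hmn : m ≤ n) : PdLE R n M :=
  hasProjectiveDimensionLT_of_ge _ (m + 1) _ (by omega)

theorem PdLE.congr {n : ℕ} (h : PdLE R n M) (g : M ≃ₗ[R] N) : PdLE R n N :=
  hasProjectiveDimensionLT_of_iso g.toModuleIso _

theorem PdLE.of_retract {n : ℕ} (h : PdLE R n M) (i : N →ₗ[R] M) (r : M →ₗ[R] N)
    (hir : r ∘ₗ i = LinearMap.id) : PdLE R n N :=
  Retract.hasProjectiveDimensionLT (Y := ModuleCat.of R M)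
    ⟨ModuleCat.ofHom i, ModuleCat.ofHom r, by rw [← ModuleCat.ofHom_comp, hir]; rfl⟩ _

theorem pdLE_succ_iff [Module.Projective R P] {g : P →ₗ[R] M} (hg : Surjective g) (n : ℕ) :
    PdLE R (n + 1) M ↔ PdLE R n (LinearMap.ker g) :=
  (LinearMap.shortExact_shortComplexKer hg).hasProjectiveDimensionLT_X₃_iff n
    ((IsProjective.iff_projective P).1 inferInstance)

theorem PdLE.of_isCompl {n : ℕ} {K L : Submodule R M} (hKL : IsCompl K L) (hK : PdLE R n K)
    (hL : PdLE R n L) : PdLE R n M := by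
  have hs : Surjective (L.projectionOnto K hKL.symm) := LinearMap.range_eq_top.1
    (Submodule.range_projectionOnto _)
  refine (LinearMap.shortExact_shortComplexKer hs).hasProjectiveDimensionLT_X₂ _ ?_ hL
  exact hK.congr (LinearEquiv.ofEq _ _ (Submodule.ker_projectionOnto _).symm)

theorem PdLE.left_of_isCompl {n : ℕ} {K L : Submodule R M} (hKL : IsCompl K L)
    (h : PdLE R n M) : PdLE R n K :=
  h.of_retract K.subtype (K.projectionOnto L hKL) (Submodule.projectionOnto_comp_subtype _)

/-- Finitely generated modules over an Artinian ring have projective covers. -/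
theorem exists_projective_cover [IsArtinianRing R] (M : Type) [AddCommGroup M] [Module R M]
    [Module.Finite R M] : ∃ (P : ModuleCat.{0} R) (g : P →ₗ[R] M), Module.Projective R P ∧
      Module.Finite R P ∧ Surjective g ∧ IsSmallSubmodule R (LinearMap.ker g) := by
  let Q : ℕ∞ → Prop := fun l => ∃ (P : ModuleCat.{0} R) (g : P →ₗ[R] M), Module.Projective R P ∧
      Module.Finite R P ∧ Surjective g ∧ Module.length R P = l
  have hQ : ∃ l, Q l := by
    obtain ⟨n, g, hg⟩ := Module.Finite.exists_fin' R M
    exact ⟨_, ModuleCat.of R (Fin n → R), g, (inferInstance : Module.Projective R (Fin n → R)),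
      (inferInstance : Module.Finite R (Fin n → R)), hg, rfl⟩
  obtain ⟨l, ⟨P, g, hP, hPf, hg, rfl⟩, hmin⟩ :=
    WellFounded.has_min (wellFounded_lt (α := ℕ∞)) {l | Q l} hQ
  refine ⟨P, g, hP, hPf, hg, fun L hL => ?_⟩
  obtain ⟨L', ⟨hL'sup, hL'le⟩, hL'min⟩ := IsArtinian.set_has_minimal
    {L' : Submodule R P | LinearMap.ker g ⊔ L' = ⊤ ∧ L' ≤ L} ⟨L, hL, le_rfl⟩
  have hsurj : ∀ K : Submodule R P, LinearMap.ker g ⊔ K = ⊤ ↔ Surjective (g.domRestrict K) := by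
    intro K
    rw [← LinearMap.range_eq_top, LinearMap.range_domRestrict, sup_comm]
    constructor
    · intro hK
      have := congrArg (Submodule.map g) hK
      rw [Submodule.map_sup, Submodule.map_top, LinearMap.range_eq_top.2 hg] at this
      rw [← this, eq_comm, sup_eq_left]
      rintro _ ⟨x, hx, rfl⟩
      rw [LinearMap.mem_ker.1 hx]; exact Submodule.zero_mem _
    · intro hK
      rw [← Submodule.comap_map_eq, hK, Submodule.comap_top]
  obtain ⟨s, hs⟩ := Module.projective_lifting_property (g.domRestrict L') g ((hsurj L').1 hL'sup)
  have hs' : ∀ x, g (s x) = g x := fun x => LinearMap.congr_fun hs x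
  have hss : Surjective (s ∘ₗ L'.subtype) := by
    rw [← LinearMap.range_eq_top]
    have hle : (LinearMap.range (s ∘ₗ L'.subtype)).map L'.subtype ≤ L' := Submodule.map_subtype_le _ _
    have hsup : LinearMap.ker g ⊔ (LinearMap.range (s ∘ₗ L'.subtype)).map L'.subtype = ⊤ := by
      rw [hsurj]
      intro m
      obtain ⟨x, hx⟩ := (hsurj L').1 hL'sup m
      exact ⟨⟨s x, s x, ⟨x, rfl⟩, rfl⟩, (hs' x).trans hx⟩
    have heq := eq_of_le_of_not_lt hle (hL'min _ ⟨hsup, hle.trans hL'le⟩)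
    apply Submodule.map_injective_of_injective (Submodule.subtype_injective L')
    rw [heq, Submodule.map_top, Submodule.range_subtype]
  have hinj := IsNoetherian.injective_of_surjective_endomorphism _ hss
  let eqv := LinearEquiv.ofBijective _ ⟨hinj, hss⟩
  have hproj : Module.Projective R L' := by
    refine Module.Projective.of_split L'.subtype (eqv.symm.toLinearMap ∘ₗ s) ?_
    ext x : 1
    exact eqv.symm_apply_apply x
  by_contra hne
  have hne' : L' ≠ ⊤ := fun h0 => hne (top_le_iff.1 (h0 ▸ hL'le))
  exact hmin _ ⟨ModuleCat.of R L', g.domRestrict L', hproj,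
    (inferInstance : Module.Finite R L'), (hsurj L').1 hL'sup, rfl⟩ (Submodule.length_lt hne')

theorem IsNthSyzygyOf.finite_and_pdLE_iff [IsArtinianRing R] {M : ModuleCat.{0} R}
    (hM : Module.Finite R M) {n : ℕ} {N : ModuleCat.{0} R} (hN : IsNthSyzygyOf R n N M) :
    Module.Finite R N ∧ ∀ m, PdLE R (n + m) M ↔ PdLE R m N := by
  induction n generalizing N with
  | zero =>
    obtain ⟨g⟩ := hN
    exact ⟨Module.Finite.equiv g.symm, fun m => by
      rw [zero_add]; exact ⟨fun h => h.congr g.symm, fun h => h.congr g⟩⟩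
  | succ n ih =>
    obtain ⟨K, hK, P, g, hP, hPf, hg, -, ⟨eqv⟩⟩ := hN
    obtain ⟨hKf, hKm⟩ := ih hK
    refine ⟨Module.Finite.equiv eqv.symm, fun m => ?_⟩
    rw [add_right_comm, add_assoc, hKm, pdLE_succ_iff hg]
    exact ⟨fun h => h.congr eqv.symm, fun h => h.congr eqv⟩

theorem exists_isNthSyzygyOf [IsArtinianRing R] (M : ModuleCat.{0} R)
    [hM : Module.Finite R M] (n : ℕ) : ∃ N, IsNthSyzygyOf R n N M := by
  induction n with
  | zero => exact ⟨M, ⟨LinearEquiv.refl R M⟩⟩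
  | succ n ih =>
    obtain ⟨K, hK⟩ := ih
    have := (IsNthSyzygyOf.finite_and_pdLE_iff hM hK).1
    obtain ⟨P, g, hP, hPf, hg, hs⟩ := exists_projective_cover (R := R) K
    exact ⟨ModuleCat.of R (LinearMap.ker g), K, hK, P, g, hP, hPf, hg, hs, ⟨LinearEquiv.refl R _⟩⟩

theorem projDim_le_iff [IsArtinianRing R] (M : ModuleCat.{0} R) [hM : Module.Finite R M] (n : ℕ) :
    projDim R M ≤ n ↔ PdLE R n M := by
  have key : ∀ m, (∃ N : ModuleCat.{0} R, IsNthSyzygyOf R m N M ∧ Module.Projective R N) ↔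
      PdLE R m M := by
    intro m
    constructor
    · rintro ⟨N, hN, hNp⟩
      have := (IsNthSyzygyOf.finite_and_pdLE_iff hM hN).2 0
      rw [add_zero] at this
      exact this.2 (pdLE_zero_iff.2 hNp)
    · intro h
      obtain ⟨N, hN⟩ := exists_isNthSyzygyOf M m
      have := (IsNthSyzygyOf.finite_and_pdLE_iff hM hN).2 0
      rw [add_zero] at this
      exact ⟨N, hN, pdLE_zero_iff.1 (this.1 h)⟩
  unfold projDim
  simp only [key]
  constructor
  · intro h
    have hne : ((fun n : ℕ => (n : ℕ∞)) '' {m | PdLE R m M}).Nonempty := by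
      rw [Set.nonempty_iff_ne_empty]
      intro h0
      rw [h0, sInf_empty, top_le_iff] at h
      exact ENat.natCast_ne_top n h
    obtain ⟨m, hm, hm'⟩ := csInf_mem hne
    rw [← hm'] at h
    exact PdLE.mono hm (Nat.cast_le.1 h)
  · intro h
    exact sInf_le ⟨n, h, rfl⟩

theorem projDim_ne_top_iff [IsArtinianRing R] (M : ModuleCat.{0} R) [Module.Finite R M] :
    projDim R M ≠ ⊤ ↔ ∃ n, PdLE R n M := by
  simp only [← projDim_le_iff]
  constructor
  · intro h
    obtain ⟨n, hn⟩ := ENat.ne_top_iff_exists.1 h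
    exact ⟨n, hn.ge⟩
  · rintro ⟨n, hn⟩ h
    rw [h, top_le_iff] at hn
    exact ENat.natCast_ne_top n hn

theorem finDim_le_iff [IsArtinianRing R] (k : ℕ) : finDim R ≤ k ↔
    ∀ M : ModuleCat.{0} R, Module.Finite R M → (∃ n, PdLE R n M) → PdLE R k M := by
  unfold finDim
  rw [sSup_le_iff]
  constructor
  · intro h M hM hn
    rw [← projDim_le_iff]
    exact h _ ⟨(projDim_ne_top_iff M).2 hn, M, hM, rfl⟩
  · rintro h d ⟨hd, M, hM, rfl⟩
    rw [projDim_le_iff]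
    exact h M hM ((projDim_ne_top_iff M).1 hd)

end ProjectiveDimension

namespace SerialSystem

variable {R : Type} [Ring R] {I : Type} [LinearOrder I] {σ : I ≃o I} {f : I → I}
  {φ : I → I → R}

/-- The module `M` is generated by an element `x` of degree `a` whose relations are generated by
`φ a b`. -/
def IsInterval (φ : I → I → R) (f : I → I) (M : Type) [AddCommGroup M] [Module R M] (a b : I) :
    Prop :=
  a ≤ b ∧ b ≤ f a ∧ ∃ x : M, φ a a • x = x ∧ (R ∙ x) = ⊤ ∧ φ a b • x = 0 ∧
    ∀ r, r * φ a a = r → r • x = 0 → ∃ c, r = c * φ a b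

section

variable (h : SerialSystem R I σ f φ) {M : Type} [AddCommGroup M] [Module R M]
include h

theorem exists_isInterval {i : I} {x : M} (hx : φ i i • x = x) :
    ∃ b, IsInterval φ f (R ∙ x) i b := by
  obtain ⟨b, h1, h2, h3, -, h4⟩ :=
    h.exists_index (LinearMap.ker (LinearMap.toSpanSingleton R M x)) i
  refine ⟨b, h1, h2, ⟨x, Submodule.mem_span_singleton_self x⟩, Subtype.ext hx, ?_,
    Subtype.ext h3, fun r hr hrx => h4 r hr (congrArg Subtype.val hrx)⟩
  rw [eq_top_iff]
  rintro ⟨y, hy⟩ -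
  obtain ⟨r, rfl⟩ := Submodule.mem_span_singleton.1 hy
  exact Submodule.mem_span_singleton.2 ⟨r, rfl⟩

theorem isInterval_span {a b : I} (hab : a ≤ b) (hb : b ≤ f a) :
    IsInterval φ f (R ∙ φ a b) b (f a) := by
  obtain ⟨c, h1, h2, h3, h5, h4⟩ :=
    h.exists_index (LinearMap.ker (LinearMap.toSpanSingleton R R (φ a b))) b
  have e1 : f a ≤ c := by
    rw [← h.eq_zero (hab.trans h1), ← h.mul hab h1]; exact h3
  have e2 : c ≤ f a := h5 _ hb (by
    rw [LinearMap.mem_ker, LinearMap.toSpanSingleton_apply, smul_eq_mul, h.mul hab hb,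
      h.eq_zero (hab.trans hb)])
  obtain rfl := le_antisymm e1 e2
  refine ⟨hb, h.mono hab, ⟨φ a b, Submodule.mem_span_singleton_self _⟩,
    Subtype.ext (h.left_mul hab), ?_, Subtype.ext h3,
    fun r hr hrx => h4 r hr (congrArg Subtype.val hrx)⟩
  rw [eq_top_iff]
  rintro ⟨y, hy⟩ -
  obtain ⟨r, rfl⟩ := Submodule.mem_span_singleton.1 hy
  exact Submodule.mem_span_singleton.2 ⟨r, rfl⟩

theorem projective_span (i : I) : Module.Projective R (R ∙ φ i i) := by
  refine Module.Projective.of_split (R ∙ φ i i).subtype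
    (LinearMap.toSpanSingleton R _ ⟨φ i i, Submodule.mem_span_singleton_self _⟩) ?_
  ext ⟨y, hy⟩
  obtain ⟨r, rfl⟩ := Submodule.mem_span_singleton.1 hy
  simp [mul_assoc, h.mul_self]

/-- The cover of an interval module by an indecomposable projective. -/
theorem IsInterval.exists_cover {a b : I} (hM : IsInterval φ f M a b) :
    ∃ g : (R ∙ φ a a) →ₗ[R] M, Surjective g ∧ Nonempty (LinearMap.ker g ≃ₗ[R] R ∙ φ a b) := by
  obtain ⟨hab, hb, x, hx, hx1, hx2, hx3⟩ := hM
  refine ⟨(LinearMap.toSpanSingleton R M x).domRestrict _, ?_, ⟨?_⟩⟩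
  · rw [← LinearMap.range_eq_top, LinearMap.range_domRestrict, Submodule.map_span,
      Set.image_singleton, LinearMap.toSpanSingleton_apply, hx, hx1]
  · have : (LinearMap.ker ((LinearMap.toSpanSingleton R M x).domRestrict (R ∙ φ a a))).map
        (R ∙ φ a a).subtype = R ∙ φ a b := by
      apply le_antisymm
      · rintro _ ⟨⟨y, hy⟩, hy', rfl⟩
        obtain ⟨r, rfl⟩ := Submodule.mem_span_singleton.1 hy
        obtain ⟨c, hc⟩ := hx3 (r • φ a a) (by rw [smul_eq_mul, mul_assoc, h.mul_self]) hy'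
        exact Submodule.mem_span_singleton.2 ⟨c, hc.symm⟩
      · rw [Submodule.span_singleton_le_iff_mem]
        exact ⟨⟨φ a b, Submodule.mem_span_singleton.2 ⟨_, h.right_mul hab⟩⟩, hx2, rfl⟩
    exact (Submodule.equivMapOfInjective _ (Submodule.subtype_injective _) _).trans
      (LinearEquiv.ofEq _ _ this)

theorem IsInterval.projective_iff {a b : I} (hM : IsInterval φ f M a b) :
    Module.Projective R M ↔ a = b ∨ b = f a := by
  have hM' := hM
  obtain ⟨hab, hb, x, hx, hx1, hx2, hx3⟩ := hM
  constructor
  · intro hp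
    refine hab.eq_or_lt.imp id fun hlt => le_antisymm hb ?_
    obtain ⟨s, hs⟩ := LinearMap.exists_rightInverse_of_surjective
      (LinearMap.toSpanSingleton R M x) (by rw [LinearMap.range_toSpanSingleton, hx1])
    have hc : s x • x = x := LinearMap.congr_fun hs x
    have hc2 : φ a b * s x = 0 := by rw [← smul_eq_mul, ← map_smul, hx2, map_zero]
    obtain ⟨d, hd⟩ := hx3 (φ a a - s x * φ a a)
      (by rw [sub_mul, mul_assoc, h.mul_self]) (by rw [sub_smul, mul_smul, hx, hc, sub_self])
    rw [← h.eq_zero hab]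
    refine eq_zero_of_isNilpotent_smul_eq (isNilpotent_mul_swap (h.nilp hlt d)) ?_
    rw [smul_eq_mul, mul_assoc, ← hd, mul_sub, h.right_mul hab, ← mul_assoc, hc2, zero_mul,
      sub_zero]
  · rintro (rfl | rfl)
    · rw [hx] at hx2
      have : Subsingleton M := (Submodule.subsingleton_iff R).1
        (subsingleton_iff_bot_eq_top.1 (by rw [← hx1, hx2, Submodule.span_zero_singleton]))
      exact Module.Projective.of_split (M := R) 0 0 (Subsingleton.elim _ _)
    · obtain ⟨g, hg, ⟨eqv⟩⟩ := hM'.exists_cover h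
      have := h.projective_span a
      refine Module.Projective.of_equiv (LinearEquiv.ofBijective g ⟨?_, hg⟩)
      rw [← LinearMap.ker_eq_bot, ← Submodule.subsingleton_iff_eq_bot]
      rw [(h.eq_zero (h.lt_map a).le).2 le_rfl, Submodule.span_zero_singleton] at eqv
      exact eqv.toEquiv.subsingleton

theorem IsInterval.pdLE_iff {a b : I} (hM : IsInterval φ f M a b) (n : ℕ) :
    PdLE R n M ↔ ∃ k ≤ n + 1, resolutionSeq f a b k = resolutionSeq f a b (k + 1) := by
  induction n generalizing a b M with
  | zero =>
    rw [pdLE_zero_iff, hM.projective_iff h]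
    constructor
    · rintro (h0 | h0)
      · exact ⟨0, by omega, h0⟩
      · exact ⟨1, by omega, h0⟩
    · rintro ⟨k, hk, hk'⟩
      obtain rfl | rfl : k = 0 ∨ k = 1 := by omega
      · exact .inl hk'
      · exact .inr hk'
  | succ n ih =>
    obtain ⟨g, hg, ⟨eqv⟩⟩ := hM.exists_cover h
    have := h.projective_span a
    rw [pdLE_succ_iff hg, show PdLE R n (LinearMap.ker g) ↔ PdLE R n (R ∙ φ a b) from
      ⟨fun h => h.congr eqv, fun h => h.congr eqv.symm⟩, ih (h.isInterval_span hM.1 hM.2.1)]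
    constructor
    · rintro ⟨k, hk, hk'⟩
      exact ⟨k + 1, by omega, hk'⟩
    · rintro ⟨k, hk, hk'⟩
      cases k with
      | zero =>
        obtain rfl : a = b := hk'
        exact ⟨1, by omega, rfl⟩
      | succ k => exact ⟨k, by omega, hk'⟩

theorem exists_module_isInterval {a b : I} (hab : a ≤ b) (hb : b ≤ f a) :
    ∃ M : ModuleCat.{0} R, Module.Finite R M ∧ IsInterval φ f M a b := by
  let K := (R ∙ φ a b).comap (R ∙ φ a a).subtype
  refine ⟨ModuleCat.of R ((R ∙ φ a a) ⧸ K), (inferInstance : Module.Finite R ((R ∙ φ a a) ⧸ K)),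
    hab, hb, K.mkQ ⟨φ a a, Submodule.mem_span_singleton_self _⟩, ?_, ?_, ?_, ?_⟩
  · change K.mkQ _ = K.mkQ _
    exact congrArg K.mkQ (Subtype.ext (h.mul_self a))
  · rw [eq_top_iff]
    rintro y -
    obtain ⟨⟨y, hy⟩, rfl⟩ := K.mkQ_surjective y
    obtain ⟨r, rfl⟩ := Submodule.mem_span_singleton.1 hy
    exact Submodule.mem_span_singleton.2 ⟨r, rfl⟩
  · change K.mkQ _ = 0
    rw [Submodule.mkQ_apply, Submodule.Quotient.mk_eq_zero]
    exact Submodule.mem_span_singleton.2 ⟨1, by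
      rw [one_smul]; exact (h.right_mul hab).symm⟩
  · intro r hr hrx
    change K.mkQ _ = 0 at hrx
    rw [Submodule.mkQ_apply, Submodule.Quotient.mk_eq_zero] at hrx
    obtain ⟨c, hc⟩ := Submodule.mem_span_singleton.1 hrx
    exact ⟨c, hr.symm.trans hc.symm⟩

/-- A bound for the projective dimension of interval modules with a property that is inherited by
direct summands holds for all finitely generated modules with that property. -/
theorem pdLE_of_isInterval (Q : ModuleCat.{0} R → Prop)
    (hQ : ∀ (M : ModuleCat.{0} R) (K L : Submodule R M), IsCompl K L → Q M → Q (ModuleCat.of R K))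
    (n : ℕ) (hI : ∀ (M : ModuleCat.{0} R) (a b : I), IsInterval φ f M a b → Q M → PdLE R n M)
    (M : ModuleCat.{0} R) [hM : Module.Finite R M] (hQM : Q M) : PdLE R n M := by
  have := h.isArtinianRing
  obtain ⟨l, hl⟩ : ∃ l, Module.length R M = l := ⟨_, rfl⟩
  induction l using WellFoundedLT.induction generalizing M with | _ l ih => ?_
  rcases subsingleton_or_nontrivial M with hs | hs
  · exact (pdLE_zero_iff.2 (Module.Projective.of_split (M := R) 0 0 (Subsingleton.elim _ _)) :
      PdLE R 0 M).mono (Nat.zero_le n)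
  obtain ⟨i, x, K, hx, hx0, hc⟩ := h.exists_isCompl_span M
  obtain ⟨b, hb⟩ := h.exists_isInterval hx
  refine PdLE.of_isCompl hc ?_ (hI (ModuleCat.of R (R ∙ x)) i b hb (hQ M _ _ hc.symm hQM))
  refine ih _ ?_ (ModuleCat.of R K) (hM := (inferInstance : Module.Finite R K)) (hQ M _ _ hc hQM) rfl
  rw [← hl]
  refine Submodule.length_lt fun htop => hx0 ?_
  rw [htop] at hc
  exact Submodule.span_singleton_eq_bot.1 (top_disjoint.1 hc.disjoint)

theorem finDim_le_iff (n : ℕ) : finDim R ≤ n ↔ PeriodicMap.BoundedResolutions f n := by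
  have := h.isArtinianRing
  rw [_root_.finDim_le_iff]
  constructor
  · rintro hn a b hab hb ⟨k, hk⟩
    obtain ⟨M, hMf, hM⟩ := h.exists_module_isInterval hab hb
    exact (hM.pdLE_iff h n).1 (hn M hMf ⟨k, (hM.pdLE_iff h k).2 ⟨k, by omega, hk⟩⟩)
  · intro hB M hM hQ
    refine h.pdLE_of_isInterval (fun M => ∃ m, PdLE R m M) ?_ n ?_ M hQ
    · rintro M K L hKL ⟨m, hm⟩
      exact ⟨m, hm.left_of_isCompl hKL⟩
    · rintro M a b hM ⟨m, hm⟩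
      obtain ⟨k, -, hk⟩ := (hM.pdLE_iff h m).1 hm
      exact (hM.pdLE_iff h n).2 (hB a b hM.1 hM.2.1 ⟨k, hk⟩)

theorem hasInfiniteResolution_of_globalDim_eq_top (hgl : globalDim R = ⊤) :
    HasInfiniteResolution f := by
  have := h.isArtinianRing
  by_contra hc
  unfold HasInfiniteResolution at hc
  push Not at hc
  obtain ⟨n, hn⟩ := h.exists_boundedResolutions
  have : globalDim R ≤ n := by
    unfold globalDim
    rw [sSup_le_iff]
    rintro _ ⟨M, hM, rfl⟩
    rw [projDim_le_iff]
    refine h.pdLE_of_isInterval (fun _ => True) (fun _ _ _ _ _ => trivial) n ?_ M trivial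
    intro M a b hM _
    exact (hM.pdLE_iff h n).2 (hn a b hM.1 hM.2.1 (hc a b hM.1 hM.2.1))
  rw [hgl, top_le_iff] at this
  exact ENat.natCast_ne_top n this

theorem finDim_ne_top : finDim R ≠ ⊤ := by
  obtain ⟨n, hn⟩ := h.exists_boundedResolutions
  exact ne_top_of_le_ne_top (ENat.natCast_ne_top n) ((h.finDim_le_iff n).2 hn)

end

end SerialSystem

namespace SerialSystem

variable {R : Type} [Ring R] {I : Type} [LinearOrder I] {σ : I ≃o I} {f : I → I}
  {φ : I → I → R} (h : SerialSystem R I σ f φ)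
include h

theorem isNakayamaRing : IsNakayamaRing R := by
  have := h.isArtinianRing
  refine ⟨this, fun M hM hind N N' => ?_⟩
  have := hind.1
  obtain ⟨i, x, K, hx, hx0, hc⟩ := h.exists_isCompl_span M
  have htop : (R ∙ x) = ⊤ := by
    rcases hind.2 _ _ hc with rfl | rfl
    · exact codisjoint_bot.1 hc.codisjoint.symm
    · exact absurd (Submodule.span_singleton_eq_bot.1 (top_disjoint.1 hc.disjoint)) hx0
  exact h.le_total_of_le_span hx (htop ▸ le_top) (htop ▸ le_top)

theorem isNakayamaAlgebra : IsNakayamaAlgebra R := by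
  obtain ⟨u, hu⟩ := h.exists_adjoint
  exact ⟨h.isNakayamaRing, (h.op hu).isNakayamaRing⟩

theorem exists_left_inv_or_isNilpotent {i : I} {r : R} (hr : φ i i * r = r) (hr' : r * φ i i = r) :
    (∃ v, v * r = φ i i) ∨ IsNilpotent r := by
  by_cases h0 : r = 0
  · exact .inr (h0 ▸ IsNilpotent.zero)
  obtain ⟨j, hij, -, ⟨u, hu⟩, v, hv⟩ := h.factor hr hr' h0
  rcases hij.eq_or_lt with rfl | hlt
  · exact .inl ⟨v, hv.symm⟩
  · exact .inr (hu ▸ h.nilp hlt u)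

theorem central_idempotent_mul {g : R} (hg : IsIdempotentElem g) (hgc : ∀ r, g * r = r * g)
    (i : I) : g * φ i i = 0 ∨ g * φ i i = φ i i := by
  have hi : (g * φ i i) * (g * φ i i) = g * φ i i := by
    rw [mul_assoc, ← mul_assoc (φ i i), ← hgc (φ i i), mul_assoc g, h.mul_self, ← mul_assoc,
      hg.eq]
  rcases h.exists_left_inv_or_isNilpotent (i := i) (r := g * φ i i)
    (by rw [← mul_assoc, ← hgc, mul_assoc, h.mul_self]) (by rw [mul_assoc, h.mul_self]) with
    ⟨v, hv⟩ | hn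
  · right
    rw [← hv, ← mul_assoc, hgc, mul_assoc, ← mul_assoc g g, hg.eq]
  · left
    exact eq_zero_of_isNilpotent_smul_eq hn hi

theorem iff_of_covBy {p : I → Prop} (hp : ∀ i j, i ⋖ j → (p i ↔ p j)) {i j : I} (hij : i ≤ j) :
    p i ↔ p j := by
  obtain ⟨k, ⟨⟨hik, hkj⟩, hk⟩, hmax⟩ := ((h.finite_Icc i j).inter_of_left
    {k | p i ↔ p k}).exists_maximalFor id _ ⟨i, ⟨le_rfl, hij⟩, Iff.rfl⟩
  rcases hkj.eq_or_lt with rfl | hlt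
  · exact hk
  obtain ⟨k', hk'⟩ := h.exists_succ k
  have hk'j : k' ≤ j := not_lt.1 fun hc => hk'.2 hlt hc
  exact absurd (hmax (j := k') ⟨⟨hik.trans hk'.le, hk'j⟩, hk.trans (hp _ _ hk')⟩ hk'.le) hk'.lt.not_ge

theorem isConnectedRing (hf : HasInfiniteResolution f) : IsConnectedRing R := by
  intro g hg hgc
  replace hgc : ∀ r, g * r = r * g := fun r => (Set.mem_center_iff.1 hgc).comm r
  have key : ∀ g : R, IsIdempotentElem g → (∀ r, g * r = r * g) → ∀ i j, i ⋖ j →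
      g * φ i i = φ i i → g * φ j j = φ j j := by
    intro g hg hgc i j hij hi
    refine (h.central_idempotent_mul hg hgc j).resolve_left fun h0 => ?_
    refine h.ne_zero hij.le (h.lt_map_of_covBy hf hij) ?_
    rw [← h.right_mul hij.le, ← hi, ← mul_assoc, ← hgc, mul_assoc, h.right_mul hij.le,
      ← h.left_mul hij.le, ← mul_assoc, h0, zero_mul]
  have key' : ∀ i j, i ⋖ j → (g * φ i i = φ i i ↔ g * φ j j = φ j j) := by
    intro i j hij
    refine ⟨key g hg hgc i j hij, fun hj => ?_⟩
    refine (h.central_idempotent_mul hg hgc i).resolve_left fun h0 => ?_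
    have := key (1 - g) hg.one_sub (fun r => by rw [sub_mul, mul_sub, hgc, one_mul, mul_one]) i j
      hij (by rw [sub_mul, h0, one_mul, sub_zero])
    rw [sub_mul, hj, one_mul, sub_self] at this
    exact h.self_ne_zero j this.symm
  have hall : ∀ i j, (g * φ i i = φ i i ↔ g * φ j j = φ j j) := fun i j => by
    rcases le_total i j with hij | hij
    · exact h.iff_of_covBy key' hij
    · exact (h.iff_of_covBy key' hij).symm
  obtain ⟨n, k, a, b, h1⟩ := h.full
  by_cases hc : ∃ i, g * φ i i = φ i i
  · obtain ⟨i, hi⟩ := hc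
    right
    rw [← mul_one g, ← h1, Finset.mul_sum]
    refine Finset.sum_congr rfl fun t _ => ?_
    rw [← mul_assoc, ← mul_assoc, hgc, mul_assoc (a t), (hall i (k t)).1 hi]
  · left
    rw [← mul_one g, ← h1, Finset.mul_sum]
    refine Finset.sum_eq_zero fun t _ => ?_
    rw [← mul_assoc, ← mul_assoc, hgc, mul_assoc (a t),
      (h.central_idempotent_mul hg hgc (k t)).resolve_right fun h0 => hc ⟨_, h0⟩, mul_zero, zero_mul]

theorem not_projective_of_isSimpleModule (hf : HasInfiniteResolution f) (M : ModuleCat.{0} R)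
    [IsSimpleModule R M] : ¬ Module.Projective R M := by
  intro hp
  have := h.isArtinianRing
  have := IsSimpleModule.nontrivial R M
  obtain ⟨i, x, K, hx, hx0, hc⟩ := h.exists_isCompl_span M
  have htop : (R ∙ x) = ⊤ := (eq_bot_or_eq_top _).resolve_left
    fun h0 => hx0 (Submodule.span_singleton_eq_bot.1 h0)
  let eqv : (R ∙ x) ≃ₗ[R] M := (LinearEquiv.ofEq _ _ htop).trans Submodule.topEquiv
  have := IsSimpleModule.congr eqv
  have hproj := Module.Projective.of_equiv eqv.symm
  have := IsSimpleModule.nontrivial R (R ∙ x)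
  obtain ⟨b, hb⟩ := h.exists_isInterval hx
  have hpr := (hb.projective_iff h).1 hproj
  obtain ⟨-, -, y, hy, hy1, hy2, hy3⟩ := hb
  have hy0 : y ≠ 0 := by
    rintro rfl
    rw [Submodule.span_zero_singleton] at hy1
    exact bot_ne_top hy1
  rcases hpr with rfl | rfl
  · exact hy0 (hy.symm.trans hy2)
  obtain ⟨j, hij⟩ := h.exists_succ i
  rcases eq_bot_or_eq_top (R ∙ (φ i j • y)) with h0 | h0
  · obtain ⟨c, hc⟩ := hy3 _ (h.right_mul hij.le) (Submodule.span_singleton_eq_bot.1 h0)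
    refine h.ne_zero hij.le (h.lt_map_of_covBy hf hij) ?_
    rw [hc, (h.eq_zero (h.lt_map i).le).2 le_rfl, mul_zero]
  · obtain ⟨c, hc⟩ := Submodule.mem_span_singleton.1 (h0 ▸ Submodule.mem_top : y ∈ _)
    exact hy0 (eq_zero_of_isNilpotent_smul_eq (h.nilp hij.lt c) (by rw [mul_smul, hc]))

theorem isCyclicNakayama (hf : HasInfiniteResolution f) : IsCyclicNakayama R :=
  ⟨h.isNakayamaAlgebra, h.isConnectedRing hf, fun M _ => h.not_projective_of_isSimpleModule hf M⟩

theorem exists_eq_mul_of_injective (hf : Injective f) {i j : I} (hij : i ≤ j) (hj : j ≤ f i) {w : R}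
    (hw : φ j j * w = w) (hw0 : φ j (f i) * w = 0) : ∃ z, w = φ i j * z := by
  have key : ∀ (k : I) (a : R), ∃ z, w * a * φ k k = φ i j * z := by
    intro k a
    by_cases h0 : w * a * φ k k = 0
    · exact ⟨0, by rw [h0, mul_zero]⟩
    obtain ⟨i', hi', -, ⟨u, hu⟩, v, hv⟩ := h.cofactor (i := k) (j := j) (r := w * a * φ k k)
      (by rw [← mul_assoc, ← mul_assoc, hw]) (by rw [mul_assoc, h.mul_self]) h0
    have hle : f i' ≤ f i := by
      rw [← h.eq_zero (hi'.trans hj), ← h.mul hi' hj, hv, ← mul_assoc, ← mul_assoc, ← mul_assoc,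
        hw0, zero_mul, zero_mul, zero_mul]
    have hi'i : i' ≤ i := by
      by_contra! hc
      exact hc.ne (hf (le_antisymm (h.mono hc.le) hle))
    exact ⟨φ i' i * u, by rw [hu, ← mul_assoc, h.mul hi'i hij]⟩
  obtain ⟨n, k, a, b, h1⟩ := h.full
  choose z hz using fun t => key (k t) (a t)
  refine ⟨∑ t, z t * b t, ?_⟩
  rw [← mul_one w, ← h1, Finset.mul_sum, Finset.mul_sum]
  refine Finset.sum_congr rfl fun t _ => ?_
  rw [← mul_assoc, ← mul_assoc, ← mul_assoc, hz]

theorem isSelfinjectiveRing_of_injective (hf : Injective f) : IsSelfinjectiveRing R := by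
  have := h.isNoetherianRing
  refine Module.Baer.injective fun L g => ?_
  obtain ⟨_, ⟨p, hp, rfl⟩, hmax⟩ := set_has_maximal_iff_noetherian.2
    (inferInstance : IsNoetherian R R) {N | ∃ p : R →ₗ.[R] R, ⟨L, g⟩ ≤ p ∧ p.domain = N}
    ⟨L, ⟨L, g⟩, le_rfl, rfl⟩
  by_cases htop : p.domain = ⊤
  · refine ⟨p.toFun ∘ₗ LinearMap.codRestrict _ LinearMap.id fun x => htop ▸ Submodule.mem_top, ?_⟩
    intro x hx
    exact (hp.2 (x := ⟨x, hx⟩) (y := ⟨x, htop ▸ Submodule.mem_top⟩) rfl).symm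
  exfalso
  obtain ⟨i, b, hy⟩ : ∃ i b, φ i i * b ∉ p.domain := by
    by_contra! hc
    refine htop (eq_top_iff.2 fun x _ => h.mem_of_forall fun k b => ?_)
    rw [smul_eq_mul, mul_assoc]
    exact hc _ _
  set y := φ i i * b with hy_def
  have hiy : φ i i * y = y := by rw [hy_def, ← mul_assoc, h.mul_self]
  obtain ⟨j, hij, hj, h3, -, h4⟩ :=
    h.exists_index (p.domain.comap (LinearMap.toSpanSingleton R R y)) i
  obtain ⟨z, hz⟩ := h.exists_eq_mul_of_injective hf hij hj (w := p ⟨φ i j * y, h3⟩)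
    (by
      rw [← smul_eq_mul, ← p.map_smul]
      exact congrArg p (Subtype.ext (by
        change φ j j * (φ i j * y) = _; rw [← mul_assoc, h.left_mul hij])))
    (by
      rw [← smul_eq_mul, ← p.map_smul, ← p.map_zero]
      exact congrArg p (Subtype.ext (by
        change φ j (f i) * (φ i j * y) = 0
        rw [← mul_assoc, h.mul hij hj, (h.eq_zero (hij.trans hj)).2 le_rfl, zero_mul])))
  have key : ∀ (a : R) (ha : a * y ∈ p.domain), p ⟨a * y, ha⟩ = a * (φ i i * z) := by
    intro a ha
    obtain ⟨c, hc⟩ := h4 (a * φ i i) (by rw [mul_assoc, h.mul_self])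
      (by change a * φ i i * y ∈ p.domain; rwa [mul_assoc, hiy])
    have : (⟨a * y, ha⟩ : p.domain) = c • ⟨φ i j * y, h3⟩ := Subtype.ext (by
      change a * y = c * (φ i j * y)
      rw [← mul_assoc c, ← hc, mul_assoc, hiy])
    rw [this, p.map_smul, hz, smul_eq_mul, ← mul_assoc, ← mul_assoc, hc]
  let q := LinearPMap.mkSpanSingleton' (σ := RingHom.id R) y (φ i i * z) (fun c hc => by
    have h0 : c * y ∈ p.domain := by
      rw [← smul_eq_mul, hc]; exact zero_mem _
    rw [RingHom.id_apply, smul_eq_mul, ← key c h0, ← p.map_zero]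
    exact congrArg p (Subtype.ext hc))
  have hpq : ∀ (s : p.domain) (t : q.domain), (s : R) = t → p s = q t := by
    rintro ⟨s, hs⟩ ⟨t, ht⟩ rfl
    obtain ⟨c, rfl⟩ := Submodule.mem_span_singleton.1 ht
    rw [LinearPMap.mkSpanSingleton'_apply]
    exact key c hs
  refine hmax _ ⟨p.sup q hpq, hp.trans (LinearPMap.left_le_sup p q hpq), rfl⟩ ?_
  refine lt_of_le_of_ne le_sup_left fun h0 => hy ?_
  rw [h0]
  exact Submodule.mem_sup_right (Submodule.mem_span_singleton_self y)

theorem injective_of_isSelfinjectiveRing (hR : IsSelfinjectiveRing R) : Injective f := by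
  have key : ∀ i j, i < j → f i ≠ f j := by
    intro i j hij he
    have hjf : j ≤ f i := he ▸ (h.lt_map j).le
    have hann : ∀ c : R, c • φ i j = 0 → c • φ j j = 0 := by
      intro c hc
      obtain ⟨k, hjk, -, h3, h5, h4⟩ :=
        h.exists_index (LinearMap.ker (LinearMap.toSpanSingleton R R (φ i j))) j
      obtain ⟨d, hd⟩ := h4 (c * φ j j) (by rw [mul_assoc, h.mul_self]) (by
        rw [LinearMap.mem_ker, LinearMap.toSpanSingleton_apply, smul_eq_mul, mul_assoc,
          h.left_mul hij.le]; exact hc)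
      have hk : f i ≤ k := by
        rw [← h.eq_zero (hij.le.trans hjk), ← h.mul hij.le hjk]; exact h3
      rw [smul_eq_mul, hd, (h.eq_zero hjk).2 (he ▸ hk), mul_zero]
    let q := LinearPMap.mkSpanSingleton' (σ := RingHom.id R) (φ i j) (φ j j) hann
    obtain ⟨g, hg⟩ := hR.out q.domain.subtype (Submodule.subtype_injective _) q.toFun
    have hg1 : φ i j * g 1 = φ j j := by
      rw [← smul_eq_mul, ← map_smul, smul_eq_mul, mul_one]
      exact (hg ⟨φ i j, Submodule.mem_span_singleton_self _⟩).trans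
        (LinearPMap.mkSpanSingleton'_apply_self _ _ _ _)
    refine h.self_ne_zero j (eq_zero_of_isNilpotent_smul_eq
      (isNilpotent_mul_swap (h.nilp hij (g 1))) ?_)
    rw [hg1, smul_eq_mul, h.mul_self]
  intro i j hij
  by_contra hne
  rcases lt_or_gt_of_ne hne with hlt | hlt
  · exact key i j hlt hij
  · exact key j i hlt hij.symm

theorem one_le_finDim_iff : 1 ≤ finDim R ↔ ¬ IsSelfinjectiveRing R := by
  have h0 : finDim R = 0 ↔ Injective f := by
    have := (h.finDim_le_iff (2 * 0)).trans (h.boundedResolutions_even_iff 0)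
    rw [← nonpos_iff_eq_zero]
    exact this
  rw [Order.one_le_iff_ne_zero, ne_eq, h0, not_iff_not]
  exact ⟨h.isSelfinjectiveRing_of_injective, h.injective_of_isSelfinjectiveRing⟩

end SerialSystem

/-- A complete set of representatives of the primitive idempotents of a serial ring without simple
projective left modules. -/
structure SerialFamily (A : Type) [Ring A] {ι : Type} (ε : ι → A) : Prop where
  idem : ∀ i, ε i * ε i = ε i
  ne_zero : ∀ i, ε i ≠ 0
  full : ∃ (n : ℕ) (k : Fin n → ι) (a b : Fin n → A), ∑ t, a t * ε (k t) * b t = 1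
  eq_of_mul_eq : ∀ i j a b, a * ε j * b = ε i → i = j
  left_chain : ∀ i x y, x * ε i = x → y * ε i = y → (∃ a, x = a * y) ∨ ∃ a, y = a * x
  right_chain : ∀ i x y, ε i * x = x → ε i * y = y → (∃ a, x = y * a) ∨ ∃ a, y = x * a
  local_corner : ∀ i r, ε i * r = r → r * ε i = r → (∃ v, v * r = ε i) ∨ IsNilpotent r
  not_simple : ∀ i, ∃ y, y * ε i = y ∧ y ≠ 0 ∧ ¬ ∃ a, a * y = ε i

namespace SerialFamily

variable {A : Type} [Ring A] {ι : Type} {ε : ι → A} (h : SerialFamily A ε)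
include h

theorem injective : Injective ε := fun i j hij =>
  h.eq_of_mul_eq i j (ε j) (ε j) (by rw [h.idem, h.idem, hij])

theorem eq_zero_of_forall {x : A} (hx : ∀ k b, ε k * b * x = 0) : x = 0 := by
  obtain ⟨n, k, a, b, h1⟩ := h.full
  rw [← one_mul x, ← h1, Finset.sum_mul]
  refine Finset.sum_eq_zero fun t _ => ?_
  rw [mul_assoc, mul_assoc, ← mul_assoc (ε (k t)), hx, mul_zero]

theorem exists_inv {i : ι} {r : A} (hr : ε i * r = r) (hr' : r * ε i = r) :
    (∃ v, v * r = ε i ∧ r * v = ε i) ∨ IsNilpotent r := by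
  refine (h.local_corner i r hr hr').imp_left ?_
  rintro ⟨v, hv⟩
  have hv' : ε i * v * ε i * r = ε i := by rw [mul_assoc, hr, mul_assoc, hv, h.idem]
  refine ⟨ε i * v * ε i, hv', ?_⟩
  set w := ε i * v * ε i with hw
  have hgg : (r * w) * (r * w) = r * w := by
    rw [mul_assoc, ← mul_assoc w, hv', ← mul_assoc, hr']
  rcases h.local_corner i (r * w) (by rw [← mul_assoc, hr])
    (by rw [hw, mul_assoc, mul_assoc, h.idem]) with ⟨c, hc⟩ | hn
  · have : ε i * (r * w) = ε i := by rw [← hc, mul_assoc, hgg]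
    rwa [← mul_assoc, hr] at this
  · have h0 : r * w = 0 := eq_zero_of_isNilpotent_smul_eq hn hgg
    exact absurd (by rw [← hv', ← hr', ← hv', ← mul_assoc r, h0, zero_mul, mul_zero]) (h.ne_zero i)

/-- The maximal submodule of an indecomposable projective is generated by a homogeneous element. -/
theorem exists_generator [IsNoetherianRing A] (i : ι) : ∃ (j : ι) (x : A), ε j * x = x ∧
    x * ε i = x ∧ x ≠ 0 ∧ (¬ ∃ a, a * x = ε i) ∧
      ∀ k y, ε k * y = y → y * ε i = y → (∃ a, a * y = ε i) ∨ ∃ a, y = a * x := by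
  let Q : ι → A → Prop := fun j x => ε j * x = x ∧ x * ε i = x ∧ x ≠ 0 ∧ ¬ ∃ a, a * x = ε i
  have hQ : ∃ N : Submodule A A, ∃ j x, Q j x ∧ (A ∙ x) = N := by
    obtain ⟨y, hy, hy0, hy1⟩ := h.not_simple i
    obtain ⟨k, b, hkb⟩ : ∃ k b, ε k * b * y ≠ 0 := by
      by_contra! hc
      exact hy0 (h.eq_zero_of_forall hc)
    refine ⟨_, k, ε k * b * y, ⟨by rw [← mul_assoc, ← mul_assoc, h.idem],
      by rw [mul_assoc, hy], hkb, ?_⟩, rfl⟩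
    rintro ⟨a, ha⟩
    exact hy1 ⟨a * (ε k * b), by rw [mul_assoc, ha]⟩
  obtain ⟨_, ⟨j, x, hx, rfl⟩, hmax⟩ := set_has_maximal_iff_noetherian.2
    (inferInstance : IsNoetherian A A) {N | ∃ j x, Q j x ∧ (A ∙ x) = N} hQ
  refine ⟨j, x, hx.1, hx.2.1, hx.2.2.1, hx.2.2.2, fun k y hy hy' => ?_⟩
  by_contra! hc
  rcases h.left_chain i x y hx.2.1 hy' with ⟨a, ha⟩ | ⟨a, ha⟩
  · refine hmax _ ⟨k, y, ⟨hy, hy', ?_, fun ⟨a, ha⟩ => hc.1 a ha⟩, rfl⟩ (lt_of_le_of_ne ?_ ?_)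
    · rintro rfl
      exact hc.2 0 (by rw [zero_mul])
    · rw [Submodule.span_singleton_le_iff_mem, ha]
      exact Submodule.mem_span_singleton.2 ⟨a, rfl⟩
    · intro he
      obtain ⟨c, hcy⟩ := Submodule.mem_span_singleton.1
        (he ▸ Submodule.mem_span_singleton_self y : y ∈ A ∙ x)
      exact hc.2 c hcy.symm
  · exact hc.2 a ha

end SerialFamily

/-- A serial family together with a permutation of the indices and homogeneous generators of the
maximal submodules of the indecomposable projectives. -/
structure SerialQuiver (A : Type) [Ring A] {ι : Type} (ε : ι → A) (s : Equiv.Perm ι)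
    (x : ι → A) : Prop extends SerialFamily A ε where
  left_mul : ∀ i, ε (s i) * x i = x i
  right_mul : ∀ i, x i * ε i = x i
  not_inv : ∀ i, ¬ ∃ a, a * x i = ε i
  dichotomy : ∀ i k y, ε k * y = y → y * ε i = y → (∃ a, a * y = ε i) ∨ ∃ a, y = a * x i

theorem SerialFamily.exists_serialQuiver {A : Type} [Ring A] [IsNoetherianRing A] {ι : Type}
    [Finite ι] {ε : ι → A} (h : SerialFamily A ε) : ∃ s x, SerialQuiver A ε s x := by
  choose s x h1 h2 h0 h3 h4 using h.exists_generator
  have hnil : ∀ i r, IsNilpotent (r * x i) := by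
    intro i r
    have hni := (h.local_corner i (ε i * (r * x i)) (by rw [← mul_assoc, h.idem])
      (by rw [mul_assoc, mul_assoc, h2])).resolve_left
      (fun ⟨v, hv⟩ => h3 i ⟨v * (ε i * r), by simpa only [mul_assoc] using hv⟩)
    have := isNilpotent_mul_swap hni
    rwa [mul_assoc, h2] at this
  have key : ∀ i j, s i = s j → ∀ a, x i = x j * a → i = j := by
    intro i j hij a ha
    have ha' : x i = x j * (ε j * a * ε i) := by
      rw [← mul_assoc, ← mul_assoc, h2, ← ha, h2]
    rcases h4 i j (ε j * a * ε i) (by rw [← mul_assoc, ← mul_assoc, h.idem])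
      (by rw [mul_assoc, h.idem]) with ⟨c, hc⟩ | ⟨c, hc⟩
    · exact h.eq_of_mul_eq i j c (a * ε i) (by simpa only [mul_assoc] using hc)
    · rw [hc, ← mul_assoc] at ha'
      exact absurd (eq_zero_of_isNilpotent_smul_eq (isNilpotent_mul_swap (hnil j c)) ha'.symm) (h0 i)
  have hinj : Injective s := by
    intro i j hij
    rcases h.right_chain (s i) (x i) (x j) (h1 i) (hij ▸ h1 j) with ⟨a, ha⟩ | ⟨a, ha⟩
    · exact key i j hij a ha
    · exact (key j i hij.symm a ha).symm
  exact ⟨Equiv.ofBijective s (Finite.injective_iff_bijective.1 hinj), x, h, h1, h2, h3, h4⟩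

/-- The composition of `m` consecutive arrows starting at `i`. -/
def arrowPath {A : Type} [Ring A] {ι : Type} (ε : ι → A) (s : Equiv.Perm ι) (x : ι → A) (i : ι) :
    ℕ → A
  | 0 => ε i
  | m + 1 => x ((s ^ m) i) * arrowPath ε s x i m

namespace SerialQuiver

variable {A : Type} [Ring A] {ι : Type} {ε : ι → A} {s : Equiv.Perm ι} {x : ι → A}
  (h : SerialQuiver A ε s x)
include h

theorem isNilpotent (i : ι) (r : A) : IsNilpotent (r * x i) := by
  have hni := (h.local_corner i (ε i * (r * x i)) (by rw [← mul_assoc, h.idem])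
    (by rw [mul_assoc, mul_assoc, h.right_mul])).resolve_left
    (fun ⟨v, hv⟩ => h.not_inv i ⟨v * (ε i * r), by simpa only [mul_assoc] using hv⟩)
  have := isNilpotent_mul_swap hni
  rwa [mul_assoc, h.right_mul] at this

theorem arrowPath_right (i : ι) (m : ℕ) : arrowPath ε s x i m * ε i = arrowPath ε s x i m := by
  induction m with
  | zero => exact h.idem i
  | succ m ih => rw [arrowPath, mul_assoc, ih]

theorem arrowPath_left (i : ι) (m : ℕ) :
    ε ((s ^ m) i) * arrowPath ε s x i m = arrowPath ε s x i m := by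
  cases m with
  | zero => exact h.idem i
  | succ m => rw [arrowPath, ← mul_assoc, pow_succ', Equiv.Perm.mul_apply, h.left_mul]

theorem arrowPath_mul (i : ι) (m m' : ℕ) :
    arrowPath ε s x ((s ^ m) i) m' * arrowPath ε s x i m = arrowPath ε s x i (m + m') := by
  induction m' with
  | zero => exact h.arrowPath_left i m
  | succ m' ih =>
    rw [arrowPath, mul_assoc, ih, ← add_assoc, arrowPath, ← Equiv.Perm.mul_apply, ← pow_add,
      add_comm m']

theorem exists_arrowPath_eq_zero [IsArtinianRing A] (i : ι) : ∃ m, arrowPath ε s x i m = 0 := by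
  obtain ⟨m, hm⟩ := IsArtinian.monotone_stabilizes (R := A) (M := A)
    ⟨fun m => OrderDual.toDual (A ∙ arrowPath ε s x i m), monotone_nat_of_le_succ fun m => by
      change (A ∙ arrowPath ε s x i (m + 1)) ≤ A ∙ arrowPath ε s x i m
      rw [Submodule.span_singleton_le_iff_mem]
      exact Submodule.mem_span_singleton.2 ⟨_, rfl⟩⟩
  have h1 : (A ∙ arrowPath ε s x i m) = A ∙ arrowPath ε s x i (m + 1) :=
    congrArg OrderDual.ofDual (hm (m + 1) (Nat.le_succ m))
  obtain ⟨c, hc⟩ := Submodule.mem_span_singleton.1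
    (h1 ▸ Submodule.mem_span_singleton_self _ : arrowPath ε s x i m ∈ _)
  refine ⟨m, eq_zero_of_isNilpotent_smul_eq (h.isNilpotent ((s ^ m) i) c) ?_⟩
  rwa [smul_eq_mul, mul_assoc]

theorem exists_factor [IsArtinianRing A] {i j : ι} {r : A} (hr : ε j * r = r) (hr' : r * ε i = r)
    (hr0 : r ≠ 0) : ∃ m : ℕ, (s ^ m) i = j ∧ (∃ u, r = u * arrowPath ε s x i m) ∧
      ∃ v, arrowPath ε s x i m = v * r := by
  by_contra! hc
  have key : ∀ m, ∃ u, r = u * arrowPath ε s x i m := by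
    intro m
    induction m with
    | zero => exact ⟨r, hr'.symm⟩
    | succ m ih =>
      obtain ⟨u, hu⟩ := ih
      have hu' : r = ε j * u * ε ((s ^ m) i) * arrowPath ε s x i m := by
        rw [mul_assoc, h.arrowPath_left, mul_assoc, ← hu, hr]
      rcases h.dichotomy ((s ^ m) i) j (ε j * u * ε ((s ^ m) i))
        (by rw [← mul_assoc, ← mul_assoc, h.idem]) (by rw [mul_assoc, h.idem]) with ⟨c, hcu⟩ | ⟨c, hcu⟩
      · refine absurd ?_ (hc m (h.eq_of_mul_eq _ _ c (u * ε ((s ^ m) i))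
          (by simpa only [mul_assoc] using hcu)) ⟨u, hu⟩ c)
        rw [hu', ← mul_assoc, hcu, h.arrowPath_left]
      · exact ⟨c, by rw [hu', hcu, mul_assoc, arrowPath]⟩
  obtain ⟨m, hm⟩ := h.exists_arrowPath_eq_zero i
  obtain ⟨u, hu⟩ := key m
  exact hr0 (by rw [hu, hm, mul_zero])

theorem exists_cofactor [IsArtinianRing A] {i j : ι} {r : A} (hr : ε j * r = r) (hr' : r * ε i = r)
    (hr0 : r ≠ 0) : ∃ m : ℕ, (s ^ m) i = j ∧ (∃ u, r = arrowPath ε s x i m * u) ∧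
      ∃ v, arrowPath ε s x i m = r * v := by
  obtain ⟨m, hm, ⟨u, hu⟩, v, hv⟩ := h.exists_factor hr hr' hr0
  refine ⟨m, hm, ?_⟩
  have hl := h.arrowPath_left i m
  rw [hm] at hl
  have hrr := h.arrowPath_right i m
  set p := arrowPath ε s x i m
  have zero_of : ∀ c d q : A, IsNilpotent d → q = c * q * d → q = 0 := by
    rintro c d q ⟨n, hn⟩ hq
    have : ∀ n : ℕ, q = c ^ n * q * d ^ n := by
      intro n
      induction n with
      | zero => simp
      | succ n ih =>
        rw [pow_succ, pow_succ']
        calc q = c ^ n * q * d ^ n := ih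
          _ = c ^ n * (c * q * d) * d ^ n := by rw [← hq]
          _ = _ := by simp only [mul_assoc]
    rw [this n, hn, mul_zero]
  have corner : ∀ a : A, ε i * (ε i * a * ε i) = ε i * a * ε i ∧
      (ε i * a * ε i) * ε i = ε i * a * ε i := fun a =>
    ⟨by rw [← mul_assoc, ← mul_assoc, h.idem], by rw [mul_assoc, h.idem]⟩
  rcases h.right_chain j r p hr hl with ⟨a, ha⟩ | ⟨a, ha⟩
  · have ha' : r = p * (ε i * a * ε i) := by rw [← mul_assoc, ← mul_assoc, hrr, ← ha, hr']
    rcases h.exists_inv (corner a).1 (corner a).2 with ⟨c, -, hc⟩ | hn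
    · exact ⟨⟨_, ha'⟩, c, by rw [ha', mul_assoc, hc, hrr]⟩
    · have hp0 := zero_of v _ p hn (by rw [mul_assoc, ← ha', ← hv])
      exact absurd (by rw [hu, hp0, mul_zero]) hr0
  · have ha' : p = r * (ε i * a * ε i) := by rw [← mul_assoc, ← mul_assoc, hr', ← ha, hrr]
    rcases h.exists_inv (corner a).1 (corner a).2 with ⟨c, -, hc⟩ | hn
    · exact ⟨⟨c, by rw [ha', mul_assoc, hc, hr']⟩, _, ha'⟩
    · exact absurd (zero_of u _ r hn (by rw [mul_assoc, ← ha', ← hu])) hr0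

theorem sameCycle [IsArtinianRing A] (hA : IsConnectedRing A) (i j : ι) : s.SameCycle i j := by
  have hzero : ∀ i j a, ¬ s.SameCycle i j → ε j * a * ε i = 0 := by
    intro i j a hij
    by_contra h0
    obtain ⟨m, hm, -⟩ := h.exists_factor (i := i) (j := j) (by rw [← mul_assoc, ← mul_assoc, h.idem])
      (by rw [mul_assoc, h.idem]) h0
    exact hij ⟨m, by simpa using hm⟩
  obtain ⟨n, k, a, b, h1⟩ := h.full
  let u := ∑ t with s.SameCycle i (k t), a t * ε (k t) * b t
  let v := ∑ t with ¬ s.SameCycle i (k t), a t * ε (k t) * b t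
  have huv : u + v = 1 := by rw [← h1]; exact Finset.sum_filter_add_sum_filter_not _ _ _
  have h2 : ∀ r, u * r * v = 0 := by
    intro r
    simp only [u, v, Finset.sum_mul, Finset.mul_sum]
    refine Finset.sum_eq_zero fun t' ht' => Finset.sum_eq_zero fun t ht => ?_
    rw [Finset.mem_filter] at ht ht'
    have := hzero (k t') (k t) (b t * r * a t') fun hs => ht'.2 (ht.2.trans hs.symm)
    calc _ = a t * (ε (k t) * (b t * r * a t') * ε (k t')) * b t' := by simp only [mul_assoc]
      _ = 0 := by rw [this, mul_zero, zero_mul]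
  have h3 : ∀ r, v * r * u = 0 := by
    intro r
    simp only [u, v, Finset.sum_mul, Finset.mul_sum]
    refine Finset.sum_eq_zero fun t' ht' => Finset.sum_eq_zero fun t ht => ?_
    rw [Finset.mem_filter] at ht ht'
    have := hzero (k t') (k t) (b t * r * a t') fun hs => ht.2 (ht'.2.trans hs)
    calc _ = a t * (ε (k t) * (b t * r * a t') * ε (k t')) * b t' := by simp only [mul_assoc]
      _ = 0 := by rw [this, mul_zero, zero_mul]
  have hu : u * u = u := by
    have := h2 1
    rw [mul_one] at this
    rw [← add_zero (u * u), ← this, ← mul_add, huv, mul_one]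
  have hc : ∀ r, u * r = r * u := by
    intro r
    calc u * r = u * r * (u + v) := by rw [huv, mul_one]
      _ = (u + v) * r * u := by rw [mul_add, h2, add_mul, add_mul, h3]
      _ = r * u := by rw [huv, one_mul]
  by_contra hij
  rcases hA u hu (by rw [Semigroup.mem_center_iff]; exact fun r => (hc r).symm) with h0 | h0
  · refine h.ne_zero i ?_
    rw [← h.idem, ← mul_one (ε i), ← huv, h0, zero_add, Finset.mul_sum, Finset.sum_mul]
    refine Finset.sum_eq_zero fun t ht => ?_
    rw [Finset.mem_filter] at ht
    rw [← mul_assoc, ← mul_assoc, hzero _ _ _ fun hs => ht.2 hs.symm, zero_mul, zero_mul]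
  · refine h.ne_zero j ?_
    rw [← h.idem, ← mul_one (ε j), ← h0, Finset.mul_sum, Finset.sum_mul]
    refine Finset.sum_eq_zero fun t ht => ?_
    rw [Finset.mem_filter] at ht
    rw [← mul_assoc, ← mul_assoc, hzero _ _ _ fun hs => hij (ht.2.trans hs), zero_mul, zero_mul]

end SerialQuiver

namespace SerialQuiver

variable {A : Type} [Ring A] {ι : Type} {ε : ι → A} {s : Equiv.Perm ι} {x : ι → A}

theorem arrowPath_zpow_mul (h : SerialQuiver A ε s x) (o : ι) {i j k : ℤ} (hij : i ≤ j)
    (hjk : j ≤ k) :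
    arrowPath ε s x ((s ^ j) o) (k - j).toNat * arrowPath ε s x ((s ^ i) o) (j - i).toNat =
      arrowPath ε s x ((s ^ i) o) (k - i).toNat := by
  have h1 : (s ^ j) o = (s ^ (j - i).toNat) ((s ^ i) o) := by
    rw [← Equiv.Perm.mul_apply, ← zpow_natCast, ← zpow_add]
    congr 2; omega
  rw [h1, h.arrowPath_mul]
  congr 1; omega

/-- A connected serial quiver unrolls to a serial system over the integers. -/
theorem exists_serialSystem [IsArtinianRing A] [Finite ι] [Nonempty ι] (h : SerialQuiver A ε s x)
    (hA : IsConnectedRing A) : ∃ (σ : ℤ ≃o ℤ) (f : ℤ → ℤ) (φ : ℤ → ℤ → A),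
      SerialSystem A ℤ σ f φ := by
  obtain ⟨o⟩ := ‹Nonempty ι›
  have hex := fun i : ℤ => h.exists_arrowPath_eq_zero ((s ^ i) o)
  let f : ℤ → ℤ := fun i => i + Nat.find (hex i)
  let φ : ℤ → ℤ → A := fun i j => arrowPath ε s x ((s ^ i) o) (j - i).toNat
  have hφ : ∀ i, φ i i = ε ((s ^ i) o) := fun i => by
    change arrowPath ε s x ((s ^ i) o) (i - i).toNat = _
    rw [sub_self]; rfl
  have hn : 0 < orderOf s := orderOf_pos s
  have hperiod : ∀ i : ℤ, (s ^ (i + orderOf s)) o = (s ^ i) o := fun i => by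
    rw [zpow_add, zpow_natCast, pow_orderOf_eq_one, mul_one]
  have hf_congr : ∀ i j, (s ^ i) o = (s ^ j) o → f j = f i + (j - i) := by
    intro i j hij
    have : Nat.find (hex i) = Nat.find (hex j) := by simp only [hij]
    simp only [f, this]; ring
  have hzero : ∀ i j, i ≤ j → (φ i j = 0 ↔ f i ≤ j) := by
    intro i j hij
    constructor
    · intro h0
      have := Nat.find_min' (hex i) h0
      simp only [f]; omega
    · intro h0
      have h1 : φ i (f i) = 0 := by
        have := Nat.find_spec (hex i)
        change arrowPath ε s x ((s ^ i) o) (i + _ - i).toNat = 0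
        rwa [add_sub_cancel_left, Int.toNat_natCast]
      change arrowPath ε s x ((s ^ i) o) (j - i).toNat = 0
      rw [← h.arrowPath_zpow_mul o (j := f i) (by simp only [f]; omega) h0]
      exact (congrArg _ h1).trans (mul_zero _)
  have hlt : ∀ i, i < f i := fun i => by
    by_contra! hc
    exact h.ne_zero _ ((hφ i).symm.trans ((hzero i i le_rfl).2 hc))
  have hmul : ∀ {i j k}, i ≤ j → j ≤ k → φ j k * φ i j = φ i k := fun hij hjk =>
    h.arrowPath_zpow_mul o hij hjk
  have hcover : ∀ t, ∃ i : ℤ, (s ^ i) o = t := fun t => h.sameCycle hA o t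
  refine ⟨OrderIso.addRight (orderOf s : ℤ), f, φ, ⟨?_, ?_, ?_, ?_, hlt⟩, hmul, hzero _ _, ?_, ?_, ?_, ?_, ?_, ?_⟩
  · intro i
    simp only [OrderIso.addRight_apply]; omega
  · exact fun i j => Set.finite_Icc i j
  · intro i j hij
    rw [← hzero _ _ (hij.trans (hlt j).le), ← hmul hij (hlt j).le, (hzero j _ (hlt j).le).2 le_rfl,
      zero_mul]
  · intro i
    simp only [OrderIso.addRight_apply]
    rw [hf_congr i _ (hperiod i).symm]; ring
  · intro i j r hr hr' hr0
    rw [hφ] at hr hr'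
    obtain ⟨m, hm, hu, hv⟩ := h.exists_factor hr hr' hr0
    have hφm : φ i (i + m) = arrowPath ε s x ((s ^ i) o) m := by
      simp only [φ, add_sub_cancel_left, Int.toNat_natCast]
    refine ⟨i + m, by omega, ?_, by rwa [hφm], by rwa [hφm]⟩
    rw [hφ, hφ, ← hm, add_comm, zpow_add, zpow_natCast, Equiv.Perm.mul_apply]
  · intro i j r hr hr' hr0
    rw [hφ] at hr hr'
    obtain ⟨m, hm, hu, hv⟩ := h.exists_cofactor hr hr' hr0
    have hji : (s ^ (j - m)) o = (s ^ i) o := by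
      apply (s ^ m).injective
      rw [hm, ← Equiv.Perm.mul_apply, ← zpow_natCast, ← zpow_add]
      congr 2; omega
    have hφm : φ (j - m) j = arrowPath ε s x ((s ^ i) o) m := by
      simp only [φ, sub_sub_cancel, Int.toNat_natCast, hji]
    exact ⟨j - m, by omega, by rw [hφ, hφ, hji], by rwa [hφm], by rwa [hφm]⟩
  · intro i j hij r
    have h1 : φ i (i + 1) = x ((s ^ i) o) := by
      simp only [φ, add_sub_cancel_left, Int.toNat_one]
      change x ((s ^ 0) ((s ^ i) o)) * ε _ = _
      rw [pow_zero, Equiv.Perm.one_apply, h.right_mul]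
    rw [← hmul (Int.le.intro 1 rfl : i ≤ i + 1) hij, h1, ← mul_assoc]
    exact h.isNilpotent _ _
  · obtain ⟨n, k, a, b, h1⟩ := h.full
    choose g hg using hcover
    exact ⟨n, fun t => g (k t), a, b, by simpa only [hφ, hg] using h1⟩
  · intro i
    rw [hφ, hφ, OrderIso.addRight_apply, hperiod]
  · intro i j hij
    rw [hφ, hφ] at hij
    have hij' := h.injective hij
    have hsh : ∀ y : ℤ, (s ^ (y + (j - i))) o = (s ^ y) o := fun y => by
      rw [show y + (j - i) = (y - i) + j by ring, zpow_add, Equiv.Perm.mul_apply, ← hij',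
        ← Equiv.Perm.mul_apply, ← zpow_add, sub_add_cancel]
    refine ⟨OrderIso.addRight (j - i), by simp, fun y => ⟨?_, ?_⟩⟩
    · simp only [OrderIso.addRight_apply]
      rw [hf_congr y _ (hsh y).symm]; ring
    · rw [hφ, hφ, OrderIso.addRight_apply, hsh]

end SerialQuiver

/-- A nonzero idempotent that does not decompose as a sum of two orthogonal nonzero idempotents. -/
structure IsPrimitiveIdempotent {A : Type} [Ring A] (e : A) : Prop where
  idem : e * e = e
  ne_zero : e ≠ 0
  eq_or : ∀ g, g * g = g → e * g = g → g * e = g → g = 0 ∨ g = e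

/-- The two-sided ideal generated by `E`, as an additive submonoid. -/
def twoSidedSpan {A : Type} [Ring A] (E : Set A) : AddSubmonoid A :=
  AddSubmonoid.closure {x | ∃ e ∈ E, ∃ a b, x = a * e * b}

section

variable {A : Type} [Ring A]

theorem mul_mem_twoSidedSpan {E : Set A} {e : A} (he : e ∈ E) (a b : A) :
    a * e * b ∈ twoSidedSpan E :=
  AddSubmonoid.subset_closure ⟨e, he, a, b, rfl⟩

theorem twoSidedSpan_mono {E F : Set A} (h : E ⊆ F) : twoSidedSpan E ≤ twoSidedSpan F :=
  AddSubmonoid.closure_mono fun _ ⟨e, he, hx⟩ => ⟨e, h he, hx⟩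

theorem exists_sum_of_mem_twoSidedSpan {E : Set A} {x : A} (hx : x ∈ twoSidedSpan E) :
    ∃ (n : ℕ) (k : Fin n → E) (a b : Fin n → A), ∑ t, a t * k t * b t = x := by
  obtain ⟨l, hl, rfl⟩ := AddSubmonoid.exists_list_of_mem_closure hx
  choose e he a b hab using fun t : Fin l.length => hl (l.get t) (l.get_mem t)
  refine ⟨l.length, fun t => ⟨e t, he t⟩, a, b, ?_⟩
  rw [← List.sum_ofFn]
  congr 1
  conv_rhs => rw [← List.ofFn_get l]
  exact congrArg List.ofFn (funext fun t => (hab t).symm)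

/-- In an Artinian ring every idempotent lies in the ideal generated by finitely many primitive
idempotents. -/
theorem exists_primitive_of_idempotent [IsArtinianRing A] (g : A) (hg : g * g = g) :
    ∃ E : Finset A, (∀ e ∈ E, IsPrimitiveIdempotent e) ∧ g ∈ twoSidedSpan (E : Set A) := by
  obtain ⟨N, hN⟩ : ∃ N : Submodule A A, (A ∙ g) = N := ⟨_, rfl⟩
  induction N using WellFoundedLT.induction generalizing g with | _ N ih => ?_
  by_cases h0 : g = 0
  · exact ⟨∅, by simp, h0 ▸ zero_mem _⟩
  by_cases hp : IsPrimitiveIdempotent g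
  · exact ⟨{g}, by simpa using hp, by
      have := mul_mem_twoSidedSpan (E := (({g} : Finset A) : Set A)) (e := g) (by simp) g g
      rwa [hg, hg] at this⟩
  obtain ⟨e, he, hge, heg, he0, heg'⟩ : ∃ e, e * e = e ∧ g * e = e ∧ e * g = e ∧ e ≠ 0 ∧ e ≠ g := by
    by_contra! hc
    exact hp ⟨hg, h0, fun e h1 h2 h3 => or_iff_not_imp_left.2 (hc e h1 h2 h3)⟩
  have key : ∀ e, e * e = e → g * e = e → e * g = e → e ≠ g → ∃ E : Finset A,
      (∀ e ∈ E, IsPrimitiveIdempotent e) ∧ e ∈ twoSidedSpan (E : Set A) := by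
    intro e he hge heg heg'
    refine ih _ ?_ e he rfl
    rw [← hN]
    refine lt_of_le_of_ne ?_ fun hEq => heg' ?_
    · rw [Submodule.span_singleton_le_iff_mem]
      exact Submodule.mem_span_singleton.2 ⟨e, heg⟩
    · obtain ⟨a, ha⟩ := Submodule.mem_span_singleton.1
        (hEq ▸ Submodule.mem_span_singleton_self g : g ∈ A ∙ e)
      rw [← hge, ← ha, smul_eq_mul, mul_assoc, he]
  obtain ⟨E, hE, hEe⟩ := key e he hge heg heg'
  obtain ⟨F, hF, hFe⟩ := key (g - e) (by rw [sub_mul, mul_sub, mul_sub, hg, hge, heg, he]; abel)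
    (by rw [mul_sub, hg, hge]) (by rw [sub_mul, hg, heg]) (by simpa using he0)
  refine ⟨E ∪ F, fun e he => (Finset.mem_union.1 he).elim (hE e) (hF e), ?_⟩
  have := add_mem (twoSidedSpan_mono (F := ((E ∪ F : Finset A) : Set A)) (by simp) hEe)
    (twoSidedSpan_mono (F := ((E ∪ F : Finset A) : Set A)) (by simp) hFe)
  rwa [add_sub_cancel] at this

theorem exists_basic_primitive [IsArtinianRing A] : ∃ E : Finset A,
    (∀ e ∈ E, IsPrimitiveIdempotent e) ∧ 1 ∈ twoSidedSpan (E : Set A) ∧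
      ∀ e ∈ E, ∀ e' ∈ E, ∀ a b, a * e' * b = e → e = e' := by
  let Q : Finset A → Prop := fun E =>
    (∀ e ∈ E, IsPrimitiveIdempotent e) ∧ 1 ∈ twoSidedSpan (E : Set A)
  obtain ⟨E, hE, hmin⟩ := WellFounded.has_min (measure Finset.card).wf {E | Q E}
    (exists_primitive_of_idempotent (1 : A) (one_mul 1))
  refine ⟨E, hE.1, hE.2, fun e he e' he' a b hab => ?_⟩
  by_contra hne
  refine hmin (E.erase e) ⟨fun g hg => hE.1 g (Finset.mem_of_mem_erase hg), ?_⟩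
    (Finset.card_erase_lt_of_mem he)
  refine (AddSubmonoid.closure_le.2 ?_ : twoSidedSpan (E : Set A) ≤ _) hE.2
  rintro _ ⟨g, hg, c, d, rfl⟩
  by_cases hge : g = e
  · have := mul_mem_twoSidedSpan (E := ((E.erase e : Finset A) : Set A)) (e := e')
      (by simpa using ⟨he', Ne.symm hne⟩) (c * a) (b * d)
    have hEq : c * g * d = c * a * e' * (b * d) := by rw [hge, ← hab]; simp only [mul_assoc]
    rw [hEq]
    exact this
  · exact mul_mem_twoSidedSpan (by simpa using ⟨hg, hge⟩) c d

namespace IsPrimitiveIdempotent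

variable {e : A} (he : IsPrimitiveIdempotent e)
include he

theorem op : IsPrimitiveIdempotent (MulOpposite.op e) where
  idem := by rw [← MulOpposite.op_mul, he.idem]
  ne_zero := by simpa using he.ne_zero
  eq_or g h1 h2 h3 := by
    obtain ⟨g, rfl⟩ := MulOpposite.op_surjective g
    simp only [← MulOpposite.op_mul, MulOpposite.op_inj] at h1 h2 h3
    simpa using he.eq_or g h1 h3 h2

theorem mem_span_iff {x : A} : x ∈ A ∙ e ↔ x * e = x :=
  Submodule.mem_span_singleton.trans
    ⟨fun ⟨a, ha⟩ => by rw [← ha, smul_eq_mul, mul_assoc, he.idem], fun h => ⟨x, h⟩⟩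

theorem indecomposableModule : IndecomposableModule A (ModuleCat.of A (A ∙ e)) := by
  let e' : A ∙ e := ⟨e, Submodule.mem_span_singleton_self e⟩
  refine ⟨⟨⟨0, e', fun h0 => he.ne_zero (congrArg Subtype.val h0).symm⟩⟩, fun N N' hc => ?_⟩
  change Submodule A (A ∙ e) at N N'
  have hsmul : ∀ y : A ∙ e, y = (y : A) • e' := fun y => Subtype.ext (he.mem_span_iff.1 y.2).symm
  obtain ⟨n, hn, n', hn', hnn'⟩ := Submodule.mem_sup.1
    (hc.sup_eq_top ▸ Submodule.mem_top : e' ∈ N ⊔ N')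
  have hdisj : ∀ y, y ∈ N → y ∈ N' → y = 0 := fun y => Submodule.disjoint_def.1 hc.disjoint y
  have hadd : (n : A) + n' = e := congrArg Subtype.val hnn'
  have h1 : n = (n : A) • n + (n : A) • n' := by rw [← smul_add, hnn', ← hsmul]
  have h2 : n' = (n' : A) • n + (n' : A) • n' := by rw [← smul_add, hnn', ← hsmul]
  have h3 : (n : A) • n' = 0 := hdisj _
    (by rw [← sub_eq_of_eq_add' h1]; exact sub_mem hn (N.smul_mem _ hn)) (N'.smul_mem _ hn')
  have h4 : (n' : A) • n = 0 := hdisj _ (N.smul_mem _ hn)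
    (by rw [← sub_eq_of_eq_add h2]; exact sub_mem hn' (N'.smul_mem _ hn'))
  rw [h3, add_zero] at h1
  have h1' : (n : A) * n = n := (congrArg Subtype.val h1).symm
  have h4' : (n' : A) * n = 0 := congrArg Subtype.val h4
  rcases he.eq_or n h1' ((congrArg (· * (n : A)) hadd).symm.trans
    ((add_mul _ _ _).trans (by rw [h1', h4', add_zero]))) (he.mem_span_iff.1 n.2)
    with h0 | h0
  · left
    rw [h0, zero_add] at hadd
    have : N' = ⊤ := eq_top_iff.2 fun y _ => by
      rw [hsmul y, show e' = n' from Subtype.ext hadd.symm]; exact N'.smul_mem _ hn'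
    rw [this] at hc
    exact disjoint_top.1 hc.disjoint
  · right
    exact eq_top_iff.2 fun y _ => by
      rw [hsmul y, show e' = n from Subtype.ext h0.symm]; exact N.smul_mem _ hn

theorem left_chain (hA : IsNakayamaRing A) {x y : A} (hx : x * e = x) (hy : y * e = y) :
    (∃ a, x = a * y) ∨ ∃ a, y = a * x := by
  let x' : A ∙ e := ⟨x, he.mem_span_iff.2 hx⟩
  let y' : A ∙ e := ⟨y, he.mem_span_iff.2 hy⟩
  rcases hA.2 (ModuleCat.of A (A ∙ e)) (inferInstance : Module.Finite A (A ∙ e))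
    he.indecomposableModule (A ∙ x' : Submodule A (A ∙ e)) (A ∙ y' : Submodule A (A ∙ e)) with h | h
  · left
    obtain ⟨a, ha⟩ := Submodule.mem_span_singleton.1 (h (Submodule.mem_span_singleton_self x'))
    exact ⟨a, (congrArg Subtype.val ha).symm⟩
  · right
    obtain ⟨a, ha⟩ := Submodule.mem_span_singleton.1 (h (Submodule.mem_span_singleton_self y'))
    exact ⟨a, (congrArg Subtype.val ha).symm⟩

theorem right_chain (hA : IsNakayamaRing Aᵐᵒᵖ) {x y : A} (hx : e * x = x) (hy : e * y = y) :
    (∃ a, x = y * a) ∨ ∃ a, y = x * a := by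
  have key : ∀ {x y : A}, (∃ a, MulOpposite.op x = a * MulOpposite.op y) → ∃ a, x = y * a := by
    rintro x y ⟨a, ha⟩
    exact ⟨MulOpposite.unop a, by simpa using congrArg MulOpposite.unop ha⟩
  exact (he.op.left_chain hA (x := MulOpposite.op x) (y := MulOpposite.op y)
    (by rw [← MulOpposite.op_mul, hx]) (by rw [← MulOpposite.op_mul, hy])).imp key key

theorem local_corner [IsArtinianRing A] {r : A} (hr : e * r = r) (hr' : r * e = r) :
    (∃ v, v * r = e) ∨ IsNilpotent r := by
  let e' : A ∙ e := ⟨e, Submodule.mem_span_singleton_self e⟩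
  let ρ : Module.End A (A ∙ e) := (LinearMap.toSpanSingleton A _
    (⟨r, he.mem_span_iff.2 hr'⟩ : A ∙ e)).domRestrict (A ∙ e)
  have hρ : ∀ n : ℕ, ((ρ ^ (n + 1)) e' : A) = r ^ (n + 1) := by
    intro n
    induction n with
    | zero => rw [zero_add, pow_one, pow_one]; exact hr
    | succ n ih =>
      rw [pow_succ' ρ (n + 1), Module.End.mul_apply, pow_succ r (n + 1), ← ih]; rfl
  obtain ⟨n, hn⟩ := (LinearMap.eventually_isCompl_ker_pow_range_pow ρ).exists_forall_of_atTop
  have hn1 := hn (n + 1) (Nat.le_succ n)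
  rcases he.indecomposableModule.2 _ _ hn1 with h0 | h0
  · left
    rw [h0] at hn1
    obtain ⟨y, hy⟩ : e' ∈ LinearMap.range (ρ ^ (n + 1)) := by
      rw [codisjoint_bot.1 hn1.codisjoint.symm]; exact Submodule.mem_top
    rw [pow_succ', Module.End.mul_apply] at hy
    exact ⟨((ρ ^ n) y : A ∙ e), congrArg Subtype.val hy⟩
  · right
    refine ⟨n + 1, ?_⟩
    rw [← hρ]
    exact congrArg Subtype.val (LinearMap.mem_ker.1 (h0 ▸ Submodule.mem_top : e' ∈ _))

theorem not_simple (hA : ∀ M : ModuleCat.{0} A, IsSimpleModule A M → ¬ Module.Projective A M) :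
    ∃ y, y * e = y ∧ y ≠ 0 ∧ ¬ ∃ a, a * y = e := by
  by_contra! hc
  refine hA (ModuleCat.of A (A ∙ e)) ?_ ?_
  · change IsSimpleModule A (A ∙ e)
    rw [isSimpleModule_iff_toSpanSingleton_surjective]
    refine ⟨he.indecomposableModule.1, fun y hy => ?_⟩
    intro z
    obtain ⟨a, ha⟩ := hc y (he.mem_span_iff.1 y.2) (by simpa using hy)
    exact ⟨z * a, Subtype.ext (by
      change (z : A) * a * y = z
      rw [mul_assoc, ha, he.mem_span_iff.1 z.2])⟩
  · refine Module.Projective.of_split (A ∙ e).subtype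
      (LinearMap.toSpanSingleton A _ ⟨e, Submodule.mem_span_singleton_self _⟩) ?_
    ext ⟨y, hy⟩
    exact congrArg Subtype.val (Subtype.ext (he.mem_span_iff.1 hy) : (⟨y * e, _⟩ : A ∙ e) = ⟨y, hy⟩)

end IsPrimitiveIdempotent

theorem IsCyclicNakayama.exists_serialSystem [Nontrivial A] (hA : IsCyclicNakayama A) :
    ∃ (σ : ℤ ≃o ℤ) (f : ℤ → ℤ) (φ : ℤ → ℤ → A), SerialSystem A ℤ σ f φ := by
  obtain ⟨⟨hl, hr⟩, hc, hs⟩ := hA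
  have := hl.1
  obtain ⟨E, hE, hE1, hE2⟩ := exists_basic_primitive (A := A)
  have hfull := exists_sum_of_mem_twoSidedSpan hE1
  have h : SerialFamily A (fun e : E => (e : A)) :=
    { idem := fun e => (hE e e.2).idem
      ne_zero := fun e => (hE e e.2).ne_zero
      full := hfull
      eq_of_mul_eq := fun e e' a b hab => Subtype.ext (hE2 e e.2 e' e'.2 a b hab)
      left_chain := fun e x y => (hE e e.2).left_chain hl
      right_chain := fun e x y => (hE e e.2).right_chain hr
      local_corner := fun e r => (hE e e.2).local_corner
      not_simple := fun e => (hE e e.2).not_simple hs }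
  have : Nonempty E := by
    by_contra! hemp
    obtain ⟨n, k, a, b, h1⟩ := hfull
    have : IsEmpty (Fin n) := ⟨fun t => hemp.elim (k t)⟩
    rw [Finset.univ_eq_empty, Finset.sum_empty] at h1
    exact zero_ne_one h1
  obtain ⟨s, x, hq⟩ := h.exists_serialQuiver
  exact hq.exists_serialSystem hc

end

/-- A ring `D` of generalized matrices over `A`, with entries at position `(s, t)` in
`g t * A * g s`. -/
structure CornerFrame {A D ι : Type} [Ring A] [Ring D] [Fintype ι] (g : ι → A)
    (Θ : ι → ι → A → D) : Prop where
  mul : ∀ s t u a b, Θ t u b * Θ s t a = Θ s u (b * g t * a)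
  eq_zero : ∀ s t a, Θ s t a = 0 ↔ g t * a * g s = 0
  exists_eq : ∀ s t r, Θ t t (g t) * r = r → r * Θ s s (g s) = r →
    ∃ a, r = Θ s t a ∧ g t * a = a ∧ a * g s = a
  sum_eq : ∑ s, Θ s s (g s) = 1
  eq_of_eq : ∀ s t, Θ s s (g s) = Θ t t (g t) → s = t

section

variable {A : Type} [Ring A]

theorem exists_cornerFrame {ι : Type} [Fintype ι] (g : ι → A) (hg : ∀ s, g s * g s = g s)
    (hg0 : ∀ s, g s ≠ 0) :
    ∃ Θ : ι → ι → A → (Module.End A (DirectSum ι fun s => ↥(A ∙ g s)))ᵐᵒᵖ, CornerFrame g Θ := by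
  have hmem : ∀ s (x : A ∙ g s), (x : A) * g s = x := fun s x => by
    obtain ⟨a, ha⟩ := Submodule.mem_span_singleton.1 x.2
    rw [← ha, smul_eq_mul, mul_assoc, hg]
  let γ : ∀ s, A ∙ g s := fun s => ⟨g s, Submodule.mem_span_singleton_self _⟩
  have hγ : ∀ s (x : A ∙ g s), x = (x : A) • γ s := fun s x => Subtype.ext (hmem s x).symm
  let ρ : ∀ s t, A → (A ∙ g t) →ₗ[A] (A ∙ g s) := fun s t a =>
    (LinearMap.toSpanSingleton A (A ∙ g s) (a • γ s)).domRestrict (A ∙ g t)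
  have hρ : ∀ s t a (x : A ∙ g t), (ρ s t a x : A) = x * (a * g s) := fun s t a x => rfl
  let θ : ι → ι → A → Module.End A (DirectSum ι fun s => ↥(A ∙ g s)) := fun s t a =>
    DirectSum.lof A ι (fun s => ↥(A ∙ g s)) s ∘ₗ ρ s t a ∘ₗ
      DirectSum.component A ι (fun s => ↥(A ∙ g s)) t
  have hθ1 : ∀ s, θ s s (g s) = DirectSum.lof A ι (fun s => ↥(A ∙ g s)) s ∘ₗ
      DirectSum.component A ι (fun s => ↥(A ∙ g s)) s := fun s => by
    refine LinearMap.ext fun x => ?_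
    simp only [θ, LinearMap.comp_apply]
    refine congrArg _ (Subtype.ext ?_)
    rw [hρ, hg, hmem]
  have hz : ∀ s t a, θ s t a = 0 ↔ g t * a * g s = 0 := by
    intro s t a
    constructor
    · intro h0
      have := congrArg (DirectSum.component A ι (fun s => ↥(A ∙ g s)) s)
        (LinearMap.congr_fun h0 (DirectSum.lof A ι (fun s => ↥(A ∙ g s)) t (γ t)))
      simp only [θ, LinearMap.comp_apply, DirectSum.component.lof_self, LinearMap.zero_apply,
        map_zero] at this
      rw [mul_assoc]
      exact congrArg Subtype.val this
    · intro h0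
      have : ρ s t a = 0 := by
        ext x
        rw [hρ, ← hmem t x, mul_assoc, ← mul_assoc (g t), h0, mul_zero]
        rfl
      simp only [θ, this, LinearMap.zero_comp, LinearMap.comp_zero]
  refine ⟨fun s t a => .op (θ s t a), ?_, ?_, ?_, ?_, ?_⟩
  · intro s t u a b
    rw [← MulOpposite.op_mul]
    refine congrArg _ (LinearMap.ext fun x => ?_)
    simp only [θ, Module.End.mul_apply, LinearMap.comp_apply, DirectSum.component.lof_self]
    refine congrArg _ (Subtype.ext ?_)
    simp only [hρ, mul_assoc]
  · intro s t a
    rw [MulOpposite.op_eq_zero_iff, hz]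
  · intro s t r ht hs
    obtain ⟨r, rfl⟩ := MulOpposite.op_surjective r
    rw [← MulOpposite.op_mul, MulOpposite.op_inj, hθ1] at ht hs
    let y := DirectSum.component A ι (fun s => ↥(A ∙ g s)) s
      (r (DirectSum.lof A ι (fun s => ↥(A ∙ g s)) t (γ t)))
    have hy : g t • y = y := by
      rw [← map_smul, ← map_smul, ← map_smul]
      exact congrArg _ (congrArg _ (congrArg _ (Subtype.ext (hg t))))
    refine ⟨y, congrArg _ (LinearMap.ext fun x => ?_), congrArg Subtype.val hy, hmem s y⟩
    have e1 := LinearMap.congr_fun ht x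
    have e2 := LinearMap.congr_fun hs (r x)
    have e3 := LinearMap.congr_fun hs x
    simp only [Module.End.mul_apply, LinearMap.comp_apply] at e1 e2 e3
    rw [← e3, ← e1]
    simp only [θ, LinearMap.comp_apply]
    refine congrArg _ ?_
    rw [hγ t (DirectSum.component A ι (fun s => ↥(A ∙ g s)) t x), map_smul, map_smul, map_smul]
    refine Subtype.ext ?_
    simp only [map_smul]
    rw [Submodule.coe_smul, Submodule.coe_smul, hρ]
    change _ * (y : A) = _ * (g t * (y * g s))
    rw [hmem, ← smul_eq_mul (g t), ← Submodule.coe_smul, hy]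
  · refine (map_sum MulOpposite.opAddEquiv _ _).symm.trans (congrArg MulOpposite.op ?_)
    simp only [hθ1]
    refine LinearMap.ext fun x => ?_
    rw [LinearMap.sum_apply]
    exact DirectSum.sum_univ_of x
  · intro s t hst
    by_contra hne
    replace hst := MulOpposite.op_injective hst
    rw [hθ1, hθ1] at hst
    have := congrArg (DirectSum.component A ι (fun s => ↥(A ∙ g s)) s)
        (LinearMap.congr_fun hst (DirectSum.lof A ι (fun s => ↥(A ∙ g s)) s (γ s)))
    simp only [LinearMap.comp_apply, DirectSum.component.lof_self] at this
    rw [DirectSum.component.of, dif_neg (Ne.symm hne)] at this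
    exact hg0 s (congrArg Subtype.val this)

end

namespace SerialSystem

variable {R : Type} [Ring R] {I : Type} [LinearOrder I] {σ : I ≃o I} {f : I → I}
  {φ : I → I → R}

theorem mem_range_of_eq (h : SerialSystem R I σ f φ) {i j : I} (hij : φ j j = φ i i)
    (hi : i ∈ Set.range f) : j ∈ Set.range f := by
  obtain ⟨y, rfl⟩ := hi
  obtain ⟨τ, rfl, hτ⟩ := h.conj hij.symm
  exact ⟨τ y, (hτ y).1⟩

theorem corner (h : SerialSystem R I σ f φ) {D ι : Type} [Ring D] [Fintype ι] {g : ι → R}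
    {Θ : ι → ι → R → D} (hΘ : CornerFrame g Θ) (hg : Injective g) {idx : Set.range f → ι}
    (hidx : Surjective idx) (hgi : ∀ i, g (idx i) = φ i i) :
    SerialSystem D (Set.range f) (PeriodicMap.restrictRange f σ h.comm) (fun x => ⟨f x, x, rfl⟩)
      (fun i j => Θ (idx i) (idx j) (φ i j)) where
  toPeriodicMap := h.toPeriodicMap.restrict
  mul {i j k} hij hjk := by
    rw [hΘ.mul, hgi, mul_assoc, h.left_mul hij, h.mul hij hjk]
  eq_zero {i j} hij := by
    rw [hΘ.eq_zero, hgi, hgi, h.left_mul hij, h.right_mul hij]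
    exact h.eq_zero hij
  factor {i j r} hj hi hr := by
    rw [← hgi] at hj hi
    obtain ⟨a, rfl, ha, ha'⟩ := hΘ.exists_eq _ _ r hj hi
    rw [hgi] at ha ha'
    obtain ⟨j', h1, h2, ⟨u, h3⟩, v, h4⟩ := h.factor ha ha' fun h0 => hr ((hΘ.eq_zero _ _ _).2 (by
      rw [h0, mul_zero, zero_mul]))
    have hjj : idx ⟨j', h.mem_range_of_eq h2 j.2⟩ = idx j := hg (by rw [hgi, hgi, h2])
    refine ⟨⟨j', h.mem_range_of_eq h2 j.2⟩, h1, by rw [hjj]; exact congrArg _ h2,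
      ⟨Θ (idx j) (idx j) u, ?_⟩, Θ (idx j) (idx j) v, ?_⟩
    · rw [hjj, hΘ.mul, hgi, mul_assoc, ← h2, h.left_mul h1, ← h3]
    · rw [hjj, hΘ.mul, hgi, mul_assoc, ha, ← h4]
  cofactor {i j r} hj hi hr := by
    rw [← hgi] at hj hi
    obtain ⟨a, rfl, ha, ha'⟩ := hΘ.exists_eq _ _ r hj hi
    rw [hgi] at ha ha'
    obtain ⟨i', h1, h2, ⟨u, h3⟩, v, h4⟩ := h.cofactor ha ha' fun h0 =>
      hr ((hΘ.eq_zero _ _ _).2 (by rw [h0, mul_zero, zero_mul]))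
    have hii : idx ⟨i', h.mem_range_of_eq h2 i.2⟩ = idx i := hg (by rw [hgi, hgi, h2])
    refine ⟨⟨i', h.mem_range_of_eq h2 i.2⟩, h1, by rw [hii]; exact congrArg _ h2,
      ⟨Θ (idx i) (idx i) u, ?_⟩, Θ (idx i) (idx i) v, ?_⟩
    · rw [hii, hΘ.mul, hgi, ← h2, h.right_mul h1, ← h3]
    · rw [hii, hΘ.mul, hgi, ha', ← h4]
  nilp {i j} hij r := by
    set s := idx i
    set t := idx j
    have hs : Θ s s (g s) * Θ s s (g s) = Θ s s (g s) := by
      rw [hΘ.mul, hgi, h.mul_self, h.mul_self]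
    have ht : Θ t t (g t) * Θ t t (g t) = Θ t t (g t) := by
      rw [hΘ.mul, hgi, h.mul_self, h.mul_self]
    obtain ⟨c, hc, -, -⟩ := hΘ.exists_eq t s (Θ s s (g s) * r * Θ t t (g t))
      (by rw [← mul_assoc, ← mul_assoc, hs]) (by rw [mul_assoc, ht])
    have e1 : Θ t t (g t) * Θ s t (φ i j) = Θ s t (φ i j) := by
      rw [hΘ.mul, hgi, h.mul_self, h.left_mul hij.le]
    have e2 : Θ s t (φ i j) * Θ s s (g s) = Θ s t (φ i j) := by
      rw [hΘ.mul, hgi, mul_assoc, h.mul_self, h.right_mul hij.le]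
    suffices hn : IsNilpotent (Θ t s c * Θ s t (φ i j)) by
      rw [← hc, mul_assoc, e1, mul_assoc] at hn
      have := isNilpotent_mul_swap hn
      rwa [mul_assoc, e2] at this
    rw [hΘ.mul, hgi, mul_assoc, h.left_mul hij.le]
    obtain ⟨n, hn⟩ := h.nilp hij c
    have hpow : ∀ m, Θ s s (c * φ i j) ^ (m + 1) = Θ s s ((c * φ i j) ^ (m + 1)) := by
      intro m
      induction m with
      | zero => rw [zero_add, pow_one, pow_one]
      | succ m ih =>
        rw [pow_succ', ih, hΘ.mul, hgi, mul_assoc c, h.right_mul hij.le, ← pow_succ']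
    refine ⟨n + 1, ?_⟩
    rw [hpow, hΘ.eq_zero, pow_succ, hn, zero_mul, mul_zero, zero_mul]
  full := by
    choose k hk using hidx
    refine ⟨Fintype.card ι, fun t => k ((Fintype.equivFin ι).symm t), fun _ => 1, fun _ => 1, ?_⟩
    simp only [one_mul, mul_one, ← hgi, hk]
    rw [← hΘ.sum_eq]
    exact Equiv.sum_comp (Fintype.equivFin ι).symm fun s => Θ s s (g s)
  shift i := by
    have : idx (PeriodicMap.restrictRange f σ h.comm i) = idx i := hg (by
      rw [hgi, hgi]; exact h.shift i)
    rw [this]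
    exact congrArg _ (h.shift i)
  conj {i j} hij := by
    rw [← hgi, ← hgi] at hij
    have := hΘ.eq_of_eq _ _ hij
    obtain ⟨τ, h1, h2⟩ := h.conj (by rw [← hgi, this, hgi] : φ i i = φ j j)
    refine ⟨PeriodicMap.restrictRange f τ fun x => (h2 x).1, Subtype.ext h1, fun x =>
      ⟨Subtype.ext (h2 x).1, ?_⟩⟩
    have hx : idx (PeriodicMap.restrictRange f τ (fun x => (h2 x).1) x) = idx x := hg (by
      rw [hgi, hgi]; exact (h2 x).2)
    rw [hx]
    exact congrArg _ (h2 x).2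

end SerialSystem

theorem radOf_lt_top {R : Type} [Ring R] (M : Type) [AddCommGroup M] [Module R M] [Nontrivial M]
    [Module.Finite R M] : radOf R M < ⊤ := by
  unfold radOf
  rw [Ideal.jacobson_bot]
  exact (Ring.jacobson_smul_top_le R M).trans_lt (Module.jacobson_lt_top R M)

namespace SerialSystem

variable {R : Type} [Ring R] {I : Type} [LinearOrder I] {σ : I ≃o I} {f : I → I}
  {φ : I → I → R} {M S : Type} [AddCommGroup M] [Module R M] [AddCommGroup S] [Module R S]

section

variable (h : SerialSystem R I σ f φ)
include h

theorem smul_mem_radOf {i j : I} (hij : i < j) (x : M) : φ i j • x ∈ radOf R M := by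
  refine Submodule.smul_mem_smul (Ideal.mem_jacobson_iff.2 fun y => ?_) Submodule.mem_top
  obtain ⟨z, hz⟩ := (h.nilp hij y).isUnit_one_add.exists_left_inv
  refine ⟨z, ?_⟩
  rw [mul_add, mul_one] at hz
  rw [Submodule.mem_bot, mul_assoc, add_comm, hz, sub_self]

theorem le_span_of_ne_top {i j : I} (hij : i ⋖ j) {x : M} (hx : φ i i • x = x)
    (hgen : (R ∙ x) = ⊤) {N : Submodule R M} (hN : N ≠ ⊤) : N ≤ R ∙ φ i j • x := by
  obtain ⟨k, hk, -, rfl⟩ := h.exists_eq_span hx (hgen ▸ le_top : N ≤ R ∙ x)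
  refine h.span_antitone x hij.le (hij.ge_of_gt (lt_of_le_of_ne hk ?_))
  rintro rfl
  rw [hx] at hN
  exact hN hgen

theorem isSmallSubmodule_of_ne_top {i : I} {x : M} (hx : φ i i • x = x) (hgen : (R ∙ x) = ⊤)
    {N : Submodule R M} (hN : N ≠ ⊤) : IsSmallSubmodule R N := by
  intro K hK
  rcases h.le_total_of_le_span hx (hgen ▸ le_top : N ≤ R ∙ x) (hgen ▸ le_top : K ≤ R ∙ x) with
    hle | hle
  · rwa [sup_eq_right.2 hle] at hK
  · rw [sup_eq_left.2 hle] at hK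
    exact absurd hK hN

theorem radOf_eq_span {i j : I} (hij : i ⋖ j) {x : M} (hx : φ i i • x = x)
    (hgen : (R ∙ x) = ⊤) (hx0 : x ≠ 0) : radOf R M = R ∙ φ i j • x := by
  have : Nontrivial M := ⟨⟨x, 0, hx0⟩⟩
  have : Module.Finite R M := ⟨⟨{x}, by simpa using hgen⟩⟩
  refine le_antisymm (h.le_span_of_ne_top hij hx hgen (radOf_lt_top M).ne) ?_
  rw [Submodule.span_singleton_le_iff_mem]
  exact h.smul_mem_radOf hij.lt x

theorem isSimpleModule_topOf {i : I} {x : M} (hx : φ i i • x = x)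
    (hgen : (R ∙ x) = ⊤) (hx0 : x ≠ 0) : IsSimpleModule R (topOf R M) ∧
      ∃ y : topOf R M, y ≠ 0 ∧ φ i i • y = y := by
  have : Nontrivial M := ⟨⟨x, 0, hx0⟩⟩
  have : Module.Finite R M := ⟨⟨{x}, by simpa using hgen⟩⟩
  have hlt := radOf_lt_top (R := R) M
  obtain ⟨j, hij⟩ := h.exists_succ i
  constructor
  · refine isSimpleModule_iff_isCoatom.2 ⟨hlt.ne, fun N hN => ?_⟩
    by_contra hN'
    have := h.le_span_of_ne_top hij hx hgen hN'
    rw [← h.radOf_eq_span hij hx hgen hx0] at this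
    exact hN.not_ge this
  · refine ⟨(radOf R M).mkQ x, fun h0 => hlt.not_ge ?_, ?_⟩
    · rw [← hgen, Submodule.span_singleton_le_iff_mem]
      exact (Submodule.Quotient.mk_eq_zero _).1 h0
    · rw [← map_smul, hx]

theorem smul_eq_zero_of_isSimpleModule [IsSimpleModule R S] {i j : I} (hij : i < j) {x : S} :
    φ i j • x = 0 := by
  by_contra h0
  obtain ⟨r, hr⟩ := Submodule.mem_span_singleton.1
    ((IsSimpleModule.span_singleton_eq_top R h0 ▸ Submodule.mem_top : x ∈ R ∙ φ i j • x))
  rw [smul_smul] at hr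
  have := eq_zero_of_isNilpotent_smul_eq (h.nilp hij r) hr
  rw [this, smul_zero] at h0
  exact h0 rfl

theorem eq_of_isSimpleModule [IsSimpleModule R S] {i j : I} {x y : S} (hx : φ i i • x = x)
    (hx0 : x ≠ 0) (hy : φ j j • y = y) (hy0 : y ≠ 0) : φ i i = φ j j := by
  obtain ⟨a, ha⟩ := Submodule.mem_span_singleton.1
    ((IsSimpleModule.span_singleton_eq_top R hx0 ▸ Submodule.mem_top : y ∈ R ∙ x))
  have hr : (φ j j * a * φ i i) • x = y := by rw [mul_smul, mul_smul, hx, ha, hy]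
  obtain ⟨j', h1, h2, ⟨u, h3⟩, -⟩ := h.factor (i := i) (j := j) (r := φ j j * a * φ i i)
    (by rw [← mul_assoc, ← mul_assoc, h.mul_self]) (by rw [mul_assoc, h.mul_self])
    (fun h0 => hy0 (by rw [← hr, h0, zero_smul]))
  rcases h1.eq_or_lt with rfl | hlt
  · exact h2
  · rw [h3, mul_smul, h.smul_eq_zero_of_isSimpleModule hlt, smul_zero] at hr
    exact absurd hr.symm hy0

/-- The simple module `S` is a quotient of the projective `R ∙ φ i i`. -/
theorem exists_surjective_of_isSimpleModule [IsSimpleModule R S] {i : I} {x : S}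
    (hx : φ i i • x = x) (hx0 : x ≠ 0) : ∃ q : (R ∙ φ i i) →ₗ[R] S, Surjective q ∧
      LinearMap.ker q = radOf R (R ∙ φ i i) := by
  let e : R ∙ φ i i := ⟨φ i i, Submodule.mem_span_singleton_self _⟩
  have he : φ i i • e = e := Subtype.ext (h.mul_self i)
  have hgen : (R ∙ e) = ⊤ := eq_top_iff.2 fun y _ => by
    obtain ⟨a, ha⟩ := Submodule.mem_span_singleton.1 y.2
    exact Submodule.mem_span_singleton.2 ⟨a, Subtype.ext ha⟩
  have he0 : e ≠ 0 := fun h0 => h.self_ne_zero i (congrArg Subtype.val h0)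
  let q : (R ∙ φ i i) →ₗ[R] S := (LinearMap.toSpanSingleton R S x).domRestrict _
  have hq : q e = x := hx
  obtain ⟨j, hij⟩ := h.exists_succ i
  refine ⟨q, ?_, ?_⟩
  · rw [← LinearMap.range_eq_top, eq_top_iff, ← IsSimpleModule.span_singleton_eq_top R hx0,
      Submodule.span_singleton_le_iff_mem]
    exact ⟨e, hq⟩
  · rw [h.radOf_eq_span hij he hgen he0]
    refine le_antisymm (h.le_span_of_ne_top hij he hgen fun h0 => hx0 ?_) ?_
    · rw [← hq]
      exact LinearMap.mem_ker.1 (h0 ▸ Submodule.mem_top)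
    · rw [Submodule.span_singleton_le_iff_mem, LinearMap.mem_ker, map_smul]
      exact h.smul_eq_zero_of_isSimpleModule hij.lt

theorem nonempty_equiv_of_isSimpleModule {S' : Type} [AddCommGroup S'] [Module R S']
    [IsSimpleModule R S] [IsSimpleModule R S'] {i : I} {x : S} {y : S'}
    (hx : φ i i • x = x) (hx0 : x ≠ 0) (hy : φ i i • y = y) (hy0 : y ≠ 0) :
    Nonempty (S ≃ₗ[R] S') := by
  obtain ⟨q, hq, hk⟩ := h.exists_surjective_of_isSimpleModule hx hx0
  obtain ⟨q', hq', hk'⟩ := h.exists_surjective_of_isSimpleModule hy hy0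
  exact ⟨(q.quotKerEquivOfSurjective hq).symm ≪≫ₗ Submodule.quotEquivOfEq _ _ (hk.trans hk'.symm)
    ≪≫ₗ q'.quotKerEquivOfSurjective hq'⟩

theorem generator_span (i : I) : ∃ e : R ∙ φ i i, e ≠ 0 ∧ φ i i • e = e ∧ (R ∙ e) = ⊤ := by
  refine ⟨⟨φ i i, Submodule.mem_span_singleton_self _⟩,
    fun h0 => h.self_ne_zero i (congrArg Subtype.val h0), Subtype.ext (h.mul_self i),
    eq_top_iff.2 fun y _ => ?_⟩
  obtain ⟨a, ha⟩ := Submodule.mem_span_singleton.1 y.2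
  exact Submodule.mem_span_singleton.2 ⟨a, Subtype.ext ha⟩

theorem isProjCoverOf {S : ModuleCat.{0} R} [IsSimpleModule R S] {i : I} {x : S}
    (hx : φ i i • x = x) (hx0 : x ≠ 0) : IsProjCoverOf R (ModuleCat.of R (R ∙ φ i i)) S := by
  obtain ⟨q, hq, -⟩ := h.exists_surjective_of_isSimpleModule hx hx0
  obtain ⟨e, he0, he, hgen⟩ := h.generator_span i
  refine ⟨h.projective_span i, (inferInstance : Module.Finite R (R ∙ φ i i)), q, hq, ?_⟩
  refine h.isSmallSubmodule_of_ne_top he hgen fun h0 => hx0 ?_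
  obtain ⟨y, rfl⟩ := hq x
  exact LinearMap.mem_ker.1 (h0 ▸ Submodule.mem_top)

theorem eq_zero_of_smul_eq_zero [Module.Projective R M] {i : I} {x : M} (hx : φ i i • x = x)
    (hgen : (R ∙ x) = ⊤) (hx0 : x ≠ 0) {r : R} (hr : r * φ i i = r) (hrx : r • x = 0) :
    r = 0 := by
  obtain ⟨e, he0, he, hge⟩ := h.generator_span i
  let π : (R ∙ φ i i) →ₗ[R] M := (LinearMap.toSpanSingleton R M x).domRestrict _
  have hπx : x ∈ LinearMap.range π := ⟨⟨φ i i, Submodule.mem_span_singleton_self _⟩, hx⟩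
  have hπ : Surjective π := by
    rw [← LinearMap.range_eq_top, eq_top_iff, ← hgen, Submodule.span_singleton_le_iff_mem]
    exact hπx
  obtain ⟨s, hs⟩ := Module.projective_lifting_property π LinearMap.id hπ
  have hker : LinearMap.ker π ≠ ⊤ := fun h0 => hx0 (by
    obtain ⟨z, hz⟩ := hπx
    rw [← hz]
    exact LinearMap.mem_ker.1 (h0 ▸ Submodule.mem_top))
  have htop : LinearMap.range s = ⊤ := h.isSmallSubmodule_of_ne_top he hge hker _ (by
    refine eq_top_iff.2 fun z _ => Submodule.mem_sup.2 ⟨z - s (π z), ?_, s (π z), ⟨_, rfl⟩,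
      sub_add_cancel _ _⟩
    rw [LinearMap.mem_ker, map_sub, ← LinearMap.comp_apply, hs, LinearMap.id_apply, sub_self])
  obtain ⟨w, hw⟩ : (⟨r, Submodule.mem_span_singleton.2 ⟨r, hr⟩⟩ : R ∙ φ i i) ∈ LinearMap.range s :=
    htop ▸ Submodule.mem_top
  have hw0 : w = 0 := by
    rw [← LinearMap.id_apply (R := R) w, ← hs, LinearMap.comp_apply, hw]
    exact hrx
  rw [hw0, map_zero] at hw
  exact (congrArg Subtype.val hw).symm

theorem socleOf_eq_span (Q : ModuleCat.{0} R) (hQ : Module.Projective R Q) {a p : I} {x : Q}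
    (hx : φ a a • x = x) (hgen : (R ∙ x) = ⊤) (hx0 : x ≠ 0) (hp : p ⋖ f a) (hap : a ≤ p) :
    φ a p • x ≠ 0 ∧ socleOf R Q = R ∙ φ a p • x ∧ IsSimpleModule R (socleOf R Q) := by
  have hne : φ a p • x ≠ 0 := fun h0 => h.ne_zero hap hp.lt
    (h.eq_zero_of_smul_eq_zero hx hgen hx0 (h.right_mul hap) h0)
  have hmin : ∀ N : Submodule R Q, N ≠ ⊥ → (R ∙ φ a p • x) ≤ N := by
    intro N hN
    obtain ⟨k, hk, -, rfl⟩ := h.exists_eq_span hx (hgen ▸ le_top : N ≤ R ∙ x)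
    refine h.span_antitone x hk (hp.le_of_lt ?_)
    by_contra! hle
    rw [(h.eq_zero hk).2 hle, zero_smul, Submodule.span_singleton_eq_bot.2 rfl] at hN
    exact hN rfl
  have hne' : (R ∙ φ a p • x) ≠ ⊥ := fun h0 => hne (Submodule.span_singleton_eq_bot.1 h0)
  have hatom : IsAtom (R ∙ φ a p • x) := ⟨hne', fun N hN => by
    by_contra h0
    exact hN.not_ge (hmin N h0)⟩
  have hEq : socleOf R Q = R ∙ φ a p • x := by
    refine le_antisymm (sSup_le fun N hN => ?_) (le_sSup (isSimpleModule_iff_isAtom.2 hatom))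
    have hN' : IsAtom N := isSimpleModule_iff_isAtom.1 hN
    exact ((hN'.le_iff_eq hne').1 (hmin N hN'.1)).ge
  exact ⟨hne, hEq, by rw [hEq]; exact isSimpleModule_iff_isAtom.2 hatom⟩

theorem isSimpleModule_topOf_radOf (hf : HasInfiniteResolution f) [Module.Projective R M] {p t : I}
    {x : M} (hx : φ p p • x = x) (hgen : (R ∙ x) = ⊤) (hx0 : x ≠ 0) (hpt : p ⋖ t) :
    IsSimpleModule R (topOf R (radOf R M)) ∧
      ∃ y : topOf R (radOf R M), y ≠ 0 ∧ φ t t • y = y := by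
  have hEq := h.radOf_eq_span hpt hx hgen hx0
  have hmem : φ p t • x ∈ radOf R M := h.smul_mem_radOf hpt.lt x
  refine h.isSimpleModule_topOf (x := (⟨φ p t • x, hmem⟩ : radOf R M)) (Subtype.ext ?_) ?_ ?_
  · change φ t t • φ p t • x = φ p t • x
    rw [smul_smul, h.left_mul hpt.le]
  · refine eq_top_iff.2 fun y _ => ?_
    obtain ⟨a, ha⟩ := Submodule.mem_span_singleton.1 (hEq ▸ y.2 : (y : M) ∈ R ∙ φ p t • x)
    exact Submodule.mem_span_singleton.2 ⟨a, Subtype.ext ha⟩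
  · intro h0
    exact h.ne_zero hpt.le (h.lt_map_of_covBy hf hpt) (h.eq_zero_of_smul_eq_zero hx hgen hx0
      (h.right_mul hpt.le) (congrArg Subtype.val h0))

theorem exists_generator_of_isProjCoverOf {P T : ModuleCat.{0} R} (hP : IsProjCoverOf R P T)
    [IsSimpleModule R T] {i : I} {x : T} (hx : φ i i • x = x) (hx0 : x ≠ 0) :
    ∃ y : P, φ i i • y = y ∧ (R ∙ y) = ⊤ ∧ y ≠ 0 := by
  obtain ⟨-, -, q, hq, hsmall⟩ := hP
  obtain ⟨p, hp⟩ := hq x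
  have hqy : q (φ i i • p) = x := by rw [map_smul, hp, hx]
  refine ⟨φ i i • p, by rw [smul_smul, h.mul_self], hsmall _ (eq_top_iff.2 fun z _ => ?_),
    fun h0 => hx0 (by rw [← hqy, h0, map_zero])⟩
  obtain ⟨a, ha⟩ := Submodule.mem_span_singleton.1
    ((IsSimpleModule.span_singleton_eq_top R hx0 ▸ Submodule.mem_top : q z ∈ R ∙ x))
  refine Submodule.mem_sup.2 ⟨z - a • φ i i • p, ?_, a • φ i i • p,
    Submodule.mem_span_singleton.2 ⟨a, rfl⟩, sub_add_cancel _ _⟩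
  rw [LinearMap.mem_ker, map_sub, map_smul, hqy, ha, sub_self]

theorem exists_generator_of_indecomposable (Q : ModuleCat.{0} R) (hQ : Module.Finite R Q)
    (hQi : IndecomposableModule R Q) : ∃ (i : I) (x : Q), φ i i • x = x ∧ (R ∙ x) = ⊤ ∧ x ≠ 0 := by
  have := h.isArtinianRing
  have := h.isNoetherianRing
  have := hQi.1
  obtain ⟨i, x, K, hx, hx0, hK⟩ := h.exists_isCompl_span Q
  refine ⟨i, x, hx, ?_, hx0⟩
  rcases hQi.2 _ _ hK.symm with h0 | h0
  · exact absurd (Submodule.span_singleton_eq_bot.1 h0) hx0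
  · exact h0

theorem isInSPrime_iff (hf : HasInfiniteResolution f) (S : ModuleCat.{0} R) : IsInSPrime R S ↔
    IsSimpleModule R S ∧ ∃ t ∈ Set.range f, ∃ x : S, x ≠ 0 ∧ φ t t • x = x := by
  constructor
  · rintro ⟨hS, T, P, ⟨hT, Q, hQ, hQf, hQi, ⟨g⟩⟩, hP, ⟨g'⟩⟩
    refine ⟨hS, ?_⟩
    obtain ⟨a, x, hx, hgen, hx0⟩ := h.exists_generator_of_indecomposable Q hQf hQi
    obtain ⟨p, hp⟩ := h.exists_pred (f a)
    have hap : a ≤ p := hp.le_of_lt (h.lt_map a)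
    obtain ⟨hy0, hsoc, -⟩ := h.socleOf_eq_span Q hQ hx hgen hx0 hp hap
    let y : socleOf R Q := ⟨φ a p • x, hsoc ▸ Submodule.mem_span_singleton_self _⟩
    have hy : φ p p • y = y := Subtype.ext (by
      change φ p p • φ a p • x = φ a p • x
      rw [smul_smul, h.left_mul hap])
    obtain ⟨w, hw, hwgen, hw0⟩ := h.exists_generator_of_isProjCoverOf hP (i := p) (x := g.symm y)
      (by rw [← map_smul, hy]) (by simpa using fun h0 => hy0 (congrArg Subtype.val h0))
    have := hP.1
    obtain ⟨-, z, hz0, hz⟩ := h.isSimpleModule_topOf_radOf hf hw hwgen hw0 hp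
    exact ⟨f a, ⟨a, rfl⟩, g' z, by simpa using hz0, by rw [← map_smul, hz]⟩
  · rintro ⟨hS, _, ⟨a, rfl⟩, x, hx0, hx⟩
    refine ⟨hS, ?_⟩
    obtain ⟨p, hp⟩ := h.exists_pred (f a)
    have hap : a ≤ p := hp.le_of_lt (h.lt_map a)
    let Q := ModuleCat.of R (R ∙ φ a a)
    obtain ⟨e, he0, he, hge⟩ := h.generator_span a
    obtain ⟨hy0, hsoc, hsimp⟩ := h.socleOf_eq_span Q (h.projective_span a) he hge he0 hp hap
    let T := ModuleCat.of R (socleOf R Q)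
    let y : T := (⟨φ a p • e, hsoc ▸ Submodule.mem_span_singleton_self _⟩ : socleOf R Q)
    have hy : φ p p • y = y := Subtype.ext (by
      change φ p p • φ a p • e = φ a p • e
      rw [smul_smul, h.left_mul hap])
    have : IsSimpleModule R T := hsimp
    obtain ⟨w, hw0, hw, hwgen⟩ := h.generator_span p
    have := h.projective_span p
    obtain ⟨hs, z, hz0, hz⟩ := h.isSimpleModule_topOf_radOf hf hw hwgen hw0 hp
    refine ⟨T, ModuleCat.of R (R ∙ φ p p), ⟨hsimp, Q, h.projective_span a,
      (inferInstance : Module.Finite R (R ∙ φ a a)), ?_, ⟨LinearEquiv.refl R _⟩⟩,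
      h.isProjCoverOf hy fun h0 => hy0 (congrArg Subtype.val h0),
      h.nonempty_equiv_of_isSimpleModule hz hz0 hx hx0⟩
    refine ⟨⟨⟨e, 0, he0⟩⟩, fun N N' hc => ?_⟩
    by_contra! hN
    have := h.isSmallSubmodule_of_ne_top he hge hN.2 N' hc.sup_eq_top
    rw [this] at hc
    exact hN.1 (disjoint_top.1 hc.disjoint)

theorem finite_range_self : (Set.range fun t : Set.range f => φ t t).Finite := by
  have hfin := h.toPeriodicMap.restrict.finite_orbits
  let σ' := PeriodicMap.restrictRange f σ h.comm
  have hshift : ∀ t : Set.range f, φ (σ' t) (σ' t) = φ t t := fun t => h.shift t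
  have hz : ∀ (n : ℤ) (t : Set.range f), φ ((σ'.toEquiv ^ n : Equiv.Perm _) t)
      ((σ'.toEquiv ^ n : Equiv.Perm _) t) = φ t t := by
    intro n
    induction n with
    | zero => intro t; rfl
    | succ n ih => intro t; rw [zpow_add_one, Equiv.Perm.mul_apply, ih]; exact hshift t
    | pred n ih =>
      intro t
      rw [zpow_sub_one, Equiv.Perm.mul_apply, ih]
      have := hshift (σ'.symm t)
      rw [σ'.apply_symm_apply] at this
      exact this.symm
  refine (Set.finite_range (Quotient.lift (s := Equiv.Perm.SameCycle.setoid σ'.toEquiv)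
    (fun t : Set.range f => φ t t) ?_)).subset ?_
  · rintro t _ ⟨n, rfl⟩
    exact (hz n t).symm
  · rintro _ ⟨t, rfl⟩
    exact ⟨Quotient.mk _ t, rfl⟩

theorem exists_syzygyFiltered (hf : HasInfiniteResolution f) :
    ∃ (B : RingCat.{0}) (J : Type) (_ : LinearOrder J) (τ : J ≃o J) (k : J → J) (ψ : J → J → B),
      SerialSystem B J τ k ψ ∧ HasInfiniteResolution k ∧ IsSyzygyFilteredAlgebra R B ∧
        ∀ n : ℕ, finDim B ≤ n ↔ finDim R ≤ (n + 2 : ℕ) := by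
  let ι := Set.range fun t : Set.range f => φ t t
  have : Fintype ι := h.finite_range_self.fintype
  have hι : ∀ s : ι, ∃ t : Set.range f, φ t t = s := fun s => s.2
  obtain ⟨Θ, hΘ⟩ := exists_cornerFrame (fun s : ι => (s : R))
    (fun s => by obtain ⟨t, ht⟩ := hι s; rw [← ht, h.mul_self])
    (fun s => by obtain ⟨t, ht⟩ := hι s; rw [← ht]; exact h.self_ne_zero t)
  have hc := h.corner hΘ Subtype.val_injective (idx := fun t => ⟨φ t t, t, rfl⟩)
    (fun s => by obtain ⟨t, ht⟩ := hι s; exact ⟨t, Subtype.ext ht⟩) fun _ => rfl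
  obtain ⟨u, hu⟩ := hc.exists_adjoint
  have hB := hc.op hu
  have htop : ∀ t : I, IsSimpleModule R (topOf R (R ∙ φ t t)) ∧
      ∃ y : topOf R (R ∙ φ t t), y ≠ 0 ∧ φ t t • y = y := fun t => by
    obtain ⟨e, he0, he, hge⟩ := h.generator_span t
    exact h.isSimpleModule_topOf he hge he0
  refine ⟨RingCat.of (Module.End R (DirectSum ι fun s => ↥(R ∙ (s : R))))ᵐᵒᵖᵐᵒᵖ, _, inferInstance,
    _, _, _, hB, hc.toPeriodicMap.hasInfiniteResolution_dual hu
      (h.hasInfiniteResolution_restrict hf), ?_, fun n => ?_⟩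
  · refine ⟨ι, inferInstance, fun s => ModuleCat.of R (topOf R (R ∙ (s : R))),
      fun s => ModuleCat.of R (R ∙ (s : R)), ?_, ?_, ?_, ⟨(RingEquiv.opOp _).symm⟩⟩
    · rintro ⟨_, t, rfl⟩
      obtain ⟨hs, y, hy0, hy⟩ := htop t
      exact ⟨(h.isInSPrime_iff hf _).2 ⟨hs, t, t.2, y, hy0, hy⟩,
        h.isProjCoverOf (S := ModuleCat.of R (topOf R (R ∙ φ t t))) hy hy0⟩
    · rintro ⟨_, t, rfl⟩ ⟨_, t', rfl⟩ ⟨g⟩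
      obtain ⟨hs, y, hy0, hy⟩ := htop t
      obtain ⟨hs', y', hy0', hy'⟩ := htop t'
      change topOf R (R ∙ φ t t) ≃ₗ[R] topOf R (R ∙ φ t' t') at g
      exact Subtype.ext (h.eq_of_isSimpleModule (x := g y) (by rw [← map_smul, hy])
        (by simpa using hy0) hy' hy0')
    · intro S hS
      obtain ⟨hS, t, ht, x, hx0, hx⟩ := (h.isInSPrime_iff hf S).1 hS
      obtain ⟨hs, y, hy0, hy⟩ := htop t
      exact ⟨⟨φ t t, ⟨t, ht⟩, rfl⟩, h.nonempty_equiv_of_isSimpleModule hx hx0 hy hy0⟩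
  · rw [h.finDim_le_iff, ← h.boundedResolutions_restrict_iff,
      ← hc.toPeriodicMap.boundedResolutions_dual_iff hu]
    exact hB.finDim_le_iff n

end

end SerialSystem

theorem IsIterSyzygyFiltered.zero (A : Type) [Ring A] : IsIterSyzygyFiltered A 0 A :=
  ⟨fun _ => RingCat.of A, ⟨RingEquiv.refl A⟩, ⟨RingEquiv.refl A⟩, fun _ hi => absurd hi (by simp)⟩

theorem IsSyzygyFilteredAlgebra.congr {A B B' : Type} [Ring A] [Ring B] [Ring B']
    (h : IsSyzygyFilteredAlgebra A B) (g : B' ≃+* B) : IsSyzygyFilteredAlgebra A B' := by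
  obtain ⟨ι, hι, Sf, Pf, h1, h2, h3, ⟨g'⟩⟩ := h
  exact ⟨ι, hι, Sf, Pf, h1, h2, h3, ⟨g.trans g'⟩⟩

theorem IsIterSyzygyFiltered.succ {A B C : Type} [Ring A] [Ring B] [Ring C] {d : ℕ}
    (hA : IsCyclicNakayama A) (hsi : ¬ IsSelfinjectiveRing A) (hB : IsSyzygyFilteredAlgebra A B)
    (h : IsIterSyzygyFiltered B d C) : IsIterSyzygyFiltered A (d + 1) C := by
  obtain ⟨X, ⟨g⟩, ⟨g'⟩, hX⟩ := h
  refine ⟨fun n => Nat.casesOn n (RingCat.of A) X, ⟨RingEquiv.refl A⟩, ⟨g'⟩, fun i hi => ?_⟩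
  cases i with
  | zero => exact ⟨hA, hsi, hB.congr g.symm⟩
  | succ i => exact hX i (by omega)

theorem SerialSystem.exists_isIterSyzygyFiltered {R : Type} [Ring R] {I : Type} [LinearOrder I]
    {σ : I ≃o I} {f : I → I} {φ : I → I → R} (h : SerialSystem R I σ f φ)
    (hf : HasInfiniteResolution f) {n : ℕ} (hn : 1 ≤ n) (hR : finDim R = n) :
    ∃ (d : ℕ) (B : RingCat.{0}), IsIterSyzygyFiltered R d B ∧ IsCyclicNakayama B ∧
      1 ≤ finDim B ∧ finDim B ≤ 2 ∧ finDim R = 2 * (d : ℕ∞) + finDim B := by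
  induction n using Nat.strong_induction_on generalizing R I with | _ n ih => ?_
  by_cases hn2 : n ≤ 2
  · refine ⟨0, RingCat.of R, .zero R, h.isCyclicNakayama hf, ?_, ?_, ?_⟩
    · change 1 ≤ finDim R
      rw [hR]
      exact_mod_cast hn
    · change finDim R ≤ 2
      rw [hR]
      exact_mod_cast hn2
    · simp
  obtain ⟨B, J, _, τ, k, ψ, hB, hk, hsyz, hdim⟩ := h.exists_syzygyFiltered hf
  have hBn : finDim B = (n - 2 : ℕ) := by
    refine le_antisymm ((hdim _).2 ?_) ?_
    · rw [hR]
      exact_mod_cast (by omega : n ≤ n - 2 + 2)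
    · obtain ⟨m, hm⟩ := ENat.ne_top_iff_exists.1 hB.finDim_ne_top
      have := (hdim m).1 hm.ge
      rw [hR, Nat.cast_le] at this
      rw [← hm, Nat.cast_le]
      omega
  obtain ⟨d, C, hC, hcyc, h1, h2, h3⟩ := ih (n - 2) (by omega) hB hk (by omega) hBn
  refine ⟨d + 1, C, hC.succ (h.isCyclicNakayama hf) (h.one_le_finDim_iff.1 ?_) hsyz, hcyc, h1, h2, ?_⟩
  · rw [hR]
    exact_mod_cast hn
  · have : (n : ℕ∞) = ((n - 2 : ℕ) : ℕ∞) + 2 := by exact_mod_cast (by omega : n = n - 2 + 2)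
    rw [hR, this, ← hBn, h3]
    push_cast
    ring

/-- Let `Λ` be a cyclic, non-selfinjective Nakayama algebra of
infinite global dimension.  Then there is `d ≥ 0` such that the `d`-th syzygy filtered
algebra `ε^d(Λ)` is a cyclic Nakayama algebra with `1 ≤ findim ε^d(Λ) ≤ 2` and
`findim Λ = 2d + findim ε^d(Λ)`. -/
theorem exists_iter_syzygyFiltered_small_findim
    (A : Type) [Ring A] (hA : IsCyclicNakayama A) (hsi : ¬ IsSelfinjectiveRing A)
    (hgl : globalDim A = ⊤) :
    ∃ (d : ℕ) (B : RingCat.{0}), IsIterSyzygyFiltered A d ↥B ∧ IsCyclicNakayama ↥B ∧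
      1 ≤ finDim ↥B ∧ finDim ↥B ≤ 2 ∧ finDim A = 2 * (d : ℕ∞) + finDim ↥B := by
  have : Nontrivial A := by
    by_contra hA'
    rw [not_nontrivial_iff_subsingleton] at hA'
    exact hsi ⟨fun X Y _ _ _ _ f _ g => ⟨0, fun x => Subsingleton.elim _ _⟩⟩
  obtain ⟨σ, f, φ, h⟩ := hA.exists_serialSystem
  obtain ⟨n, hn⟩ := ENat.ne_top_iff_exists.1 h.finDim_ne_top
  refine h.exists_isIterSyzygyFiltered (h.hasInfiniteResolution_of_globalDim_eq_top hgl) ?_ hn.symm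
  have := h.one_le_finDim_iff.2 hsi
  rw [← hn] at this
  exact_mod_cast this

end
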